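/- Let (R, m) be a commutative Noetherian local ring, let C be a semidualizing R-module, and let M be a non-zero finitely generated Cohen-Macaulay R-module of dimension n. Then the G_C-projective dimension G_C-pd_R(M) is finite if and only if the G_C-flat dimension G_C-fd_R(H^n_m(M)) is finite; furthermore, G_C-fd_R(H^n_m(M)) = G_C-pd_R(M) + n. -/

import Mathlib

/-!
Definitions needed to state results of "On flat and Gorenstein flat dimensions of
local cohomology modules" by M.R. Zargar and H. Zakeri.
-/

open CategoryTheory IsLocalRing

universe u

namespace Paper

variable (R : Type u) [CommRing R]

/-! ## Resolution/coresolution dimensions with respect to a class of modules -/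

/-- `ResDimLE R P n M` : `M` admits a resolution `0 → Xₙ → ⋯ → X₀ → M → 0`
with each `Xᵢ` in the class `P`. -/
def ResDimLE (P : ModuleCat.{u} R → Prop) : ℕ → ModuleCat.{u} R → Prop
  | 0, M => P M
  | n + 1, M => ResDimLE P n M ∨
      ∃ (X : ModuleCat.{u} R) (f : X →ₗ[R] M), P X ∧ Function.Surjective f ∧
        ResDimLE P n (ModuleCat.of R (LinearMap.ker f))

/-- `CoresDimLE R P n M` : `M` admits a coresolution `0 → M → X₀ → ⋯ → Xₙ → 0`
with each `Xᵢ` in the class `P`. -/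
def CoresDimLE (P : ModuleCat.{u} R → Prop) : ℕ → ModuleCat.{u} R → Prop
  | 0, M => P M
  | n + 1, M => CoresDimLE P n M ∨
      ∃ (X : ModuleCat.{u} R) (f : M →ₗ[R] X), P X ∧ Function.Injective f ∧
        CoresDimLE P n (ModuleCat.of R (X ⧸ LinearMap.range f))

/-- The resolution dimension of `M` with respect to the class `P`, as an
extended natural number (`⊤` if there is no finite resolution). -/
noncomputable def ResDim (P : ModuleCat.{u} R → Prop) (M : ModuleCat.{u} R) : ℕ∞ :=
  sInf {n : ℕ∞ | ∃ k : ℕ, (k : ℕ∞) = n ∧ ResDimLE R P k M}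

/-- The coresolution dimension of `M` with respect to the class `P`. -/
noncomputable def CoresDim (P : ModuleCat.{u} R → Prop) (M : ModuleCat.{u} R) : ℕ∞ :=
  sInf {n : ℕ∞ | ∃ k : ℕ, (k : ℕ∞) = n ∧ CoresDimLE R P k M}

/-- Flat dimension `fd_R M`. -/
noncomputable def flatDim (M : Type u) [AddCommGroup M] [Module R M] : ℕ∞ :=
  ResDim R (fun N => Module.Flat R N) (ModuleCat.of R M)

/-- Projective dimension `pd_R M`. -/
noncomputable def projDim (M : Type u) [AddCommGroup M] [Module R M] : ℕ∞ :=
  ResDim R (fun N => Module.Projective R N) (ModuleCat.of R M)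

/-- Injective dimension `id_R M`. -/
noncomputable def injDim (M : Type u) [AddCommGroup M] [Module R M] : ℕ∞ :=
  CoresDim R (fun N => Module.Injective R N) (ModuleCat.of R M)

/-! ## Local cohomology -/

/-- The local cohomology module `H^i_𝔞(M)`, as an object of `ModuleCat R`. -/
noncomputable def lcoh (𝔞 : Ideal R) (i : ℕ) (M : Type u) [AddCommGroup M] [Module R M] :
    ModuleCat.{u} R :=
  (localCohomology 𝔞 i).obj (ModuleCat.of R M)

/-- `M` is relative Cohen-Macaulay with respect to `𝔞` with `ht_M 𝔞 = n`, i.e. the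
`n`-th local cohomology of `M` with respect to `𝔞` is the only non-vanishing one. -/
def IsRelCM (𝔞 : Ideal R) (n : ℕ) (M : Type u) [AddCommGroup M] [Module R M] : Prop :=
  (∀ i : ℕ, i ≠ n → Subsingleton (lcoh R 𝔞 i M)) ∧ ¬ Subsingleton (lcoh R 𝔞 n M)

/-! ## Depth, dimension, Cohen-Macaulay -/

/-- The depth of a module over a local ring: the supremum of the lengths of
`M`-regular sequences contained in the maximal ideal. -/
noncomputable def depth [IsLocalRing R] (M : Type u) [AddCommGroup M] [Module R M] : ℕ∞ :=
  sSup {n : ℕ∞ | ∃ rs : List R, (rs.length : ℕ∞) = n ∧ (∀ x ∈ rs, x ∈ maximalIdeal R) ∧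
    RingTheory.Sequence.IsRegular M rs}

/-- The (Krull) dimension of a module: the Krull dimension of `R` modulo
the annihilator of `M` (`⊥` for the zero module). -/
noncomputable def moduleDim (M : Type u) [AddCommGroup M] [Module R M] : WithBot ℕ∞ :=
  ringKrullDim (R ⧸ Module.annihilator R M)

/-- A finitely generated module over a local ring is Cohen-Macaulay
if its depth equals its dimension. -/
def IsCohenMacaulayModule [IsLocalRing R] (M : Type u) [AddCommGroup M] [Module R M] : Prop :=
  (depth R M : WithBot ℕ∞) = moduleDim R M

/-- A local ring is Cohen-Macaulay if it is so as a module over itself. -/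
def IsCohenMacaulayRing [IsLocalRing R] : Prop := IsCohenMacaulayModule R R

/-- A local ring is Gorenstein if it has finite injective dimension over itself. -/
def IsGorensteinRing : Prop := injDim R R ≠ ⊤

/-! ## Ext, Tor, semidualizing modules -/

/-- `Ext^i_R(A, B)`. -/
noncomputable def ext (i : ℕ) (A B : Type u) [AddCommGroup A] [Module R A]
    [AddCommGroup B] [Module R B] : ModuleCat.{u} R :=
  ((Ext R (ModuleCat.{u} R) i).obj (Opposite.op (ModuleCat.of R A))).obj (ModuleCat.of R B)

/-- `Tor^R_p(A, B)` indexed by `p : ℤ`, with the convention that it vanishes in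
negative degrees. -/
noncomputable def tor (p : ℤ) (A B : Type u) [AddCommGroup A] [Module R A]
    [AddCommGroup B] [Module R B] : ModuleCat.{u} R :=
  if 0 ≤ p then ((Tor (ModuleCat.{u} R) p.toNat).obj (ModuleCat.of R A)).obj (ModuleCat.of R B)
  else ModuleCat.of R PUnit

/-- A finitely generated module `C` is semidualizing if the natural map
`R → Hom_R(C, C)` is bijective and `Ext^i_R(C, C) = 0` for all `i ≥ 1`. -/
def IsSemidualizing (C : Type u) [AddCommGroup C] [Module R C] : Prop :=
  Module.Finite R C ∧
  Function.Bijective (fun r : R => (r • LinearMap.id : C →ₗ[R] C)) ∧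
  ∀ i : ℕ, 1 ≤ i → Subsingleton (ext R i C C)

/-! ## Gorenstein homological classes -/

/-- `N` is Gorenstein injective: it is the kernel of the `0`-th differential of some
exact complex `Y` of injective modules which stays exact under `Hom(I, -)` for every
injective module `I`. (The complex is written cohomologically.) -/
def IsGorensteinInjective (N : Type u) [AddCommGroup N] [Module R N] : Prop :=
  ∃ (Y : ℤ → ModuleCat.{u} R) (d : ∀ i : ℤ, Y i →ₗ[R] Y (i + 1)),
    (∀ i, Module.Injective R (Y i)) ∧
    (∀ i, Function.Exact (d i) (d (i + 1))) ∧
    (∀ (I : ModuleCat.{u} R), Module.Injective R I →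
      ∀ (i : ℤ) (g : I →ₗ[R] Y (i + 1)), (d (i + 1)).comp g = 0 →
        ∃ h : I →ₗ[R] Y i, (d i).comp h = g) ∧
    ∃ ι : N →ₗ[R] Y 0, Function.Injective ι ∧ Function.Exact ι (d 0)

/-- `N` is Gorenstein projective: it is the cokernel of a differential of some
exact complex `X` of projective modules which stays exact under `Hom(-, P)` for
every projective module `P`. -/
def IsGorensteinProjective (N : Type u) [AddCommGroup N] [Module R N] : Prop :=
  ∃ (X : ℤ → ModuleCat.{u} R) (d : ∀ i : ℤ, X i →ₗ[R] X (i + 1)),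
    (∀ i, Module.Projective R (X i)) ∧
    (∀ i, Function.Exact (d i) (d (i + 1))) ∧
    (∀ (P : ModuleCat.{u} R), Module.Projective R P →
      ∀ (i : ℤ) (g : X (i + 1) →ₗ[R] P), g.comp (d i) = 0 →
        ∃ h : X (i + 1 + 1) →ₗ[R] P, h.comp (d (i + 1)) = g) ∧
    ∃ π : X 0 →ₗ[R] N, Function.Surjective π ∧ Function.Exact (d (-1)) π

/-- `N` is Gorenstein flat: it is the cokernel of a differential of some exact
complex `Z` of flat modules which stays exact under `- ⊗ I` for every injective
module `I`. -/
def IsGorensteinFlat (N : Type u) [AddCommGroup N] [Module R N] : Prop :=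
  ∃ (Z : ℤ → ModuleCat.{u} R) (d : ∀ i : ℤ, Z i →ₗ[R] Z (i + 1)),
    (∀ i, Module.Flat R (Z i)) ∧
    (∀ i, Function.Exact (d i) (d (i + 1))) ∧
    (∀ (I : ModuleCat.{u} R), Module.Injective R I →
      ∀ i : ℤ, Function.Exact (LinearMap.rTensor (R := R) I (d i))
        (LinearMap.rTensor (R := R) I (d (i + 1)))) ∧
    ∃ π : Z 0 →ₗ[R] N, Function.Surjective π ∧ Function.Exact (d (-1)) π

/-- Gorenstein injective dimension `Gid_R M`. -/
noncomputable def GinjDim (M : Type u) [AddCommGroup M] [Module R M] : ℕ∞ :=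
  CoresDim R (fun N => IsGorensteinInjective R N) (ModuleCat.of R M)

/-- Gorenstein projective dimension `Gpd_R M`. -/
noncomputable def GprojDim (M : Type u) [AddCommGroup M] [Module R M] : ℕ∞ :=
  ResDim R (fun N => IsGorensteinProjective R N) (ModuleCat.of R M)

/-- Gorenstein flat dimension `Gfd_R M`. -/
noncomputable def GflatDim (M : Type u) [AddCommGroup M] [Module R M] : ℕ∞ :=
  ResDim R (fun N => IsGorensteinFlat R N) (ModuleCat.of R M)

/-! ## `C`-injective, `C`-projective, `C`-flat modules and the `G_C`-classes -/

/-- `N` is `C`-injective if `N ≅ Hom_R(C, I)` for some injective module `I`. -/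
def IsCInjective (C : Type u) [AddCommGroup C] [Module R C]
    (N : Type u) [AddCommGroup N] [Module R N] : Prop :=
  ∃ I : ModuleCat.{u} R, Module.Injective R I ∧ Nonempty (N ≃ₗ[R] (C →ₗ[R] I))

/-- `N` is `C`-projective if `N ≅ C ⊗_R P` for some projective module `P`. -/
def IsCProjective (C : Type u) [AddCommGroup C] [Module R C]
    (N : Type u) [AddCommGroup N] [Module R N] : Prop :=
  ∃ P : ModuleCat.{u} R, Module.Projective R P ∧ Nonempty (N ≃ₗ[R] TensorProduct R C P)

/-- `N` is `C`-flat if `N ≅ C ⊗_R F` for some flat module `F`. -/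
def IsCFlat (C : Type u) [AddCommGroup C] [Module R C]
    (N : Type u) [AddCommGroup N] [Module R N] : Prop :=
  ∃ F : ModuleCat.{u} R, Module.Flat R F ∧ Nonempty (N ≃ₗ[R] TensorProduct R C F)

/-- `C`-injective dimension `cid_R M`. -/
noncomputable def cInjDim (C : Type u) [AddCommGroup C] [Module R C]
    (M : Type u) [AddCommGroup M] [Module R M] : ℕ∞ :=
  CoresDim R (fun N => IsCInjective R C N) (ModuleCat.of R M)

/-- `C`-projective dimension `cpd_R M`. -/
noncomputable def cProjDim (C : Type u) [AddCommGroup C] [Module R C]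
    (M : Type u) [AddCommGroup M] [Module R M] : ℕ∞ :=
  ResDim R (fun N => IsCProjective R C N) (ModuleCat.of R M)

/-- `N` is `G_C`-injective: `N` is the kernel of the `0`-th differential of an exact
complex `Y` (a complete `I_C I`-coresolution) with `Y i` injective in degrees belonging
to the coresolution part and `C`-injective elsewhere, such that `Hom(I', Y)` is exact
for every `C`-injective module `I'`. -/
def IsGCInjective (C : Type u) [AddCommGroup C] [Module R C]
    (N : Type u) [AddCommGroup N] [Module R N] : Prop :=
  ∃ (Y : ℤ → ModuleCat.{u} R) (d : ∀ i : ℤ, Y i →ₗ[R] Y (i + 1)),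
    (∀ i : ℤ, 0 ≤ i → Module.Injective R (Y i)) ∧
    (∀ i : ℤ, i < 0 → IsCInjective R C (Y i)) ∧
    (∀ i, Function.Exact (d i) (d (i + 1))) ∧
    (∀ (I : ModuleCat.{u} R), IsCInjective R C I →
      ∀ (i : ℤ) (g : I →ₗ[R] Y (i + 1)), (d (i + 1)).comp g = 0 →
        ∃ h : I →ₗ[R] Y i, (d i).comp h = g) ∧
    ∃ ι : N →ₗ[R] Y 0, Function.Injective ι ∧ Function.Exact ι (d 0)

/-- `N` is `G_C`-projective: the cokernel of the degree `0` differential of a complete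
`P_C P`-resolution. -/
def IsGCProjective (C : Type u) [AddCommGroup C] [Module R C]
    (N : Type u) [AddCommGroup N] [Module R N] : Prop :=
  ∃ (X : ℤ → ModuleCat.{u} R) (d : ∀ i : ℤ, X i →ₗ[R] X (i + 1)),
    (∀ i : ℤ, i ≤ 0 → Module.Projective R (X i)) ∧
    (∀ i : ℤ, 0 < i → IsCProjective R C (X i)) ∧
    (∀ i, Function.Exact (d i) (d (i + 1))) ∧
    (∀ (Q : ModuleCat.{u} R), IsCProjective R C Q →
      ∀ (i : ℤ) (g : X (i + 1) →ₗ[R] Q), g.comp (d i) = 0 →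
        ∃ h : X (i + 1 + 1) →ₗ[R] Q, h.comp (d (i + 1)) = g) ∧
    ∃ π : X 0 →ₗ[R] N, Function.Surjective π ∧ Function.Exact (d (-1)) π

/-- `N` is `G_C`-flat: the cokernel of the degree `0` differential of a complete
`F_C F`-resolution. -/
def IsGCFlat (C : Type u) [AddCommGroup C] [Module R C]
    (N : Type u) [AddCommGroup N] [Module R N] : Prop :=
  ∃ (Z : ℤ → ModuleCat.{u} R) (d : ∀ i : ℤ, Z i →ₗ[R] Z (i + 1)),
    (∀ i : ℤ, i ≤ 0 → Module.Flat R (Z i)) ∧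
    (∀ i : ℤ, 0 < i → IsCFlat R C (Z i)) ∧
    (∀ i, Function.Exact (d i) (d (i + 1))) ∧
    (∀ (J : ModuleCat.{u} R), IsCInjective R C J →
      ∀ i : ℤ, Function.Exact (LinearMap.rTensor (R := R) J (d i))
        (LinearMap.rTensor (R := R) J (d (i + 1)))) ∧
    ∃ π : Z 0 →ₗ[R] N, Function.Surjective π ∧ Function.Exact (d (-1)) π

/-- `G_C`-injective dimension `Gid_C M`. -/
noncomputable def GCinjDim (C : Type u) [AddCommGroup C] [Module R C]
    (M : Type u) [AddCommGroup M] [Module R M] : ℕ∞ :=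
  CoresDim R (fun N => IsGCInjective R C N) (ModuleCat.of R M)

/-- `G_C`-projective dimension `G_C-pd_R M`. -/
noncomputable def GCprojDim (C : Type u) [AddCommGroup C] [Module R C]
    (M : Type u) [AddCommGroup M] [Module R M] : ℕ∞ :=
  ResDim R (fun N => IsGCProjective R C N) (ModuleCat.of R M)

/-- `G_C`-flat dimension `G_C-fd_R M`. -/
noncomputable def GCflatDim (C : Type u) [AddCommGroup C] [Module R C]
    (M : Type u) [AddCommGroup M] [Module R M] : ℕ∞ :=
  ResDim R (fun N => IsGCFlat R C N) (ModuleCat.of R M)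

end Paper

open Paper IsLocalRing


/-! ## Short exact sequences and vanishing of Ext -/

namespace GCAux

open CategoryTheory

section SES

variable {R : Type u} [CommRing R]

/-- Short exact sequences of modules. -/
structure SES {A B D : Type u} [AddCommGroup A] [AddCommGroup B] [AddCommGroup D]
    [Module R A] [Module R B] [Module R D] (f : A →ₗ[R] B) (g : B →ₗ[R] D) : Prop where
  inj : Function.Injective f
  exact : Function.Exact f g
  surj : Function.Surjective g

variable {A B D A' B' D' Y Z : Type u} [AddCommGroup A] [AddCommGroup B] [AddCommGroup D]
    [Module R A] [Module R B] [Module R D] [AddCommGroup A'] [AddCommGroup B'] [AddCommGroup D']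
    [Module R A'] [Module R B'] [Module R D'] [AddCommGroup Y] [Module R Y]
    [AddCommGroup Z] [Module R Z]
    {f : A →ₗ[R] B} {g : B →ₗ[R] D}

lemma SES.zero (h : SES f g) (a : A) : g (f a) = 0 := h.exact.apply_apply_eq_zero a

lemma SES.lift (h : SES f g) {b : B} (hb : g b = 0) : ∃ a, f a = b := (h.exact b).1 hb

lemma ses_ker {g : B →ₗ[R] D} (hg : Function.Surjective g) :
    SES (LinearMap.ker g).subtype g :=
  ⟨Subtype.val_injective, by
    intro b
    constructor
    · intro hb; exact ⟨⟨b, hb⟩, rfl⟩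
    · rintro ⟨a, rfl⟩; exact a.2, hg⟩

lemma ses_coker {f : A →ₗ[R] B} (hf : Function.Injective f) :
    SES f (LinearMap.range f).mkQ :=
  ⟨hf, by
    intro b
    simp, Submodule.mkQ_surjective _⟩

lemma ses_prod : SES (LinearMap.inl R A B) (LinearMap.snd R A B) :=
  ⟨LinearMap.inl_injective, by
    rintro ⟨a, b⟩
    constructor
    · intro h
      have : b = 0 := h
      subst this
      exact ⟨a, rfl⟩
    · rintro ⟨c, hc⟩
      simp only [LinearMap.inl_apply, Prod.mk.injEq] at hc
      simp [hc.2], LinearMap.snd_surjective⟩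

lemma ses_prod' : SES (LinearMap.inr R A B) (LinearMap.fst R A B) :=
  ⟨LinearMap.inr_injective, by
    rintro ⟨a, b⟩
    constructor
    · intro h
      have : a = 0 := h
      subst this
      exact ⟨b, rfl⟩
    · rintro ⟨c, hc⟩
      simp only [LinearMap.inr_apply, Prod.mk.injEq] at hc
      simp [hc.1], LinearMap.fst_surjective⟩

/-- replace the middle/left/right by isomorphic modules -/
lemma SES.congr (h : SES f g) (eA : A ≃ₗ[R] A') (eB : B ≃ₗ[R] B') (eD : D ≃ₗ[R] D') :
    SES (eB.toLinearMap ∘ₗ f ∘ₗ eA.symm.toLinearMap) (eD.toLinearMap ∘ₗ g ∘ₗ eB.symm.toLinearMap) := by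
  refine ⟨?_, ?_, ?_⟩
  · exact eB.injective.comp (h.inj.comp eA.symm.injective)
  · intro b
    constructor
    · intro hb
      simp only [LinearMap.comp_apply, LinearEquiv.coe_coe, LinearEquiv.map_eq_zero_iff] at hb
      obtain ⟨a, ha⟩ := h.lift hb
      exact ⟨eA a, by simp [ha]⟩
    · rintro ⟨a, rfl⟩
      simp [h.zero]
  · exact eD.surjective.comp (h.surj.comp eB.symm.surjective)

/-- Noether: `B ⊆ L ⊆ Y`. -/
lemma ses_comp {f : A →ₗ[R] B} {g : B →ₗ[R] D} (h : SES f g)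
    {α : B →ₗ[R] Y} {β : Y →ₗ[R] Z} (h' : SES α β) :
    ∃ (Q : ModuleCat.{u} R) (q : Y →ₗ[R] Q) (i : D →ₗ[R] Q) (p : Q →ₗ[R] Z),
      SES (α ∘ₗ f) q ∧ SES i p := by
  let Q := Y ⧸ LinearMap.range (α ∘ₗ f)
  have hp : LinearMap.range (α ∘ₗ f) ≤ LinearMap.ker β := by
    rintro _ ⟨a, rfl⟩
    simp [h'.zero]
  let p : Q →ₗ[R] Z := Submodule.liftQ _ β hp
  let i₀ : B →ₗ[R] Q := (LinearMap.range (α ∘ₗ f)).mkQ ∘ₗ α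
  have hi₀ : LinearMap.ker i₀ = LinearMap.range f := by
    ext b
    rw [LinearMap.mem_ker]
    refine (Submodule.Quotient.mk_eq_zero _).trans ?_
    constructor
    · rintro ⟨a, ha⟩; exact ⟨a, h'.inj ha⟩
    · rintro ⟨a, rfl⟩; exact ⟨a, rfl⟩
  let e : (B ⧸ LinearMap.ker g) ≃ₗ[R] D := g.quotKerEquivOfSurjective h.surj
  have hk : LinearMap.ker g = LinearMap.range f := h.exact.linearMap_ker_eq
  let i : D →ₗ[R] Q := (Submodule.liftQ _ i₀ (by rw [hi₀, hk])) ∘ₗ e.symm.toLinearMap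
  have hi : ∀ b, i (g b) = i₀ b := by
    intro b
    have : e.symm (g b) = Submodule.Quotient.mk b := by
      rw [LinearEquiv.symm_apply_eq]; rfl
    simp [i, this]
  refine ⟨ModuleCat.of R Q, (LinearMap.range (α ∘ₗ f)).mkQ, i, p, ses_coker ?_, ?_, ?_, ?_⟩
  · exact h'.inj.comp h.inj
  · rw [← LinearMap.ker_eq_bot, LinearMap.ker_eq_bot']
    intro d hd
    obtain ⟨b, rfl⟩ := h.surj d
    rw [hi] at hd
    have : b ∈ LinearMap.ker i₀ := hd
    rw [hi₀, ← hk] at this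
    exact this
  · intro q
    obtain ⟨y, rfl⟩ := Submodule.Quotient.mk_surjective _ q
    constructor
    · intro hy
      have : β y = 0 := hy
      obtain ⟨b, rfl⟩ := h'.lift this
      exact ⟨g b, hi b⟩
    · rintro ⟨d, hd⟩
      obtain ⟨b, rfl⟩ := h.surj d
      rw [← hd, hi]
      exact h'.zero b
  · intro z
    obtain ⟨y, rfl⟩ := h'.surj z
    exact ⟨Submodule.Quotient.mk y, rfl⟩

/-- dual Noether: kernels of a composite of epis -/
lemma ses_comp_epi {f : A →ₗ[R] B} {g : B →ₗ[R] D} (h : SES f g)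
    {α : Y →ₗ[R] Z} {β : Z →ₗ[R] B} (h' : SES α β) :
    ∃ (K : ModuleCat.{u} R) (k : K →ₗ[R] Z) (i : Y →ₗ[R] K) (p : K →ₗ[R] A),
      SES k (g ∘ₗ β) ∧ SES i p := by
  let K := LinearMap.ker (g ∘ₗ β)
  let i : Y →ₗ[R] K := LinearMap.codRestrict _ α (fun y => by
    change g (β (α y)) = 0
    rw [h'.zero, map_zero])
  let eA : A ≃ₗ[R] LinearMap.range f := LinearEquiv.ofInjective f h.inj
  let p₀ : K →ₗ[R] LinearMap.range f := LinearMap.codRestrict _ (β ∘ₗ K.subtype) (fun k => by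
    obtain ⟨a, ha⟩ := h.lift (b := β k) (by exact k.2)
    exact ⟨a, ha⟩)
  have hfp : ∀ k : K, f (eA.symm (p₀ k)) = β k := by
    intro k
    have : eA (eA.symm (p₀ k)) = p₀ k := LinearEquiv.apply_symm_apply _ _
    exact congrArg Subtype.val this
  refine ⟨ModuleCat.of R K, K.subtype, i, eA.symm.toLinearMap ∘ₗ p₀,
    ses_ker (h.surj.comp h'.surj), ?_, ?_, ?_⟩
  · intro a b hab
    exact h'.inj (congrArg Subtype.val hab)
  · intro k
    constructor
    · intro hk
      have h1 : β k = 0 := by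
        rw [← hfp k]
        have : eA.symm (p₀ k) = 0 := hk
        rw [this, map_zero]
      obtain ⟨y, hy⟩ := h'.lift h1
      exact ⟨y, Subtype.ext hy⟩
    · rintro ⟨y, rfl⟩
      apply h.inj
      rw [map_zero]
      have := hfp (i y)
      refine Eq.trans this ?_
      exact h'.zero y
  · intro a
    obtain ⟨z, hz⟩ := h'.surj (f a)
    refine ⟨⟨z, ?_⟩, ?_⟩
    · change g (β z) = 0
      rw [hz, h.zero]
    · apply h.inj
      refine (hfp _).trans hz

/-- Pushouts of short exact sequences. -/
lemma exists_pushout (h : SES f g) {α : A →ₗ[R] Y} {β : Y →ₗ[R] Z} (h' : SES α β) :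
    ∃ (E : ModuleCat.{u} R) (iY : Y →ₗ[R] E) (pD : E →ₗ[R] D) (iB : B →ₗ[R] E) (pZ : E →ₗ[R] Z),
      SES iY pD ∧ SES iB pZ ∧ iB ∘ₗ f = iY ∘ₗ α ∧ pD ∘ₗ iB = g ∧ pZ ∘ₗ iY = β := by
  let ρ : A →ₗ[R] Y × B := α.prod (-f)
  let N := LinearMap.range ρ
  let E := (Y × B) ⧸ N
  have h1 : N ≤ LinearMap.ker (g ∘ₗ LinearMap.snd R Y B) := by
    rintro _ ⟨a, rfl⟩
    simp [ρ, h.zero]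
  have h2 : N ≤ LinearMap.ker (β ∘ₗ LinearMap.fst R Y B) := by
    rintro _ ⟨a, rfl⟩
    simp [ρ, h'.zero]
  have hmem : ∀ y b, (Submodule.Quotient.mk (y, b) : E) = 0 ↔ ∃ a, α a = y ∧ - f a = b := by
    intro y b
    rw [Submodule.Quotient.mk_eq_zero]
    simp [N, ρ]
  refine ⟨ModuleCat.of R E, N.mkQ ∘ₗ LinearMap.inl R Y B, N.liftQ _ h1,
    N.mkQ ∘ₗ LinearMap.inr R Y B, N.liftQ _ h2, ⟨?_, ?_, ?_⟩, ⟨?_, ?_, ?_⟩, ?_, ?_, ?_⟩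
  · rw [← LinearMap.ker_eq_bot, LinearMap.ker_eq_bot']
    intro y hy
    obtain ⟨a, ha, hb⟩ := (hmem y 0).1 hy
    have : a = 0 := h.inj (by simpa using hb)
    rw [← ha, this, map_zero]
  · intro e
    obtain ⟨⟨y, b⟩, rfl⟩ := Submodule.Quotient.mk_surjective _ e
    constructor
    · intro he
      have : g b = 0 := he
      obtain ⟨a, rfl⟩ := h.lift this
      refine ⟨y + α a, ?_⟩
      refine (Submodule.Quotient.eq _).2 ?_
      refine ⟨a, ?_⟩
      simp [ρ]
    · rintro ⟨y', hy⟩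
      rw [← hy]
      exact map_zero g
  · intro d
    obtain ⟨b, rfl⟩ := h.surj d
    exact ⟨Submodule.Quotient.mk (0, b), rfl⟩
  · rw [← LinearMap.ker_eq_bot, LinearMap.ker_eq_bot']
    intro b hb
    obtain ⟨a, ha, hb⟩ := (hmem 0 b).1 hb
    have : a = 0 := h'.inj (by simpa using ha)
    rw [← hb, this, map_zero, neg_zero]
  · intro e
    obtain ⟨⟨y, b⟩, rfl⟩ := Submodule.Quotient.mk_surjective _ e
    constructor
    · intro he
      have : β y = 0 := he
      obtain ⟨a, rfl⟩ := h'.lift this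
      refine ⟨b + f a, ?_⟩
      refine (Submodule.Quotient.eq _).2 ?_
      refine ⟨-a, ?_⟩
      simp [ρ]
    · rintro ⟨y', hy⟩
      rw [← hy]
      exact map_zero β
  · intro d
    obtain ⟨b, rfl⟩ := h'.surj d
    exact ⟨Submodule.Quotient.mk (b, 0), rfl⟩
  · ext a
    refine (Submodule.Quotient.eq _).2 ?_
    refine ⟨-a, ?_⟩
    simp [ρ]
  · ext b; rfl
  · ext b; rfl

/-- Pullbacks of short exact sequences. -/
lemma exists_pullback (h : SES f g) {α : Y →ₗ[R] Z} {β : Z →ₗ[R] D} (h' : SES α β) :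
    ∃ (E : ModuleCat.{u} R) (iA : A →ₗ[R] E) (pZ : E →ₗ[R] Z) (iY : Y →ₗ[R] E) (pB : E →ₗ[R] B),
      SES iA pZ ∧ SES iY pB := by
  let E := LinearMap.ker (g ∘ₗ LinearMap.fst R B Z - β ∘ₗ LinearMap.snd R B Z)
  have hE : ∀ b z, (b, z) ∈ E ↔ g b = β z := by
    intro b z
    simp [E, sub_eq_zero]
  refine ⟨ModuleCat.of R E, LinearMap.codRestrict _ (LinearMap.inl R B Z ∘ₗ f) ?_,
    LinearMap.snd R B Z ∘ₗ E.subtype, LinearMap.codRestrict _ (LinearMap.inr R B Z ∘ₗ α) ?_,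
    LinearMap.fst R B Z ∘ₗ E.subtype, ⟨?_, ?_, ?_⟩, ⟨?_, ?_, ?_⟩⟩
  · intro a; exact (hE _ _).2 (by simp [h.zero])
  · intro a; exact (hE _ _).2 (by simp [h'.zero])
  · intro a b hab
    have := congrArg (fun t => (Subtype.val t).1) hab
    exact h.inj this
  · rintro ⟨⟨b, z⟩, hbz⟩
    constructor
    · intro hz
      have hz : z = 0 := hz
      subst hz
      have : g b = 0 := by simpa using (hE _ _).1 hbz
      obtain ⟨a, rfl⟩ := h.lift this
      exact ⟨a, rfl⟩
    · rintro ⟨a, ha⟩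
      rw [← ha]; rfl
  · intro z
    obtain ⟨b, hb⟩ := h.surj (β z)
    exact ⟨⟨(b, z), (hE _ _).2 hb⟩, rfl⟩
  · intro a b hab
    have := congrArg (fun t => (Subtype.val t).2) hab
    exact h'.inj this
  · rintro ⟨⟨b, z⟩, hbz⟩
    constructor
    · intro hz
      have hz : b = 0 := hz
      subst hz
      have : β z = 0 := by simpa using ((hE _ _).1 hbz).symm
      obtain ⟨a, rfl⟩ := h'.lift this
      exact ⟨a, rfl⟩
    · rintro ⟨a, ha⟩
      rw [← ha]; rfl
  · intro z
    obtain ⟨b, hb⟩ := h'.surj (g z)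
    exact ⟨⟨(z, b), (hE _ _).2 hb.symm⟩, rfl⟩

/-- A retraction gives the reversed split sequence and an isomorphism. -/
lemma SES.split (h : SES f g) {r : B →ₗ[R] A} (hr : r ∘ₗ f = LinearMap.id) :
    ∃ s : D →ₗ[R] B, SES s r ∧ g ∘ₗ s = LinearMap.id ∧
      ∃ e : B ≃ₗ[R] A × D, (∀ b, e b = (r b, g b)) := by
  have hr' : ∀ a, r (f a) = a := fun a => LinearMap.congr_fun hr a
  let φ : B →ₗ[R] A × D := r.prod g
  have hφ : Function.Bijective φ := by
    constructor
    · rw [← LinearMap.ker_eq_bot, LinearMap.ker_eq_bot']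
      intro b hb
      have hb : r b = 0 ∧ g b = 0 := Prod.mk_eq_zero.1 hb
      obtain ⟨a, rfl⟩ := h.lift hb.2
      rw [← hr' a, hb.1, map_zero]
    · rintro ⟨a, d⟩
      obtain ⟨b, rfl⟩ := h.surj d
      refine ⟨b + f (a - r b), ?_⟩
      simp [φ, hr', h.zero]
  let e := LinearEquiv.ofBijective φ hφ
  have he : ∀ b, e b = (r b, g b) := fun b => rfl
  have hs : ∀ d, r (e.symm (0, d)) = 0 ∧ g (e.symm (0, d)) = d := by
    intro d
    have := he (e.symm (0, d))
    rw [LinearEquiv.apply_symm_apply] at this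
    simp only [Prod.mk.injEq] at this
    exact ⟨this.1.symm, this.2.symm⟩
  refine ⟨e.symm.toLinearMap ∘ₗ LinearMap.inr R A D, ⟨?_, ?_, ?_⟩, ?_, e, he⟩
  · exact e.symm.injective.comp LinearMap.inr_injective
  · intro b
    constructor
    · intro hb
      refine ⟨g b, ?_⟩
      apply e.injective
      simp [he, hb, hs]
    · rintro ⟨d, rfl⟩
      exact (hs d).1
  · intro a; exact ⟨f a, hr' a⟩
  · ext d; exact (hs d).2

lemma SES.split_of_section (h : SES f g) {s : D →ₗ[R] B} (hs : g ∘ₗ s = LinearMap.id) :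
    Nonempty (B ≃ₗ[R] A × D) := by
  have hs' : ∀ a, g (s a) = a := fun a => LinearMap.congr_fun hs a
  let φ : A × D →ₗ[R] B := f.coprod s
  have hφ : Function.Bijective φ := by
    constructor
    · rw [← LinearMap.ker_eq_bot, LinearMap.ker_eq_bot']
      rintro ⟨a, d⟩ hb
      simp only [φ, LinearMap.coprod_apply] at hb
      have : d = 0 := by
        have := congrArg g hb
        simpa [h.zero, hs'] using this
      subst this
      have : a = 0 := h.inj (by simpa using hb)
      simp [this]
    · intro b
      obtain ⟨a, ha⟩ := h.lift (b := b - s (g b)) (by simp [hs'])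
      exact ⟨(a, g b), by simp [φ, ha]⟩
  exact ⟨(LinearEquiv.ofBijective φ hφ).symm⟩

lemma SES.split_of_projective (h : SES f g) [Module.Projective R D] :
    Nonempty (B ≃ₗ[R] A × D) := by
  obtain ⟨s, hs⟩ := Module.projective_lifting_property g LinearMap.id h.surj
  exact h.split_of_section hs

/-- free covers -/
lemma exists_free_cover (A : Type u) [AddCommGroup A] [Module R A] :
    ∃ (K P : ModuleCat.{u} R) (f : K →ₗ[R] P) (g : P →ₗ[R] A), SES f g ∧ Module.Projective R P := by
  refine ⟨ModuleCat.of R (LinearMap.ker (Finsupp.linearCombination R (id : A → A))),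
    ModuleCat.of R (A →₀ R), _, _, ses_ker (Finsupp.linearCombination_id_surjective R A), ?_⟩
  change Module.Projective R (A →₀ R)
  infer_instance

lemma exists_finite_cover [IsNoetherianRing R] (A : Type u) [AddCommGroup A] [Module R A]
    [Module.Finite R A] :
    ∃ (n : ℕ) (K : ModuleCat.{u} R) (f : K →ₗ[R] (Fin n → R)) (g : (Fin n → R) →ₗ[R] A), SES f g ∧
      Module.Finite R K := by
  obtain ⟨n, g, hg⟩ := Module.Finite.exists_fin' R A
  exact ⟨n, ModuleCat.of R (LinearMap.ker g), _, g, ses_ker hg,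
    inferInstanceAs (Module.Finite R (LinearMap.ker g))⟩

lemma SES.shortExact (h : SES f g) :
    (ShortComplex.mk (ModuleCat.ofHom f) (ModuleCat.ofHom g) (by
      ext a; exact h.zero a)).ShortExact := by
  refine ShortComplex.ShortExact.mk' ?_ ?_ ?_
  · rw [ShortComplex.ShortExact.moduleCat_exact_iff_function_exact]
    exact h.exact
  · exact (ModuleCat.mono_iff_injective _).2 h.inj
  · exact (ModuleCat.epi_iff_surjective _).2 h.surj

end SES

end GCAux

namespace GCAux

open CategoryTheory

section EV

variable {R : Type u} [CommRing R]

variable (R) in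
/-- Vanishing of `Ext^i(A, Y)`. -/
def EV (i : ℕ) (A Y : Type u) [AddCommGroup A] [Module R A] [AddCommGroup Y] [Module R Y] : Prop :=
  Subsingleton (Abelian.Ext (ModuleCat.of R A) (ModuleCat.of R Y) i)

variable (R) in
/-- Vanishing of `Ext^i(A, Y)` for all `i ≥ 1`. -/
def PE (A Y : Type u) [AddCommGroup A] [Module R A] [AddCommGroup Y] [Module R Y] : Prop :=
  ∀ i : ℕ, EV R (i + 1) A Y

variable {A B D A' B' D' Y Y' Z : Type u} [AddCommGroup A] [AddCommGroup B] [AddCommGroup D]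
    [Module R A] [Module R B] [Module R D] [AddCommGroup A'] [AddCommGroup B'] [AddCommGroup D']
    [Module R A'] [Module R B'] [Module R D'] [AddCommGroup Y] [Module R Y]
    [AddCommGroup Y'] [Module R Y'] [AddCommGroup Z] [Module R Z]
    {f : A →ₗ[R] B} {g : B →ₗ[R] D}

open Abelian.Ext in
lemma EV.congr {i : ℕ} (h : EV R i A Y) (e : A ≃ₗ[R] A') (e' : Y ≃ₗ[R] Y') : EV R i A' Y' := by
  unfold EV at *
  refine ⟨fun a b => ?_⟩
  have key : ∀ a : Abelian.Ext (ModuleCat.of R A') (ModuleCat.of R Y') i, a = 0 := by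
    intro a
    have h1 : (mk₀ e.toModuleIso.inv).comp ((mk₀ e.toModuleIso.hom).comp a (zero_add i)) (zero_add i) = a := by
      rw [mk₀_comp_mk₀_assoc, Iso.inv_hom_id, mk₀_id_comp]
    have h2 : (((mk₀ e.toModuleIso.hom).comp a (zero_add i)).comp (mk₀ e'.toModuleIso.inv) (add_zero i)).comp
        (mk₀ e'.toModuleIso.hom) (add_zero i) = (mk₀ e.toModuleIso.hom).comp a (zero_add i) := by
      rw [comp_assoc_of_third_deg_zero, mk₀_comp_mk₀, Iso.inv_hom_id, comp_mk₀_id]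
    have h3 : ((mk₀ e.toModuleIso.hom).comp a (zero_add i)).comp (mk₀ e'.toModuleIso.inv) (add_zero i) = 0 :=
      Subsingleton.elim _ _
    rw [← h1, ← h2, h3, zero_comp, comp_zero]
  rw [key a, key b]

lemma PE.congr (h : PE R A Y) (e : A ≃ₗ[R] A') (e' : Y ≃ₗ[R] Y') : PE R A' Y' :=
  fun i => (h i).congr e e'

lemma PE.congr_left (h : PE R A Y) (e : A ≃ₗ[R] A') : PE R A' Y := h.congr e (LinearEquiv.refl R Y)
lemma PE.congr_right (h : PE R A Y) (e : Y ≃ₗ[R] Y') : PE R A Y' := h.congr (LinearEquiv.refl R A) e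

lemma EV.of_zero {i : ℕ} (h : ∀ x : Abelian.Ext (ModuleCat.of R A) (ModuleCat.of R Y) i, x = 0) :
    EV R i A Y := ⟨fun a b => by rw [h a, h b]⟩

lemma EV.eq_zero {i : ℕ} (h : EV R i A Y) (x : Abelian.Ext (ModuleCat.of R A) (ModuleCat.of R Y) i) :
    x = 0 := by
  unfold EV at h
  exact Subsingleton.elim _ _

lemma EV.mid (h : SES f g) {i : ℕ} (hA : EV R i A Y) (hD : EV R i D Y) : EV R i B Y := by
  refine EV.of_zero fun x => ?_
  obtain ⟨y, rfl⟩ := Abelian.Ext.contravariant_sequence_exact₂ h.shortExact _ x (hA.eq_zero _)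
  rw [hD.eq_zero y, Abelian.Ext.comp_zero]

lemma EV.left (h : SES f g) {i : ℕ} (hB : EV R i B Y) (hD : EV R (i + 1) D Y) : EV R i A Y := by
  refine EV.of_zero fun x => ?_
  obtain ⟨y, rfl⟩ := Abelian.Ext.contravariant_sequence_exact₁ h.shortExact _ x (add_comm 1 i)
    (hD.eq_zero _)
  rw [hB.eq_zero y, Abelian.Ext.comp_zero]

lemma EV.right (h : SES f g) {i : ℕ} (hA : EV R i A Y) (hB : EV R (i + 1) B Y) :
    EV R (i + 1) D Y := by
  refine EV.of_zero fun x => ?_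
  obtain ⟨y, rfl⟩ := Abelian.Ext.contravariant_sequence_exact₃ h.shortExact _ x
    (hB.eq_zero _) (add_comm 1 i)
  rw [hA.eq_zero y, Abelian.Ext.comp_zero]

lemma EV.extend (h : SES f g) (hD : EV R 1 D Y) (φ : A →ₗ[R] Y) : ∃ ψ : B →ₗ[R] Y, ψ ∘ₗ f = φ := by
  obtain ⟨y, hy⟩ := Abelian.Ext.contravariant_sequence_exact₁ h.shortExact _
    (Abelian.Ext.mk₀ (ModuleCat.ofHom φ)) (add_zero 1) (hD.eq_zero _)
  obtain ⟨ψ, rfl⟩ := Abelian.Ext.homEquiv₀.symm.surjective y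
  refine ⟨ψ.hom, ?_⟩
  simp only [Abelian.Ext.homEquiv₀_symm_apply, Abelian.Ext.mk₀_comp_mk₀] at hy
  have := (Abelian.Ext.mk₀_bijective _ _).1 hy
  exact congrArg ModuleCat.Hom.hom this

lemma EV.of_extend (h : SES f g) (hB : EV R 1 B Y)
    (hex : ∀ φ : A →ₗ[R] Y, ∃ ψ : B →ₗ[R] Y, ψ ∘ₗ f = φ) : EV R 1 D Y := by
  refine EV.of_zero fun x => ?_
  obtain ⟨y, rfl⟩ := Abelian.Ext.contravariant_sequence_exact₃ h.shortExact _ x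
    (hB.eq_zero _) (add_zero 1)
  obtain ⟨φ, rfl⟩ := Abelian.Ext.homEquiv₀.symm.surjective y
  obtain ⟨ψ, hψ⟩ := hex φ.hom
  have : φ = ModuleCat.ofHom f ≫ ModuleCat.ofHom ψ := by
    ext a; exact (LinearMap.congr_fun hψ a).symm
  subst this
  rw [Abelian.Ext.homEquiv₀_symm_apply, ← Abelian.Ext.mk₀_comp_mk₀,
    ← Abelian.Ext.comp_assoc (a₁₂ := 1) (a₂₃ := 0) _ _ _ (by simp) (by simp) (by simp)]
  erw [h.shortExact.extClass_comp]
  rw [Abelian.Ext.zero_comp]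

lemma EV.of_projective [Module.Projective R A] (i : ℕ) : EV R (i + 1) A Y := by
  haveI : Projective (ModuleCat.of R A) :=
    (IsProjective.iff_projective A).1 inferInstance
  exact EV.of_zero fun x => Abelian.Ext.eq_zero_of_projective x

lemma PE.of_projective [Module.Projective R A] : PE R A Y := fun _ => EV.of_projective _

lemma PE.mid (h : SES f g) (hA : PE R A Y) (hD : PE R D Y) : PE R B Y :=
  fun i => (hA i).mid h (hD i)

lemma PE.left (h : SES f g) (hB : PE R B Y) (hD : PE R D Y) : PE R A Y :=
  fun i => (hB i).left h (hD (i + 1))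

lemma PE.right (h : SES f g) (hA : PE R A Y) (hB : PE R B Y)
    (hex : ∀ φ : A →ₗ[R] Y, ∃ ψ : B →ₗ[R] Y, ψ ∘ₗ f = φ) : PE R D Y
  | 0 => (hB 0).of_extend h hex
  | (i + 1) => (hA i).right h (hB (i + 1))

lemma PE.extend (h : SES f g) (hD : PE R D Y) (φ : A →ₗ[R] Y) : ∃ ψ : B →ₗ[R] Y, ψ ∘ₗ f = φ :=
  (hD 0).extend h φ

lemma PE.of_subsingleton [Subsingleton A] : PE R A Y := PE.of_projective

/-- covariant: middle term -/
lemma EV.mid_right (h : SES f g) {X : Type u} [AddCommGroup X] [Module R X] {i : ℕ}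
    (hA : EV R i X A) (hD : EV R i X D) : EV R i X B := by
  refine EV.of_zero fun x => ?_
  obtain ⟨y, rfl⟩ := Abelian.Ext.covariant_sequence_exact₂ _ h.shortExact x (hD.eq_zero _)
  rw [hA.eq_zero y, Abelian.Ext.zero_comp]

/-- dimension shifting induction principle : to prove vanishing for a class closed under
syzygies -/
lemma PE.of_syzygy {Φ : ModuleCat.{u} R → Prop} {Ψ : ModuleCat.{u} R → Prop}
    (H : ∀ A : ModuleCat.{u} R, Φ A → ∃ (K P : ModuleCat.{u} R) (f : K →ₗ[R] P) (g : P →ₗ[R] A),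
      SES f g ∧ Φ K ∧ ∀ Y, Ψ Y → PE R P Y ∧ ∀ φ : K →ₗ[R] Y, ∃ ψ : P →ₗ[R] Y, ψ ∘ₗ f = φ)
    (A Y : ModuleCat.{u} R) (hA : Φ A) (hY : Ψ Y) : PE R A Y := by
  intro i
  induction i generalizing A with
  | zero =>
    obtain ⟨K, P, f, g, hs, _, h⟩ := H A hA
    exact ((h Y hY).1 0).of_extend hs (h Y hY).2
  | succ i ih =>
    obtain ⟨K, P, f, g, hs, hK, h⟩ := H A hA
    exact (ih K hK).right hs ((h Y hY).1 (i + 1))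

/-- Extensions as kernels. -/
lemma ext_to_ker (h : SES f g) {α : A →ₗ[R] Y} {β : Y →ₗ[R] Z} (h' : SES α β) (hD : EV R 1 D Y) :
    ∃ (i : B →ₗ[R] Y × D) (p : Y × D →ₗ[R] Z), SES i p := by
  obtain ⟨E, iY, pD, iB, pZ, h1, h2, -⟩ := exists_pushout h h'
  obtain ⟨r, hr⟩ := hD.extend h1 LinearMap.id
  obtain ⟨s, -, -, e, -⟩ := h1.split hr
  exact ⟨_, _, h2.congr (LinearEquiv.refl R B) e (LinearEquiv.refl R Z)⟩

lemma EV.split_rev (h : SES f g) (hD : EV R 1 D A) : ∃ (s : D →ₗ[R] B) (r : B →ₗ[R] A), SES s r := by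
  obtain ⟨r, hr⟩ := hD.extend h LinearMap.id
  obtain ⟨s, hs, -⟩ := h.split hr
  exact ⟨s, r, hs⟩

end EV

end GCAux

namespace GCAux

open CategoryTheory

section W

variable {R : Type u} [CommRing R]

/-- Modules `A` with `Ext^{≥1}(A, 𝒴) = 0` having a coresolution by modules in `𝒵`
all of whose cosyzygies have the same property (a coinductive definition). -/
def IsW (𝒴 𝒵 : ModuleCat.{u} R → Prop) (A : Type u) [AddCommGroup A] [Module R A] : Prop :=
  ∃ Φ : ModuleCat.{u} R → Prop, Φ (ModuleCat.of R A) ∧ ∀ B : ModuleCat.{u} R, Φ B →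
    (∀ Y : ModuleCat.{u} R, 𝒴 Y → PE R B Y) ∧
    ∃ (Z D : ModuleCat.{u} R) (f : B →ₗ[R] Z) (g : Z →ₗ[R] D), SES f g ∧ 𝒵 Z ∧ Φ D

variable {𝒴 𝒵 𝒴' 𝒵' : ModuleCat.{u} R → Prop}

variable {A B D A' B' D' Y Y' Z : Type u} [AddCommGroup A] [AddCommGroup B] [AddCommGroup D]
    [Module R A] [Module R B] [Module R D] [AddCommGroup A'] [AddCommGroup B'] [AddCommGroup D']
    [Module R A'] [Module R B'] [Module R D'] [AddCommGroup Y] [Module R Y]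
    [AddCommGroup Y'] [Module R Y'] [AddCommGroup Z] [Module R Z]
    {f : A →ₗ[R] B} {g : B →ₗ[R] D}

lemma IsW.pe (h : IsW 𝒴 𝒵 A) (Y : ModuleCat.{u} R) (hY : 𝒴 Y) : PE R A Y := by
  obtain ⟨Φ, hA, H⟩ := h
  exact (H _ hA).1 Y hY

lemma IsW.step (h : IsW 𝒴 𝒵 A) :
    ∃ (Z D : ModuleCat.{u} R) (f : A →ₗ[R] Z) (g : Z →ₗ[R] D), SES f g ∧ 𝒵 Z ∧ IsW 𝒴 𝒵 D := by
  obtain ⟨Φ, hA, H⟩ := h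
  obtain ⟨_, Z, D, f, g, hs, hZ, hD⟩ := H _ hA
  exact ⟨Z, D, f, g, hs, hZ, Φ, hD, H⟩

lemma IsW.mono (h : IsW 𝒴 𝒵 A) (hy : ∀ B Y : ModuleCat.{u} R, IsW 𝒴 𝒵 B → 𝒴' Y → PE R B Y)
    (hz : ∀ Z, 𝒵 Z → 𝒵' Z) :
    IsW 𝒴' 𝒵' A := by
  refine ⟨fun B => IsW 𝒴 𝒵 B, h, fun B hB => ⟨fun Y hY => hy B Y hB hY, ?_⟩⟩
  obtain ⟨Z, D, f, g, hs, hZ, hD⟩ := hB.step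
  exact ⟨Z, D, f, g, hs, hz _ hZ, hD⟩

lemma IsW.congr (h : IsW 𝒴 𝒵 A) (e : A ≃ₗ[R] A') : IsW 𝒴 𝒵 A' := by
  refine ⟨fun B => ∃ A : ModuleCat.{u} R, IsW 𝒴 𝒵 A ∧ Nonempty (A ≃ₗ[R] B),
    ⟨ModuleCat.of R A, h, ⟨e⟩⟩, ?_⟩
  rintro B ⟨A, hA, ⟨e⟩⟩
  refine ⟨fun Y hY => (hA.pe Y hY).congr_left e, ?_⟩
  obtain ⟨Z, D, f, g, hs, hZ, hD⟩ := hA.step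
  exact ⟨Z, D, _, _, hs.congr e (LinearEquiv.refl R _) (LinearEquiv.refl R _), hZ, D, hD,
    ⟨LinearEquiv.refl R D⟩⟩

/-- The properties of the class `𝒴` used below. -/
structure Good (𝒴 : ModuleCat.{u} R → Prop) : Prop where
  prod : ∀ Y Y' : ModuleCat.{u} R, 𝒴 Y → 𝒴 Y' → 𝒴 (ModuleCat.of R (Y × Y'))
  zero : ∃ Y : ModuleCat.{u} R, 𝒴 Y ∧ Subsingleton Y
  perp : ∀ Y Y' : ModuleCat.{u} R, 𝒴 Y → 𝒴 Y' → PE R Y Y'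

lemma ses_zero {Y Z : Type u} [AddCommGroup Y] [Module R Y] [AddCommGroup Z] [Module R Z]
    [Subsingleton Z] : SES (LinearMap.id : Y →ₗ[R] Y) (0 : Y →ₗ[R] Z) :=
  ⟨fun _ _ h => h, fun y => by simp, fun z => ⟨0, Subsingleton.elim _ _⟩⟩

lemma Good.mem (hg : Good 𝒴) {Y : ModuleCat.{u} R} (hY : 𝒴 Y) : IsW 𝒴 𝒴 Y := by
  refine ⟨𝒴, hY, fun B hB => ⟨fun Y hY => hg.perp B Y hB hY, ?_⟩⟩
  obtain ⟨Z, hZ, hs⟩ := hg.zero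
  exact ⟨B, Z, LinearMap.id, 0, ses_zero, hB, hZ⟩

lemma IsW.prod (hg : Good 𝒴) (hA : IsW 𝒴 𝒴 A) (hB : IsW 𝒴 𝒴 B) : IsW 𝒴 𝒴 (A × B) := by
  refine ⟨fun E => ∃ A B : ModuleCat.{u} R, IsW 𝒴 𝒴 A ∧ IsW 𝒴 𝒴 B ∧ Nonempty (E ≃ₗ[R] A × B),
    ⟨ModuleCat.of R A, ModuleCat.of R B, hA, hB, ⟨LinearEquiv.refl R _⟩⟩, ?_⟩
  rintro E ⟨A, B, hA, hB, ⟨e⟩⟩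
  refine ⟨fun Y hY => ((hA.pe Y hY).mid ses_prod (hB.pe Y hY)).congr_left e.symm, ?_⟩
  obtain ⟨Z, D, f, g, hs, hZ, hD⟩ := hA.step
  obtain ⟨Z', D', f', g', hs', hZ', hD'⟩ := hB.step
  have h : SES (f.prodMap f') (g.prodMap g') := by
    refine ⟨?_, ?_, ?_⟩
    · exact Function.Injective.prodMap hs.inj hs'.inj
    · rintro ⟨a, b⟩
      constructor
      · intro h
        obtain ⟨x, rfl⟩ := hs.lift (congrArg Prod.fst h)
        obtain ⟨y, rfl⟩ := hs'.lift (congrArg Prod.snd h)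
        exact ⟨(x, y), rfl⟩
      · rintro ⟨⟨x, y⟩, h⟩
        rw [← h]
        simp [hs.zero, hs'.zero]
    · exact Function.Surjective.prodMap hs.surj hs'.surj
  exact ⟨ModuleCat.of R (Z × Z'), ModuleCat.of R (D × D'), _, _,
    h.congr e.symm (LinearEquiv.refl R _) (LinearEquiv.refl R _), hg.prod _ _ hZ hZ',
    D, D', hD, hD', ⟨LinearEquiv.refl R _⟩⟩

lemma IsW.ker (hg : Good 𝒴) (h : SES f g) (hB : IsW 𝒴 𝒴 B) (hD : IsW 𝒴 𝒴 D) : IsW 𝒴 𝒴 A := by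
  refine ⟨fun A => ∃ (B D : ModuleCat.{u} R) (f : A →ₗ[R] B) (g : B →ₗ[R] D), SES f g ∧
    IsW 𝒴 𝒴 B ∧ IsW 𝒴 𝒴 D, ⟨ModuleCat.of R B, ModuleCat.of R D, f, g, h, hB, hD⟩, ?_⟩
  rintro A ⟨B, D, f, g, h, hB, hD⟩
  refine ⟨fun Y hY => (hB.pe Y hY).left h (hD.pe Y hY), ?_⟩
  obtain ⟨Y, L, α, β, hs, hY, hL⟩ := hB.step
  obtain ⟨Q, q, i, p, h1, h2⟩ := ses_comp h hs
  obtain ⟨Y', L', α', β', hs', hY', hL'⟩ := hD.step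
  obtain ⟨j, k, h3⟩ := ext_to_ker h2 hs' (hL.pe Y' hY' 0)
  exact ⟨Y, Q, _, _, h1, hY, ModuleCat.of R (Y' × L), L', j, k, h3, (hg.mem hY').prod hg hL, hL'⟩

lemma IsW.ext (hg : Good 𝒴) (h : SES f g) (hA : IsW 𝒴 𝒴 A) (hD : IsW 𝒴 𝒴 D) : IsW 𝒴 𝒴 B := by
  obtain ⟨Y, L, α, β, hs, hY, hL⟩ := hA.step
  obtain ⟨j, k, h3⟩ := ext_to_ker h hs (hD.pe Y hY 0)
  exact IsW.ker hg h3 ((hg.mem hY).prod hg hD) hL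

lemma IsW.trans (hg : Good 𝒴) (hz : ∀ Z, 𝒵 Z → IsW 𝒴 𝒴 Z) (hA : IsW 𝒴 𝒵 A) : IsW 𝒴 𝒴 A := by
  refine ⟨fun B => ∃ (A D : ModuleCat.{u} R) (f : A →ₗ[R] B) (g : B →ₗ[R] D), SES f g ∧
    IsW 𝒴 𝒵 A ∧ IsW 𝒴 𝒴 D, ?_, ?_⟩
  · obtain ⟨Z, hZ, hs⟩ := hg.zero
    exact ⟨ModuleCat.of R A, Z, LinearMap.id, 0, ses_zero, hA, hg.mem hZ⟩
  · rintro B ⟨A, D, f, g, h, hA, hD⟩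
    refine ⟨fun Y hY => (hA.pe Y hY).mid h (hD.pe Y hY), ?_⟩
    obtain ⟨Z, A₁, α, β, hs, hZ, hA₁⟩ := hA.step
    obtain ⟨E, iY, pD, iB, pZ, h1, h2, -⟩ := exists_pushout h hs
    have hE : IsW 𝒴 𝒴 E := IsW.ext hg h1 (hz _ hZ) hD
    obtain ⟨Y, E₁, γ, δ, hs', hY, hE₁⟩ := hE.step
    obtain ⟨Q, q, i, p, h3, h4⟩ := ses_comp h2 hs'
    exact ⟨Y, Q, _, _, h3, hY, A₁, E₁, i, p, h4, hA₁, hE₁⟩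

lemma IsW.cok (hg : Good 𝒴) (h : SES f g) (hA : IsW 𝒴 𝒴 A) (hB : IsW 𝒴 𝒴 B)
    (hD : ∀ Y : ModuleCat.{u} R, 𝒴 Y → PE R D Y) : IsW 𝒴 𝒴 D := by
  obtain ⟨Y, L, α, β, hs, hY, hL⟩ := hA.step
  obtain ⟨E, iY, pD, iB, pZ, h1, h2, -⟩ := exists_pushout h hs
  have hE : IsW 𝒴 𝒴 E := IsW.ext hg h2 hB hL
  obtain ⟨s, r, h3⟩ := EV.split_rev h1 (hD Y hY 0)
  exact IsW.ker hg h3 hE (hg.mem hY)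

end W

section Syz

variable {R : Type u} [CommRing R]

/-- resolving classes -/
structure Resolving (𝒲 : ModuleCat.{u} R → Prop) : Prop where
  congr : ∀ A B : ModuleCat.{u} R, 𝒲 A → (A ≃ₗ[R] B) → 𝒲 B
  proj : ∀ A : ModuleCat.{u} R, Module.Projective R A → 𝒲 A
  ext : ∀ (A B D : ModuleCat.{u} R) (f : A →ₗ[R] B) (g : B →ₗ[R] D), SES f g → 𝒲 A → 𝒲 D → 𝒲 B
  ker : ∀ (A B D : ModuleCat.{u} R) (f : A →ₗ[R] B) (g : B →ₗ[R] D), SES f g → 𝒲 B → 𝒲 D → 𝒲 A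

lemma Resolving.of_isW {𝒴 : ModuleCat.{u} R → Prop} (hg : Good 𝒴)
    (hp : ∀ A : ModuleCat.{u} R, Module.Projective R A → IsW 𝒴 𝒴 A) :
    Resolving (fun A : ModuleCat.{u} R => IsW 𝒴 𝒴 A) :=
  ⟨fun _ _ h e => h.congr e, hp, fun _ _ _ _ _ h => IsW.ext hg h, fun _ _ _ _ _ h => IsW.ker hg h⟩

/-- dimension defined by projective syzygies -/
def Syz (𝒲 : ModuleCat.{u} R → Prop) : ℕ → ModuleCat.{u} R → Prop
  | 0, A => 𝒲 A
  | n + 1, A => ∃ (K P : ModuleCat.{u} R) (f : K →ₗ[R] P) (g : P →ₗ[R] A), SES f g ∧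
      Module.Projective R P ∧ Syz 𝒲 n K

variable {𝒲 : ModuleCat.{u} R → Prop} (hw : Resolving 𝒲)

include hw in
lemma Syz.congr {n : ℕ} {A B : ModuleCat.{u} R} (h : Syz 𝒲 n A) (e : A ≃ₗ[R] B) : Syz 𝒲 n B := by
  cases n with
  | zero => exact hw.congr _ _ h e
  | succ n =>
    obtain ⟨K, P, f, g, hs, hP, hK⟩ := h
    exact ⟨K, P, _, _, hs.congr (LinearEquiv.refl R _) (LinearEquiv.refl R _) e, hP, hK⟩

include hw in
lemma Syz.succ {n : ℕ} {A : ModuleCat.{u} R} (h : Syz 𝒲 n A) : Syz 𝒲 (n + 1) A := by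
  induction n generalizing A with
  | zero =>
    obtain ⟨K, P, f, g, hs, hP⟩ := exists_free_cover (R := R) A
    exact ⟨K, P, f, g, hs, hP, hw.ker _ _ _ _ _ hs (hw.proj _ hP) h⟩
  | succ n ih =>
    obtain ⟨K, P, f, g, hs, hP, hK⟩ := h
    exact ⟨K, P, f, g, hs, hP, ih hK⟩

include hw in
lemma Syz.of_mem {A : ModuleCat.{u} R} (h : 𝒲 A) : ∀ n : ℕ, Syz 𝒲 n A
  | 0 => h
  | n + 1 => (Syz.of_mem h n).succ hw

include hw in
lemma Syz.prod_proj {n : ℕ} {A P : ModuleCat.{u} R} (h : Syz 𝒲 n A) (hP : Module.Projective R P) :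
    Syz 𝒲 n (ModuleCat.of R (A × P)) := by
  cases n with
  | zero => exact hw.ext A (ModuleCat.of R (A × P)) P _ _ ses_prod h (hw.proj _ hP)
  | succ n =>
    obtain ⟨K, Q, f, g, hs, hQ, hK⟩ := h
    refine ⟨K, ModuleCat.of R (Q × P), LinearMap.inl R Q P ∘ₗ f, g.prodMap LinearMap.id, ⟨?_, ?_, ?_⟩,
      ?_, hK⟩
    · exact LinearMap.inl_injective.comp hs.inj
    · rintro ⟨q, p⟩
      constructor
      · intro h
        obtain ⟨x, rfl⟩ := hs.lift (congrArg Prod.fst h)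
        have : p = 0 := congrArg Prod.snd h
        subst this
        exact ⟨x, rfl⟩
      · rintro ⟨x, hx⟩
        rw [← hx]
        exact Prod.ext (hs.zero x) rfl
    · exact Function.Surjective.prodMap hs.surj Function.surjective_id
    · change Module.Projective R (Q × P)
      infer_instance

/-- kernel statement in degree `n` -/
def SyzKer (𝒲 : ModuleCat.{u} R → Prop) (n : ℕ) : Prop :=
  ∀ (A B D : ModuleCat.{u} R) (f : A →ₗ[R] B) (g : B →ₗ[R] D), SES f g → Syz 𝒲 n B → Syz 𝒲 n D →
    Syz 𝒲 n A

include hw in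
lemma SyzKer.cok {n : ℕ} (hn : SyzKer 𝒲 n) {A B D : ModuleCat.{u} R} {f : A →ₗ[R] B} {g : B →ₗ[R] D}
    (h : SES f g) (hA : Syz 𝒲 n A) (hB : Syz 𝒲 n B) : Syz 𝒲 (n + 1) D := by
  obtain ⟨K, P, f', g', hs, hP⟩ := exists_free_cover (R := R) D
  obtain ⟨E, iA, pZ, iY, pB, h1, h2⟩ := exists_pullback h hs
  obtain ⟨e⟩ := h1.split_of_projective
  have hE : Syz 𝒲 n E := (hA.prod_proj hw hP).congr hw e.symm
  exact ⟨K, P, f', g', hs, hP, hn _ _ _ _ _ h2 hE hB⟩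

include hw in
lemma SyzKer.indep {n : ℕ} (hn : SyzKer 𝒲 n) {K P A : ModuleCat.{u} R} {f : K →ₗ[R] P} {g : P →ₗ[R] A}
    (h : SES f g) (hP : Module.Projective R P) (hA : Syz 𝒲 (n + 1) A) : Syz 𝒲 n K := by
  obtain ⟨K', P', f', g', hs, hP', hK'⟩ := hA
  obtain ⟨E, iA, pZ, iY, pB, h1, h2⟩ := exists_pullback h hs
  obtain ⟨e⟩ := h2.split_of_projective
  have hE : Syz 𝒲 n E := (hK'.prod_proj hw hP).congr hw e.symm
  exact hn _ _ _ _ _ h1 hE (Syz.of_mem hw (hw.proj _ hP') n)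

include hw in
lemma syzKer (n : ℕ) : SyzKer 𝒲 n := by
  induction n with
  | zero => exact fun A B D f g h hB hD => hw.ker A B D f g h hB hD
  | succ n ih =>
    intro A B D f g h hB hD
    obtain ⟨K, P, f', g', hs, hP⟩ := exists_free_cover (R := R) B
    obtain ⟨L, k, i, p, h1, h2⟩ := ses_comp_epi h hs
    exact ih.cok hw h2 (ih.indep hw hs hP hB) (ih.indep hw h1 hP hD)

include hw in
lemma Syz.ker {n : ℕ} {A B D : ModuleCat.{u} R} {f : A →ₗ[R] B} {g : B →ₗ[R] D}
    (h : SES f g) (hB : Syz 𝒲 n B) (hD : Syz 𝒲 n D) : Syz 𝒲 n A :=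
  syzKer hw n _ _ _ _ _ h hB hD

include hw in
lemma Syz.cok {n : ℕ} {A B D : ModuleCat.{u} R} {f : A →ₗ[R] B} {g : B →ₗ[R] D}
    (h : SES f g) (hA : Syz 𝒲 n A) (hB : Syz 𝒲 n B) : Syz 𝒲 (n + 1) D :=
  (syzKer hw n).cok hw h hA hB

include hw in
lemma Syz.indep {n : ℕ} {K P A : ModuleCat.{u} R} {f : K →ₗ[R] P} {g : P →ₗ[R] A}
    (h : SES f g) (hP : Module.Projective R P) (hA : Syz 𝒲 (n + 1) A) : Syz 𝒲 n K :=
  (syzKer hw n).indep hw h hP hA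

lemma ResDimLE.congr' (hc : ∀ A B : ModuleCat.{u} R, 𝒲 A → (A ≃ₗ[R] B) → 𝒲 B) {n : ℕ}
    {A B : ModuleCat.{u} R} (h : ResDimLE R 𝒲 n A) (e : A ≃ₗ[R] B) : ResDimLE R 𝒲 n B := by
  induction n generalizing A B with
  | zero => exact hc _ _ h e
  | succ n ih =>
    rcases h with h | ⟨X, f, hX, hf, hK⟩
    · exact Or.inl (ih h e)
    · refine Or.inr ⟨X, e.toLinearMap ∘ₗ f, hX, e.surjective.comp hf, ih hK ?_⟩
      exact LinearEquiv.ofEq _ _ (by ext x; simp)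

include hw in
lemma resDimLE_iff_syz (n : ℕ) (A : ModuleCat.{u} R) : ResDimLE R 𝒲 n A ↔ Syz 𝒲 n A := by
  induction n generalizing A with
  | zero => rfl
  | succ n ih =>
    constructor
    · rintro (h | ⟨X, f, hX, hf, hK⟩)
      · exact ((ih _).1 h).succ hw
      · exact Syz.cok hw (ses_ker hf) ((ih _).1 hK) (Syz.of_mem hw hX n)
    · rintro ⟨K, P, f, g, hs, hP, hK⟩
      refine Or.inr ⟨P, g, hw.proj _ hP, hs.surj, (ih _).2 (hK.congr hw ?_)⟩
      refine (LinearEquiv.ofInjective f hs.inj).trans (LinearEquiv.ofEq _ _ ?_)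
      exact hs.exact.linearMap_ker_eq.symm

end Syz

end GCAux

namespace GCAux
open CategoryTheory TensorProduct
section char
variable {R : Type u} [CommRing R]
variable {A B D F K P N Y Z : Type u} [AddCommGroup A] [AddCommGroup B] [AddCommGroup D]
    [Module R A] [Module R B] [Module R D] [AddCommGroup F] [Module R F] [AddCommGroup K] [Module R K]
    [AddCommGroup P] [Module R P] [AddCommGroup N] [Module R N] [AddCommGroup Y] [Module R Y]
    [AddCommGroup Z] [Module R Z]
    {f : A →ₗ[R] B} {g : B →ₗ[R] D}

lemma SES.rTensor (h : SES f g) (F : Type u) [AddCommGroup F] [Module R F] [Module.Flat R F] :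
    SES (f.rTensor F) (g.rTensor F) :=
  ⟨Module.Flat.rTensor_preserves_injective_linearMap f h.inj, Module.Flat.rTensor_exact F h.exact,
    LinearMap.rTensor_surjective F h.surj⟩

lemma SES.lTensor (h : SES f g) (F : Type u) [AddCommGroup F] [Module R F] [Module.Flat R F] :
    SES (f.lTensor F) (g.lTensor F) :=
  ⟨Module.Flat.lTensor_preserves_injective_linearMap f h.inj, Module.Flat.lTensor_exact F h.exact,
    LinearMap.lTensor_surjective F h.surj⟩

lemma SES.lTensor_of_flat (h : SES f g) [Module.Flat R D] (N : Type u) [AddCommGroup N] [Module R N] :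
    SES (f.lTensor N) (g.lTensor N) :=
  ⟨LinearMap.lTensor_injective_of_exact_of_flat g h.surj f h.inj h.exact N, lTensor_exact N h.exact h.surj,
    LinearMap.lTensor_surjective N h.surj⟩

lemma SES.rTensor_of_flat (h : SES f g) [Module.Flat R D] (N : Type u) [AddCommGroup N] [Module R N] :
    SES (f.rTensor N) (g.rTensor N) :=
  ⟨by
    rw [← LinearMap.lTensor_inj_iff_rTensor_inj]
    exact (h.lTensor_of_flat N).inj, rTensor_exact N h.exact h.surj,
    LinearMap.rTensor_surjective N h.surj⟩

/-- extension to a character module -/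
lemma extend_char_iff (f : A →ₗ[R] B) (N : Type u) [AddCommGroup N] [Module R N] :
    Function.Injective (f.rTensor N) ↔
      ∀ φ : A →ₗ[R] CharacterModule N, ∃ ψ : B →ₗ[R] CharacterModule N, ψ ∘ₗ f = φ :=
  rTensor_injective_iff_lcomp_surjective

lemma flat_ker (h : SES f g) [Module.Flat R D] [Module.Flat R B] : Module.Flat R A := by
  rw [Module.Flat.iff_lTensor_preserves_injective_linearMap' (R := R) (M := A)]
  intro X Y _ _ _ _ u hu
  have h1 : Function.Injective (LinearMap.lTensor B u) :=
    Module.Flat.lTensor_preserves_injective_linearMap u hu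
  have h2 := (h.rTensor_of_flat X).inj
  have : (LinearMap.rTensor Y f) ∘ₗ (LinearMap.lTensor A u) =
      (LinearMap.lTensor B u) ∘ₗ (LinearMap.rTensor X f) := by
    ext; simp
  have h3 : Function.Injective ((LinearMap.rTensor Y f) ∘ₗ (LinearMap.lTensor A u)) := by
    rw [this]; exact h1.comp h2
  exact Function.Injective.of_comp h3

/-- a flat module has no extensions by character modules -/
lemma PE.of_flat [Module.Flat R F] : PE R F (CharacterModule B) := by
  refine PE.of_syzygy (Φ := fun X => Module.Flat R X) (Ψ := fun Y => Y = ModuleCat.of R (CharacterModule B))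
    ?_ (ModuleCat.of R F) (ModuleCat.of R (CharacterModule B)) (by assumption) rfl
  intro A hA
  obtain ⟨K, P, f, g, h, hP⟩ := exists_free_cover (R := R) A
  refine ⟨K, P, f, g, h, flat_ker h, ?_⟩
  rintro _ rfl
  exact ⟨PE.of_projective, (extend_char_iff f B).1 (h.rTensor_of_flat B).inj⟩

lemma PE.tensor_flat [Module.Flat R F] (hA : PE R A (CharacterModule B)) :
    PE R (A ⊗[R] F) (CharacterModule B) := by
  refine PE.of_syzygy (Φ := fun X => ∃ A' : ModuleCat.{u} R, PE R A' (CharacterModule B) ∧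
    Nonempty (X ≃ₗ[R] A' ⊗[R] F)) (Ψ := fun Y => Y = ModuleCat.of R (CharacterModule B))
    ?_ (ModuleCat.of R (A ⊗[R] F)) (ModuleCat.of R (CharacterModule B))
      ⟨ModuleCat.of R A, hA, ⟨LinearEquiv.refl R _⟩⟩ rfl
  rintro X ⟨A', hA', ⟨e⟩⟩
  obtain ⟨K, P, f, g, h, hP⟩ := exists_free_cover (R := R) A'
  refine ⟨ModuleCat.of R (K ⊗[R] F), ModuleCat.of R (P ⊗[R] F), _, _,
    (h.rTensor F).congr (LinearEquiv.refl R _) (LinearEquiv.refl R _) e.symm,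
    ⟨K, PE.left h PE.of_projective hA', ⟨LinearEquiv.refl R _⟩⟩, ?_⟩
  rintro _ rfl
  refine ⟨PE.of_flat, (extend_char_iff _ B).1 ?_⟩
  have h1 : Function.Injective (f.rTensor B) := (extend_char_iff f B).2 fun φ => PE.extend h hA' φ
  have h2 : Function.Injective ((f.rTensor B).rTensor F) :=
    Module.Flat.rTensor_preserves_injective_linearMap _ h1
  have h3 : (TensorProduct.rightComm R P B F).toLinearMap ∘ₗ ((f.rTensor B).rTensor F) ∘ₗ
      (TensorProduct.rightComm R K B F).symm.toLinearMap = (f.rTensor F).rTensor B := by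
    ext; simp
  have h4 : Function.Injective ((f.rTensor F).rTensor B) := by
    rw [← h3]
    exact (TensorProduct.rightComm R P B F).injective.comp
      (h2.comp (TensorProduct.rightComm R K B F).symm.injective)
  exact h4

lemma PE.tensor_projective [Module.Projective R P] (hA : PE R A Z) : PE R (A ⊗[R] P) Z := by
  refine PE.of_syzygy (Φ := fun X => ∃ A' : ModuleCat.{u} R, PE R A' Z ∧
    Nonempty (X ≃ₗ[R] A' ⊗[R] P)) (Ψ := fun Y => Y = ModuleCat.of R Z)
    ?_ (ModuleCat.of R (A ⊗[R] P)) (ModuleCat.of R Z)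
      ⟨ModuleCat.of R A, hA, ⟨LinearEquiv.refl R _⟩⟩ rfl
  rintro X ⟨A', hA', ⟨e⟩⟩
  obtain ⟨K, Q, f, g, h, hQ⟩ := exists_free_cover (R := R) A'
  refine ⟨ModuleCat.of R (K ⊗[R] P), ModuleCat.of R (Q ⊗[R] P), _, _,
    (h.rTensor P).congr (LinearEquiv.refl R _) (LinearEquiv.refl R _) e.symm,
    ⟨K, PE.left h PE.of_projective hA', ⟨LinearEquiv.refl R _⟩⟩, ?_⟩
  rintro _ rfl
  refine ⟨PE.of_projective, fun φ => ?_⟩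
  have hs : Function.Surjective (f.lcomp R Z) := fun φ => PE.extend h hA' φ
  let φ' : K ⊗[R] P →ₗ[R] Z := φ
  obtain ⟨ψ, hψ⟩ := Module.projective_lifting_property (f.lcomp R Z) (TensorProduct.curry φ').flip hs
  refine ⟨TensorProduct.lift ψ.flip, ?_⟩
  change TensorProduct.lift ψ.flip ∘ₗ f.rTensor P = φ'
  ext k p
  have := congr($hψ p k)
  simpa using this

end char
end GCAux

namespace GCAux
open CategoryTheory TensorProduct
section char2
variable {R : Type u} [CommRing R]
variable {A B D F K P N Y Z : Type u} [AddCommGroup A] [AddCommGroup B] [AddCommGroup D]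
    [Module R A] [Module R B] [Module R D] [AddCommGroup F] [Module R F] [AddCommGroup K] [Module R K]
    [AddCommGroup P] [Module R P] [AddCommGroup N] [Module R N] [AddCommGroup Y] [Module R Y]
    [AddCommGroup Z] [Module R Z]
    {f : A →ₗ[R] B} {g : B →ₗ[R] D}

lemma SES.desc (h : SES f g) (φ : B →ₗ[R] Y) (hφ : φ ∘ₗ f = 0) : ∃ ψ : D →ₗ[R] Y, ψ ∘ₗ g = φ := by
  have hk : LinearMap.ker g ≤ LinearMap.ker φ := by
    intro b hb
    obtain ⟨a, rfl⟩ := h.lift hb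
    exact congr($hφ a)
  refine ⟨(LinearMap.ker g).liftQ φ hk ∘ₗ (g.quotKerEquivOfSurjective h.surj).symm.toLinearMap, ?_⟩
  ext b
  have : (g.quotKerEquivOfSurjective h.surj).symm (g b) = (LinearMap.ker g).mkQ b := by
    rw [LinearEquiv.symm_apply_eq]; rfl
  simp only [LinearMap.comp_apply, LinearEquiv.coe_coe, this]
  simp

/-- exactness of the character dual -/
lemma char_factor (α : A →ₗ[R] B) (χ : CharacterModule A) (hχ : ∀ a, α a = 0 → χ a = 0) :
    ∃ χ' : CharacterModule B, ∀ a, χ' (α a) = χ a := by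
  let χ₀ : LinearMap.range α →+ AddCircle (1 : ℚ) :=
    { toFun := fun b => χ b.2.choose
      map_zero' := hχ _ (Exists.choose_spec (0 : LinearMap.range α).2)
      map_add' := by
        intro b c
        rw [← map_add, ← sub_eq_zero, ← map_sub]
        apply hχ
        rw [map_sub, map_add, (b + c).2.choose_spec, b.2.choose_spec, c.2.choose_spec]
        simp }
  have h0 : ∀ a, χ₀ ⟨α a, a, rfl⟩ = χ a := by
    intro a
    change χ _ = χ a
    rw [← sub_eq_zero, ← map_sub]
    apply hχ
    rw [map_sub, Exists.choose_spec (⟨a, rfl⟩ : ∃ y, α y = α a)]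
    simp
  obtain ⟨χ', h'⟩ := CharacterModule.dual_surjective_of_injective (R := R)
    (LinearMap.range α).subtype Subtype.val_injective χ₀
  refine ⟨χ', fun a => ?_⟩
  rw [← h0 a, ← h']
  rfl

/-- evaluation `A ⊗ N⁺ → Hom(A,N)⁺` -/
noncomputable def theta (A N : Type u) [AddCommGroup A] [Module R A] [AddCommGroup N] [Module R N] :
    A ⊗[R] CharacterModule N →ₗ[R] CharacterModule (A →ₗ[R] N) :=
  TensorProduct.lift (LinearMap.mk₂ R
    (fun a χ => (CharacterModule.dual (LinearMap.applyₗ (R := R) (M₂ := N) a) χ))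
    (fun a a' χ => by ext h; change χ (h (a + a')) = χ (h a) + χ (h a'); simp)
    (fun r a χ => by ext h; change χ (h (r • a)) = χ ((r • h) a); simp)
    (fun _ _ _ => rfl)
    (fun r a χ => by ext h; rfl))

@[simp] lemma theta_tmul (a : A) (χ : CharacterModule N) (h : A →ₗ[R] N) :
    theta (R := R) A N (a ⊗ₜ χ) h = χ (h a) := rfl

lemma theta_nat (f : A →ₗ[R] B) (t : A ⊗[R] CharacterModule N) :
    theta B N (f.rTensor _ t) = CharacterModule.dual (f.lcomp R N) (theta A N t) := by
  induction t with
  | zero => simp only [map_zero]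
  | tmul a χ => ext h; rfl
  | add x y hx hy => simp only [map_add, hx, hy]

lemma pi_tensor_form {n : ℕ} (t : (Fin n → R) ⊗[R] Y) :
    ∃ m : Fin n → Y, t = ∑ i, (Pi.single i (1 : R)) ⊗ₜ[R] m i := by
  induction t with
  | zero => exact ⟨0, by simp⟩
  | tmul a y =>
    refine ⟨fun i => a i • y, ?_⟩
    conv_lhs => rw [pi_eq_sum_univ' a, TensorProduct.sum_tmul]
    simp [TensorProduct.smul_tmul]
  | add x y hx hy =>
    obtain ⟨m, rfl⟩ := hx
    obtain ⟨m', rfl⟩ := hy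
    exact ⟨m + m', by simp [TensorProduct.tmul_add, Finset.sum_add_distrib]⟩

lemma theta_pi_bijective (n : ℕ) : Function.Bijective (theta (R := R) (Fin n → R) N) := by
  have key : ∀ (m : Fin n → CharacterModule N) (i : Fin n) (x : N),
      theta (R := R) (Fin n → R) N (∑ j, (Pi.single j (1 : R)) ⊗ₜ[R] m j)
        ((LinearMap.proj i).smulRight x) = m i x := by
    intro m i x
    rw [map_sum]
    have : ∀ (s : Finset (Fin n)) (F : Fin n → CharacterModule ((Fin n → R) →ₗ[R] N)) h,
      (∑ j ∈ s, F j) h = ∑ j ∈ s, F j h := by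
      intro s F h
      induction s using Finset.induction_on with
      | empty => simp; rfl
      | insert a s ha ih => rw [Finset.sum_insert ha, Finset.sum_insert ha, ← ih]; rfl
    rw [this, Finset.sum_eq_single i]
    · simp
    · intro j _ hj
      simp [Pi.single_apply, hj.symm]
    · simp
  constructor
  · rw [injective_iff_map_eq_zero]
    intro t ht
    obtain ⟨m, rfl⟩ := pi_tensor_form t
    have : m = 0 := by
      funext i
      ext x
      rw [← key m i x, ht]
      rfl
    simp [this]
  · intro χ
    refine ⟨∑ j, (Pi.single j (1 : R)) ⊗ₜ[R]
      CharacterModule.dual (R := R) (LinearMap.smulRightₗ (R := R) (LinearMap.proj j : (Fin n → R) →ₗ[R] R)) χ, ?_⟩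
    ext h
    have hh : h = ∑ i, (LinearMap.proj i : (Fin n → R) →ₗ[R] R).smulRight (h (Pi.single i 1)) := by
      ext i
      simp [Pi.single_apply]
    have hs : ∀ (c : CharacterModule ((Fin n → R) →ₗ[R] N)) (G : Fin n → ((Fin n → R) →ₗ[R] N)),
      c (∑ i, G i) = ∑ i, c (G i) := fun c G => map_sum c G _
    rw [hh, hs, hs]
    refine Finset.sum_congr rfl fun i _ => ?_
    rw [key]
    rfl

section noeth
variable [IsNoetherianRing R]

lemma theta_surjective [Module.Finite R A] : Function.Surjective (theta (R := R) A N) := by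
  obtain ⟨n, K, f, g, h, hK⟩ := exists_finite_cover (R := R) A
  intro χ
  obtain ⟨χ', h'⟩ := CharacterModule.dual_surjective_of_injective (g.lcomp R N)
    (LinearMap.lcomp_injective_of_surjective g h.surj) χ
  obtain ⟨t, rfl⟩ := (theta_pi_bijective n).2 χ'
  exact ⟨g.rTensor _ t, by rw [theta_nat, h']⟩

lemma theta_bijective [Module.Finite R A] : Function.Bijective (theta (R := R) A N) := by
  refine ⟨?_, theta_surjective⟩
  obtain ⟨n, K, f, g, h, hK⟩ := exists_finite_cover (R := R) A
  rw [injective_iff_map_eq_zero]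
  intro t ht
  obtain ⟨t', rfl⟩ := LinearMap.rTensor_surjective _ h.surj t
  rw [theta_nat] at ht
  obtain ⟨χ, hχ⟩ := char_factor (f.lcomp R N) (theta _ N t') (by
    intro a ha
    have : ∃ b, g.lcomp R N b = a := h.desc a ha
    obtain ⟨b, rfl⟩ := this
    exact congr($ht b))
  obtain ⟨s, rfl⟩ := theta_surjective χ
  have : t' = f.rTensor _ s := by
    apply (theta_pi_bijective n).1
    rw [theta_nat]
    ext x
    exact (hχ x).symm
  rw [this, ← LinearMap.comp_apply, ← LinearMap.rTensor_comp]
  have : g ∘ₗ f = 0 := by ext x; exact h.zero x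
  simp [this]

noncomputable def thetaEquiv (A N : Type u) [AddCommGroup A] [Module R A] [AddCommGroup N] [Module R N] [Module.Finite R A] :
    A ⊗[R] CharacterModule N ≃ₗ[R] CharacterModule (A →ₗ[R] N) :=
  LinearEquiv.ofBijective (theta A N) theta_bijective

/-- Injectivity of `A ⊗ N⁺ → B ⊗ N⁺` iff maps `A → N` extend. -/
lemma extend_iff_tensor [Module.Finite R A] [Module.Finite R B] (f : A →ₗ[R] B) :
    Function.Injective (f.rTensor (CharacterModule N)) ↔
      ∀ φ : A →ₗ[R] N, ∃ ψ : B →ₗ[R] N, ψ ∘ₗ f = φ := by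
  have h1 : ⇑(theta (R := R) B N) ∘ f.rTensor (CharacterModule N) =
      (CharacterModule.dual (f.lcomp R N)) ∘ theta A N := by
    funext t
    exact theta_nat f t
  have h2 : Function.Injective (f.rTensor (CharacterModule N)) ↔
      Function.Injective (CharacterModule.dual (f.lcomp R N)) := by
    rw [← (theta_bijective (R := R) (A := B) (N := N)).1.of_comp_iff, h1,
      Function.Injective.of_comp_iff' _ (theta_bijective (R := R) (A := A) (N := N))]
  rw [h2, CharacterModule.dual_injective_iff_surjective]
  rfl

end noeth
end char2
end GCAux

namespace GCAux
open CategoryTheory TensorProduct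
section char3
variable {R : Type u} [CommRing R]
variable {A B D F K P N Y Z C : Type u} [AddCommGroup A] [AddCommGroup B] [AddCommGroup D]
    [Module R A] [Module R B] [Module R D] [AddCommGroup F] [Module R F] [AddCommGroup K] [Module R K]
    [AddCommGroup P] [Module R P] [AddCommGroup N] [Module R N] [AddCommGroup Y] [Module R Y]
    [AddCommGroup Z] [Module R Z] [AddCommGroup C] [Module R C]
    {f : A →ₗ[R] B} {g : B →ₗ[R] D}

/-- evaluation into the double character module -/
noncomputable def cev (N : Type u) [AddCommGroup N] [Module R N] :
    N →ₗ[R] CharacterModule (CharacterModule N) where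
  toFun n :=
    { toFun := fun χ => χ n
      map_zero' := rfl
      map_add' := fun _ _ => rfl }
  map_add' a b := by ext χ; exact map_add χ a b
  map_smul' r a := by ext χ; rfl

@[simp] lemma cev_apply (n : N) (χ : CharacterModule N) : cev (R := R) N n χ = χ n := rfl

lemma cev_injective : Function.Injective (cev (R := R) N) := by
  rw [injective_iff_map_eq_zero]
  intro n hn
  apply CharacterModule.eq_zero_of_character_apply
  intro c
  exact congr($hn c)

lemma injective_of_retract [hI : Module.Injective R B] (i : A →ₗ[R] B) (r : B →ₗ[R] A)
    (h : r ∘ₗ i = LinearMap.id) : Module.Injective R A := by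
  refine ⟨fun X Y _ _ _ _ f hf g => ?_⟩
  obtain ⟨k, hk⟩ := hI.out f hf (i ∘ₗ g)
  refine ⟨r ∘ₗ k, fun x => ?_⟩
  have := congr($h (g x))
  simpa [hk] using this

lemma SES.dual (h : SES f g) : SES (CharacterModule.dual g) (CharacterModule.dual f) := by
  refine ⟨CharacterModule.dual_injective_of_surjective g h.surj, ?_,
    CharacterModule.dual_surjective_of_injective f h.inj⟩
  intro χ
  constructor
  · intro hχ
    obtain ⟨χ', h'⟩ := char_factor g χ (by
      intro b hb
      obtain ⟨a, rfl⟩ := h.lift hb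
      exact congr($hχ a))
    exact ⟨χ', by ext b; exact h' b⟩
  · rintro ⟨χ', rfl⟩
    ext a
    change χ' (g (f a)) = 0
    rw [h.zero, map_zero]

section noeth
variable [IsNoetherianRing R]

lemma flat_char_of_injective [hI : Module.Injective R N] : Module.Flat R (CharacterModule N) := by
  rw [Module.Flat.iff_rTensor_injective']
  intro I
  rw [extend_iff_tensor]
  intro φ
  obtain ⟨h, hh⟩ := hI.out I.subtype Subtype.val_injective φ
  exact ⟨h, by ext x; exact hh x⟩

omit [IsNoetherianRing R] in
lemma injective_char_of_flat [Module.Flat R N] : Module.Injective R (CharacterModule N) :=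
  Module.Flat.iff_characterModule_injective.1 inferInstance

lemma flat_bidual [Module.Flat R F] : Module.Flat R (CharacterModule (CharacterModule F)) :=
  have := injective_char_of_flat (R := R) (N := F)
  flat_char_of_injective

/-- a flat module embeds in its double dual with flat cokernel -/
lemma exists_flat_embed (F : Type u) [AddCommGroup F] [Module R F] [Module.Flat R F] :
    ∃ (Q : ModuleCat.{u} R) (q : CharacterModule (CharacterModule F) →ₗ[R] Q),
      SES (cev (R := R) F) q ∧ Module.Flat R Q := by
  refine ⟨ModuleCat.of R _, _, ses_coker cev_injective, ?_⟩
  have h := ses_coker (cev_injective (R := R) (N := F))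
  have h' := h.dual
  have hs : CharacterModule.dual (cev (R := R) F) ∘ₗ cev (R := R) (CharacterModule F) = LinearMap.id := by
    ext χ x
    rfl
  obtain ⟨e⟩ := h'.split_of_section hs
  have := flat_bidual (R := R) (F := F)
  have := injective_char_of_flat (R := R) (N := CharacterModule (CharacterModule F))
  have hfl := injective_of_retract (R := R) (e.symm.toLinearMap ∘ₗ LinearMap.inl R _ _)
    (LinearMap.fst R _ _ ∘ₗ e.toLinearMap) (by ext; simp)
  exact Module.Flat.iff_characterModule_injective.2 hfl

lemma PE.of_bidual [Module.Finite R A] (hA : PE R A (CharacterModule (CharacterModule C))) : PE R A C := by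
  refine PE.of_syzygy (Φ := fun X => Module.Finite R X ∧ PE R X (CharacterModule (CharacterModule C)))
    (Ψ := fun Y => Y = ModuleCat.of R C) ?_ (ModuleCat.of R A) (ModuleCat.of R C) ⟨‹_›, hA⟩ rfl
  rintro A ⟨hA, hA'⟩
  obtain ⟨n, K, f, g, h, hK⟩ := exists_finite_cover (R := R) A
  refine ⟨K, ModuleCat.of R (Fin n → R), f, g, h, ⟨hK, PE.left h PE.of_projective hA'⟩, ?_⟩
  rintro _ rfl
  refine ⟨PE.of_projective, ?_⟩
  rw [← extend_iff_tensor, extend_char_iff]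
  exact fun φ => PE.extend h hA' φ

/-- the double dual of `C` as tensor product -/
lemma bidual_equiv [Module.Finite R C] :
    Nonempty (C ⊗[R] CharacterModule (CharacterModule R) ≃ₗ[R] CharacterModule (CharacterModule C)) :=
  ⟨(thetaEquiv C (CharacterModule R)).trans (CharacterModule.congr
    (CharacterModule.homEquiv.trans (CharacterModule.congr (TensorProduct.rid R C))))⟩

lemma hom_tensor_pi_surj (n : ℕ) (φ : (Fin n → R) →ₗ[R] C ⊗[R] F) :
    ∃ t, TensorProduct.rTensorHomToHomRTensor (RingHom.id R) (Fin n → R) C F t = φ := by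
  obtain ⟨t, ht⟩ := (rTensorHomEquivHomRTensor R (Fin n → R) C F).surjective φ
  refine ⟨t, ?_⟩
  rw [← ht]
  exact congr($(rTensorHomEquivHomRTensor_toLinearMap R (Fin n → R) C F) t).symm

lemma hom_tensor_pi_inj (n : ℕ) :
    Function.Injective (TensorProduct.rTensorHomToHomRTensor (RingHom.id R) (Fin n → R) C F) := by
  have := (rTensorHomEquivHomRTensor R (Fin n → R) C F).injective
  convert this using 1
  funext t
  exact congr($(rTensorHomEquivHomRTensor_toLinearMap R (Fin n → R) C F) t).symm

lemma hom_tensor_nat (f : A →ₗ[R] B) (t : (B →ₗ[R] C) ⊗[R] F) :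
    TensorProduct.rTensorHomToHomRTensor (RingHom.id R) A C F ((f.lcomp R C).rTensor F t) =
      (TensorProduct.rTensorHomToHomRTensor (RingHom.id R) B C F t) ∘ₗ f := by
  induction t with
  | zero => simp
  | tmul a χ => ext h; simp
  | add x y hx hy => simp only [map_add, hx, hy]; rfl

lemma hom_tensor_inj [Module.Finite R A] [Module.Flat R F] :
    Function.Injective (TensorProduct.rTensorHomToHomRTensor (RingHom.id R) A C F) := by
  obtain ⟨n, K, f, g, h, hK⟩ := exists_finite_cover (R := R) A
  rw [injective_iff_map_eq_zero]
  intro t ht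
  have h1 : Function.Injective ((g.lcomp R C).rTensor F) :=
    Module.Flat.rTensor_preserves_injective_linearMap _ (LinearMap.lcomp_injective_of_surjective g h.surj)
  apply h1
  apply hom_tensor_pi_inj
  rw [hom_tensor_nat, ht]
  simp

lemma hom_tensor_surj [Module.Finite R A] [Module.Flat R F] (φ : A →ₗ[R] C ⊗[R] F) :
    ∃ t, TensorProduct.rTensorHomToHomRTensor (RingHom.id R) A C F t = φ := by
  obtain ⟨n, K, f, g, h, hK⟩ := exists_finite_cover (R := R) A
  obtain ⟨t, ht⟩ := hom_tensor_pi_surj n (φ ∘ₗ g)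
  have h0 : (f.lcomp R C).rTensor F t = 0 := by
    apply hom_tensor_inj
    rw [hom_tensor_nat, ht, LinearMap.comp_assoc]
    have : g ∘ₗ f = 0 := by ext x; exact h.zero x
    simp [this]
  have hex : Function.Exact (g.lcomp R C) (f.lcomp R C) := by
    intro ψ
    constructor
    · intro hψ
      exact h.desc ψ hψ
    · rintro ⟨χ, rfl⟩
      ext x
      change χ (g (f x)) = 0
      rw [h.zero, map_zero]
  obtain ⟨s, rfl⟩ := (Module.Flat.rTensor_exact F hex t).1 h0
  refine ⟨s, ?_⟩
  rw [hom_tensor_nat] at ht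
  ext a
  obtain ⟨x, rfl⟩ := h.surj a
  exact congr($ht x)

/-- the factor property -/
lemma factor_prop [Module.Finite R A] [Module.Flat R F] (φ : A →ₗ[R] C ⊗[R] F) :
    ∃ (s : Finset ((A →ₗ[R] C) × F)), ∀ a, φ a = ∑ i ∈ s, i.1 a ⊗ₜ[R] i.2 := by
  obtain ⟨t, rfl⟩ := hom_tensor_surj φ
  obtain ⟨s, rfl⟩ := TensorProduct.exists_finset t
  refine ⟨s, fun a => ?_⟩
  simp [map_sum]

lemma PE.tensor_right [Module.Finite R A] [Module.Flat R F] (hA : PE R A C) : PE R A (C ⊗[R] F) := by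
  refine PE.of_syzygy (Φ := fun X => Module.Finite R X ∧ PE R X C)
    (Ψ := fun Y => Y = ModuleCat.of R (C ⊗[R] F)) ?_ (ModuleCat.of R A) (ModuleCat.of R (C ⊗[R] F))
    ⟨‹_›, hA⟩ rfl
  rintro A ⟨hA, hA'⟩
  obtain ⟨n, K, f, g, h, hK⟩ := exists_finite_cover (R := R) A
  refine ⟨K, ModuleCat.of R (Fin n → R), f, g, h, ⟨hK, PE.left h PE.of_projective hA'⟩, ?_⟩
  rintro _ rfl
  refine ⟨PE.of_projective, ?_⟩
  intro φ
  obtain ⟨s, hs⟩ := factor_prop (R := R) (A := K) (C := C) (F := F) φ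
  choose ψ hψ using fun χ : K →ₗ[R] C => PE.extend h hA' χ
  refine ⟨∑ i ∈ s, (TensorProduct.mk R C F).flip i.2 ∘ₗ ψ i.1, ?_⟩
  ext k
  rw [hs]
  simp only [LinearMap.comp_apply, LinearMap.sum_apply, LinearMap.flip_apply, TensorProduct.mk_apply]
  refine Finset.sum_congr rfl fun i _ => ?_
  rw [← LinearMap.comp_apply (ψ i.1) f k, hψ]

end noeth
end char3
end GCAux

namespace GCAux
open CategoryTheory TensorProduct
section classes
variable {R : Type u} [CommRing R]
variable {A B D F K P N Y Z : Type u} [AddCommGroup A] [AddCommGroup B] [AddCommGroup D]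
    [Module R A] [Module R B] [Module R D] [AddCommGroup F] [Module R F] [AddCommGroup K] [Module R K]
    [AddCommGroup P] [Module R P] [AddCommGroup N] [Module R N] [AddCommGroup Y] [Module R Y]
    [AddCommGroup Z] [Module R Z]
    {f : A →ₗ[R] B} {g : B →ₗ[R] D}
variable (C : Type u) [AddCommGroup C] [Module R C]

variable (R) in
/-- working form of semidualizing -/
structure SD : Prop where
  fin : Module.Finite R C
  hom : Function.Bijective (fun r : R => (r • LinearMap.id : C →ₗ[R] C))
  pe : PE R C C

/-- modules `C ⊗ P` with `P` in a class -/
def CT (pp : ModuleCat.{u} R → Prop) (Y : ModuleCat.{u} R) : Prop :=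
  ∃ P : ModuleCat.{u} R, pp P ∧ Nonempty (Y ≃ₗ[R] C ⊗[R] P)

variable (R) in
def pF (P : ModuleCat.{u} R) : Prop := Module.Free R P ∧ Module.Finite R P
variable (R) in
def pP (P : ModuleCat.{u} R) : Prop := Module.Projective R P
variable (R) in
def pL (P : ModuleCat.{u} R) : Prop := Module.Flat R P
variable (R) in
def pD (P : ModuleCat.{u} R) : Prop := ∃ I : ModuleCat.{u} R, Module.Injective R I ∧
  Nonempty (P ≃ₗ[R] CharacterModule I)

variable (R) in
abbrev WF (A : Type u) [AddCommGroup A] [Module R A] : Prop := IsW (CT C (pF R)) (CT C (pF R)) A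
variable (R) in
abbrev WP (A : Type u) [AddCommGroup A] [Module R A] : Prop := IsW (CT C (pP R)) (CT C (pP R)) A
variable (R) in
abbrev WD (A : Type u) [AddCommGroup A] [Module R A] : Prop := IsW (CT C (pD R)) (CT C (pD R)) A

variable {C}

lemma CT.mono {pp qq : ModuleCat.{u} R → Prop} (h : ∀ P, pp P → qq P) {Y : ModuleCat.{u} R} (hY : CT C pp Y) :
    CT C qq Y := by
  obtain ⟨P, hP, e⟩ := hY
  exact ⟨P, h P hP, e⟩

lemma good_CT {pp : ModuleCat.{u} R → Prop}
    (hprod : ∀ P P' : ModuleCat.{u} R, pp P → pp P' → pp (ModuleCat.of R (P × P')))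
    (hzero : pp (ModuleCat.of R PUnit.{u + 1}))
    (hperp : ∀ P P' : ModuleCat.{u} R, pp P → pp P' → PE R (C ⊗[R] P) (C ⊗[R] P')) : Good (CT C pp) := by
  refine ⟨?_, ?_, ?_⟩
  · rintro Y Y' ⟨P, hP, ⟨e⟩⟩ ⟨P', hP', ⟨e'⟩⟩
    exact ⟨_, hprod _ _ hP hP', ⟨(LinearEquiv.prodCongr e e').trans
      (TensorProduct.prodRight R R C P P').symm⟩⟩
  · refine ⟨ModuleCat.of R (C ⊗[R] PUnit.{u + 1}), ⟨_, hzero, ⟨LinearEquiv.refl R _⟩⟩, ?_⟩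
    change Subsingleton (C ⊗[R] PUnit.{u + 1})
    infer_instance
  · rintro Y Y' ⟨P, hP, ⟨e⟩⟩ ⟨P', hP', ⟨e'⟩⟩
    exact (hperp P P' hP hP').congr e.symm e'.symm

lemma pF_le_pP (P : ModuleCat.{u} R) (h : pF R P) : pP R P := by
  obtain ⟨h1, h2⟩ := h
  change Module.Projective R P
  infer_instance

lemma pP_le_pL (P : ModuleCat.{u} R) (h : pP R P) : pL R P := by
  change Module.Projective R P at h
  change Module.Flat R P
  infer_instance

variable [IsNoetherianRing R]

lemma pD_le_pL (P : ModuleCat.{u} R) (h : pD R P) : pL R P := by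
  obtain ⟨I, hI, ⟨e⟩⟩ := h
  have := flat_char_of_injective (R := R) (N := I)
  exact Module.Flat.of_linearEquiv e

variable (hC : SD R C)
include hC

lemma perp_proj [Module.Projective R P] [Module.Flat R F] : PE R (C ⊗[R] P) (C ⊗[R] F) := by
  have := hC.fin
  exact PE.tensor_projective (PE.tensor_right hC.pe)

lemma goodF : Good (CT C (pF R)) := by
  refine good_CT ?_ ?_ ?_
  · rintro P P' ⟨h1, h2⟩ ⟨h3, h4⟩
    exact ⟨inferInstanceAs (Module.Free R (P × P')), inferInstanceAs (Module.Finite R (P × P'))⟩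
  · exact ⟨inferInstanceAs (Module.Free R PUnit.{u + 1}), inferInstanceAs (Module.Finite R PUnit.{u + 1})⟩
  · intro P P' h h'
    have h1 : Module.Projective R P := pF_le_pP _ h
    have h2 : Module.Flat R P' := pP_le_pL _ (pF_le_pP _ h')
    exact perp_proj hC

lemma goodP : Good (CT C (pP R)) := by
  refine good_CT ?_ ?_ ?_
  · intro P P' h h'
    have h1 : Module.Projective R P := h
    have h2 : Module.Projective R P' := h'
    exact inferInstanceAs (Module.Projective R (P × P'))
  · exact inferInstanceAs (Module.Projective R PUnit.{u + 1})
  · intro P P' h h'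
    have h1 : Module.Projective R P := h
    have h2 : Module.Flat R P' := pP_le_pL _ h'
    exact perp_proj hC

/-- `C ⊗ flat` is orthogonal to the class `D` -/
lemma perp_flat [Module.Flat R F] (Y : ModuleCat.{u} R) (hY : CT C (pD R) Y) : PE R (C ⊗[R] F) Y := by
  have := hC.fin
  obtain ⟨P, ⟨I, hI, ⟨e⟩⟩, ⟨e'⟩⟩ := hY
  have h1 : Module.Flat R (CharacterModule I) := flat_char_of_injective
  have h2 : PE R C (C ⊗[R] CharacterModule I) := PE.tensor_right hC.pe
  have h3 : PE R (C ⊗[R] F) (CharacterModule (C →ₗ[R] I)) :=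
    PE.tensor_flat (h2.congr_right (thetaEquiv C I))
  exact h3.congr_right ((thetaEquiv C I).symm.trans
    ((TensorProduct.congr (LinearEquiv.refl R C) e.symm).trans e'.symm))

lemma goodD : Good (CT C (pD R)) := by
  refine good_CT ?_ ?_ ?_
  · rintro P P' ⟨I, hI, ⟨e⟩⟩ ⟨I', hI', ⟨e'⟩⟩
    have e₂ : (CharacterModule I × CharacterModule I') ≃ₗ[R] CharacterModule (I × I') := by
      refine (LinearEquiv.ofBijective ((CharacterModule.dual (LinearMap.fst R I I')).coprod
        (CharacterModule.dual (LinearMap.snd R I I'))) ⟨?_, ?_⟩)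
      · rw [injective_iff_map_eq_zero]
        rintro ⟨x, y⟩ h
        ext z
        · have := congr($h (z, 0))
          change x z + y 0 = 0 at this
          exact (by simpa using this : x z = 0)
        · have := congr($h (0, z))
          change x 0 + y z = 0 at this
          exact (by simpa using this : y z = 0)
      · intro χ
        refine ⟨(CharacterModule.dual (LinearMap.inl R I I') χ, CharacterModule.dual (LinearMap.inr R I I') χ), ?_⟩
        ext ⟨a, b⟩
        change χ (a, 0) + χ (0, b) = χ (a, b)
        rw [← map_add]
        simp
    refine ⟨ModuleCat.of R (I × I'), ?_, ⟨(LinearEquiv.prodCongr e e').trans e₂⟩⟩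
    refine ⟨fun X Y _ _ _ _ f hf g => ?_⟩
    obtain ⟨k, hk⟩ := hI.out f hf (LinearMap.fst R I I' ∘ₗ g)
    obtain ⟨k', hk'⟩ := hI'.out f hf (LinearMap.snd R I I' ∘ₗ g)
    exact ⟨k.prod k', fun x => Prod.ext (hk x) (hk' x)⟩
  · refine ⟨ModuleCat.of R PUnit.{u + 1}, ?_, ⟨?_⟩⟩
    · exact ⟨fun X Y _ _ _ _ f hf g => ⟨0, fun x => rfl⟩⟩
    · have : Subsingleton (CharacterModule (PUnit.{u + 1})) :=
        ⟨fun a b => by ext x; exact (map_zero a).trans (map_zero b).symm⟩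
      exact { toFun := 0, invFun := 0, map_add' := by simp, map_smul' := by simp, left_inv := fun x => rfl,
              right_inv := fun x => Subsingleton.elim _ _ }
  · intro P P' h h'
    have h1 : Module.Flat R P := pD_le_pL _ h
    exact perp_flat hC (ModuleCat.of R (C ⊗[R] P')) ⟨P', h', ⟨LinearEquiv.refl R _⟩⟩

lemma WD.of_cflat (X : ModuleCat.{u} R) (hX : CT C (pL R) X) : WD R C X := by
  refine ⟨CT C (pL R), hX, ?_⟩
  rintro B ⟨F, hF, ⟨e⟩⟩
  change Module.Flat R F at hF
  refine ⟨fun Y hY => (perp_flat hC Y hY).congr_left e.symm, ?_⟩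
  obtain ⟨Q, q, h, hQ⟩ := exists_flat_embed (R := R) F
  refine ⟨ModuleCat.of R (C ⊗[R] CharacterModule (CharacterModule F)), ModuleCat.of R (C ⊗[R] Q), _, _,
    (h.lTensor_of_flat C).congr e.symm (LinearEquiv.refl R _) (LinearEquiv.refl R _), ?_, ?_⟩
  · exact ⟨ModuleCat.of R (CharacterModule (CharacterModule F)), ⟨ModuleCat.of R (CharacterModule F),
      injective_char_of_flat, ⟨LinearEquiv.refl R _⟩⟩, ⟨LinearEquiv.refl R _⟩⟩
  · exact ⟨Q, hQ, ⟨LinearEquiv.refl R _⟩⟩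

omit hC [IsNoetherianRing R] in
lemma CT_self {pp : ModuleCat.{u} R → Prop} (h : pp (ModuleCat.of R R)) : CT C pp (ModuleCat.of R C) :=
  ⟨ModuleCat.of R R, h, ⟨(TensorProduct.rid R C).symm⟩⟩

omit hC [IsNoetherianRing R] in
lemma pF_self : pF R (ModuleCat.of R R) :=
  ⟨inferInstanceAs (Module.Free R R), inferInstanceAs (Module.Finite R R)⟩

lemma WF.finite {S : Type u} [AddCommGroup S] [Module R S] (h : WF R C S) : Module.Finite R S := by
  have := hC.fin
  obtain ⟨Z, D, f, g, h, ⟨P, ⟨hP, hP'⟩, ⟨e⟩⟩, _⟩ := h.step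
  exact Module.Finite.of_injective (e.toLinearMap ∘ₗ f) (e.injective.comp h.inj)

lemma WF.pe {S : Type u} [AddCommGroup S] [Module R S] (h : WF R C S) : PE R S C :=
  IsW.pe h (ModuleCat.of R C) (CT_self pF_self)

lemma WF.pe_flat {S : Type u} [AddCommGroup S] [Module R S] (h : WF R C S) (Y : ModuleCat.{u} R)
    (hY : CT C (pL R) Y) : PE R S Y := by
  obtain ⟨F, hF, ⟨e⟩⟩ := hY
  have h1 : Module.Flat R F := hF
  have := WF.finite hC h
  exact (PE.tensor_right (WF.pe hC h)).congr_right e.symm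

lemma WF.toWP {S : Type u} [AddCommGroup S] [Module R S] (h : WF R C S) : WP R C S :=
  IsW.mono h (fun _ Y hB hY => WF.pe_flat hC hB Y (hY.mono pP_le_pL)) (fun _ hZ => hZ.mono pF_le_pP)

lemma WF.toWD {S : Type u} [AddCommGroup S] [Module R S] (h : WF R C S) : WD R C S := by
  have h1 : IsW (CT C (pD R)) (CT C (pF R)) S :=
    IsW.mono h (fun _ Y hB hY => WF.pe_flat hC hB Y (hY.mono pD_le_pL)) (fun _ hZ => hZ)
  exact IsW.trans (goodD hC) (fun Z hZ => WD.of_cflat hC Z (hZ.mono fun P hP => pP_le_pL _ (pF_le_pP _ hP))) h1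

lemma WF.tensor_proj {B : Type u} [AddCommGroup B] [Module R B] (h : WF R C B) [hP : Module.Projective R P] :
    WP R C (B ⊗[R] P) := by
  refine ⟨fun X => ∃ B : ModuleCat.{u} R, WF R C B ∧ Nonempty (X ≃ₗ[R] B ⊗[R] P),
    ⟨ModuleCat.of R B, h, ⟨LinearEquiv.refl R _⟩⟩, ?_⟩
  rintro X ⟨B, hB, ⟨e⟩⟩
  constructor
  · intro Y hY
    have h1 := WF.pe_flat hC hB Y (hY.mono pP_le_pL)
    exact (PE.tensor_projective h1).congr_left e.symm
  · obtain ⟨Z, D, f, g, hs, ⟨Q, hQ, ⟨e'⟩⟩, hD⟩ := hB.step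
    refine ⟨ModuleCat.of R (Z ⊗[R] P), ModuleCat.of R (D ⊗[R] P), _, _,
      (hs.rTensor P).congr e.symm (LinearEquiv.refl R _) (LinearEquiv.refl R _), ?_, D, hD, ⟨LinearEquiv.refl R _⟩⟩
    have hQ' : Module.Projective R Q := pF_le_pP _ hQ
    exact ⟨ModuleCat.of R (Q ⊗[R] P), inferInstanceAs (Module.Projective R (Q ⊗[R] P)),
      ⟨(TensorProduct.congr e' (LinearEquiv.refl R P)).trans (TensorProduct.assoc R C Q P)⟩⟩

lemma WD.tensor_flat {B : Type u} [AddCommGroup B] [Module R B] (h : WD R C B) [hF : Module.Flat R F] :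
    WD R C (B ⊗[R] F) := by
  have := hC.fin
  suffices IsW (CT C (pD R)) (CT C (pL R)) (B ⊗[R] F) from
    IsW.trans (goodD hC) (fun Z hZ => WD.of_cflat hC Z hZ) this
  refine ⟨fun X => ∃ B : ModuleCat.{u} R, WD R C B ∧ Nonempty (X ≃ₗ[R] B ⊗[R] F),
    ⟨ModuleCat.of R B, h, ⟨LinearEquiv.refl R _⟩⟩, ?_⟩
  rintro X ⟨B, hB, ⟨e⟩⟩
  constructor
  · rintro Y hY
    have hY' := hY
    obtain ⟨P, ⟨I, hI, ⟨e₁⟩⟩, ⟨e₂⟩⟩ := hY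
    let e₃ : Y ≃ₗ[R] CharacterModule (C →ₗ[R] I) := e₂.trans
      ((TensorProduct.congr (LinearEquiv.refl R C) e₁).trans (thetaEquiv C I))
    have h1 := hB.pe Y hY'
    exact (PE.tensor_flat (h1.congr_right e₃)).congr e.symm e₃.symm
  · obtain ⟨Z, D, f, g, hs, ⟨Q, hQ, ⟨e'⟩⟩, hD⟩ := hB.step
    refine ⟨ModuleCat.of R (Z ⊗[R] F), ModuleCat.of R (D ⊗[R] F), _, _,
      (hs.rTensor F).congr e.symm (LinearEquiv.refl R _) (LinearEquiv.refl R _), ?_, D, hD, ⟨LinearEquiv.refl R _⟩⟩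
    have hQ' : Module.Flat R Q := pD_le_pL _ hQ
    exact ⟨ModuleCat.of R (Q ⊗[R] F), inferInstanceAs (Module.Flat R (Q ⊗[R] F)),
      ⟨(TensorProduct.congr e' (LinearEquiv.refl R F)).trans (TensorProduct.assoc R C Q F)⟩⟩

end classes
end GCAux

namespace GCAux
open CategoryTheory TensorProduct
section totally
variable {R : Type u} [CommRing R]
variable {A B D F K P N Y Z : Type u} [AddCommGroup A] [AddCommGroup B] [AddCommGroup D]
    [Module R A] [Module R B] [Module R D] [AddCommGroup F] [Module R F] [AddCommGroup K] [Module R K]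
    [AddCommGroup P] [Module R P] [AddCommGroup N] [Module R N] [AddCommGroup Y] [Module R Y]
    [AddCommGroup Z] [Module R Z]
    {f : A →ₗ[R] B} {g : B →ₗ[R] D}
variable (C : Type u) [AddCommGroup C] [Module R C]

variable (R) in
/-- biduality map -/
def bd (A : Type u) [AddCommGroup A] [Module R A] : A →ₗ[R] ((A →ₗ[R] C) →ₗ[R] C) := LinearMap.applyₗ

lemma bd_apply (a : A) (φ : A →ₗ[R] C) : bd R C A a φ = φ a := rfl

/-- precomposition -/
def pc (f : A →ₗ[R] B) : (B →ₗ[R] C) →ₗ[R] (A →ₗ[R] C) := LinearMap.lcomp R C f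

lemma pc_apply (f : A →ₗ[R] B) (φ : B →ₗ[R] C) : pc C f φ = φ ∘ₗ f := rfl

lemma SES.hom (h : SES f g) (hex : ∀ φ : A →ₗ[R] C, ∃ ψ : B →ₗ[R] C, ψ ∘ₗ f = φ) :
    SES (pc C g) (pc C f) := by
  refine ⟨?_, ?_, hex⟩
  · intro φ ψ hh
    ext d
    obtain ⟨b, rfl⟩ := h.surj d
    exact LinearMap.congr_fun hh b
  · intro φ
    constructor
    · intro hφ
      obtain ⟨ψ, hψ⟩ := h.desc φ hφ
      exact ⟨ψ, hψ⟩
    · rintro ⟨ψ, rfl⟩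
      ext a
      simp [pc_apply, h.zero]

variable {C}

lemma bd_five (h : SES f g) (hex : ∀ φ : A →ₗ[R] C, ∃ ψ : B →ₗ[R] C, ψ ∘ₗ f = φ)
    (hB : Function.Bijective (bd R C B)) (hD : Function.Injective (bd R C D)) :
    Function.Bijective (bd R C A) := by
  constructor
  · rw [injective_iff_map_eq_zero]
    intro a ha
    apply h.inj
    rw [map_zero]
    apply hB.1
    rw [map_zero]
    ext ψ
    exact LinearMap.congr_fun ha (ψ ∘ₗ f)
  · intro ξ
    obtain ⟨b, hb⟩ := hB.2 (ξ ∘ₗ pc C f)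
    have hgb : g b = 0 := by
      apply hD
      rw [map_zero]
      ext δ
      have := LinearMap.congr_fun hb (δ ∘ₗ g)
      have h2 : pc C f (δ ∘ₗ g) = 0 := by
        ext a; simp [pc_apply, h.zero]
      simpa [bd_apply, h2] using this
    obtain ⟨a, rfl⟩ := h.lift hgb
    refine ⟨a, ?_⟩
    ext φ
    obtain ⟨ψ, rfl⟩ := hex φ
    exact LinearMap.congr_fun hb ψ

lemma bd_inj (hf : Function.Injective f) (hB : Function.Injective (bd R C B)) :
    Function.Injective (bd R C A) := by
  rw [injective_iff_map_eq_zero]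
  intro a ha
  apply hf
  rw [map_zero]
  apply hB
  rw [map_zero]
  ext ψ
  exact LinearMap.congr_fun ha (ψ ∘ₗ f)

lemma bd_congr (e : A ≃ₗ[R] B) (hB : Function.Bijective (bd R C A)) : Function.Bijective (bd R C B) := by
  have h : SES e.symm.toLinearMap (0 : A →ₗ[R] PUnit.{u + 1}) :=
    ⟨e.symm.injective, fun a => by simp [e.symm.surjective a], fun z => ⟨0, rfl⟩⟩
  refine bd_five h (fun φ => ⟨φ ∘ₗ e.toLinearMap, ?_⟩) hB (fun a b _ => rfl)
  ext; simp

variable (R C) in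
/-- totally C-reflexive -/
structure TR (A : Type u) [AddCommGroup A] [Module R A] : Prop where
  fin : Module.Finite R A
  pe : PE R A C
  pe' : PE R (A →ₗ[R] C) C
  bij : Function.Bijective (bd R C A)

lemma TR.congr (h : TR R C A) (e : A ≃ₗ[R] B) : TR R C B where
  fin := by have := h.fin; exact Module.Finite.equiv e
  pe := h.pe.congr_left e
  pe' := h.pe'.congr_left (LinearEquiv.congrLeft C R e)
  bij := bd_congr e h.bij

lemma finite_hom [IsNoetherianRing R] [Module.Finite R A] [Module.Finite R B] :
    Module.Finite R (A →ₗ[R] B) := inferInstance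

variable [IsNoetherianRing R] (hC : SD R C)

include hC in
lemma TR.dual (h : TR R C A) : TR R C (A →ₗ[R] C) where
  fin := by have := h.fin; have := hC.fin; exact finite_hom
  pe := h.pe'
  pe' := h.pe.congr_left (LinearEquiv.ofBijective _ h.bij)
  bij := by
    have h1 : Function.Bijective (pc C (bd R C A)) :=
      (LinearEquiv.congrLeft C R (LinearEquiv.ofBijective _ h.bij).symm).bijective
    have h2 : ∀ x, pc C (bd R C A) (bd R C (A →ₗ[R] C) x) = x := fun x => rfl
    constructor
    · exact Function.LeftInverse.injective h2
    · intro y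
      exact ⟨pc C (bd R C A) y, h1.1 (h2 _)⟩

def homPow (m : ℕ) : ((Fin m → R) →ₗ[R] C) ≃ₗ[R] (Fin m → C) := LinearEquiv.piRing R C (Fin m) R

def tensorPow (m : ℕ) : C ⊗[R] (Fin m → R) ≃ₗ[R] (Fin m → C) := TensorProduct.piScalarRight R R C (Fin m)

include hC in
lemma pe_pow (m : ℕ) : PE R (Fin m → C) C := by
  have h : PE R (C ⊗[R] (Fin m → R)) C := PE.tensor_projective hC.pe
  exact h.congr_left (tensorPow m)

include hC in
lemma TR.free (m : ℕ) : TR R C (Fin m → R) where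
  fin := inferInstance
  pe := PE.of_projective
  pe' := (pe_pow hC m).congr_left (homPow m).symm
  bij := by
    constructor
    · rw [injective_iff_map_eq_zero]
      intro r hr
      ext i
      apply hC.hom.1
      ext c
      have := LinearMap.congr_fun hr ((LinearMap.proj i : (Fin m → R) →ₗ[R] R).smulRight c)
      simpa [bd_apply] using this
    · intro ξ
      have key : ∀ i, ∃ r : R, ∀ c : C, ξ ((LinearMap.proj i : (Fin m → R) →ₗ[R] R).smulRight c) = r • c := by
        intro i
        obtain ⟨r, hr⟩ := hC.hom.2 (ξ ∘ₗ LinearMap.smulRightₗ (LinearMap.proj i : (Fin m → R) →ₗ[R] R))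
        exact ⟨r, fun c => (LinearMap.congr_fun hr c).symm⟩
      choose r hr using key
      refine ⟨r, ?_⟩
      ext φ
      have : φ = ∑ i, (LinearMap.proj i : (Fin m → R) →ₗ[R] R).smulRight (φ (Pi.single i 1)) := by
        apply LinearMap.pi_ext'
        intro i
        ext
        simp only [LinearMap.coe_comp, Function.comp_apply, LinearMap.coe_single, LinearMap.coe_sum,
          Finset.sum_apply, LinearMap.smulRight_apply, LinearMap.proj_apply]
        rw [Finset.sum_eq_single i]
        · simp
        · intro j _ hj
          simp [Pi.single_apply, hj]
        · simp
      rw [bd_apply]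
      conv_rhs => rw [this]
      conv_lhs => rw [this]
      simp [hr]

include hC in
lemma TR.pow (m : ℕ) : TR R C (Fin m → C) := ((TR.free hC m).dual hC).congr (homPow m)

include hC in
lemma TR.of_CT {Y : ModuleCat.{u} R} (h : CT C (pF R) Y) : TR R C Y := by
  obtain ⟨P, ⟨h1, h2⟩, ⟨e⟩⟩ := h
  let b := (Module.Free.chooseBasis R P).reindex (Fintype.equivFin _)
  exact (TR.pow hC _).congr ((tensorPow _).symm.trans
    ((TensorProduct.congr (LinearEquiv.refl R C) b.equivFun.symm).trans e.symm))

include hC in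
lemma CT_pow (m : ℕ) : CT C (pF R) (ModuleCat.of R (Fin m → C)) :=
  ⟨ModuleCat.of R (Fin m → R), ⟨inferInstanceAs (Module.Free R (Fin m → R)),
    inferInstanceAs (Module.Finite R (Fin m → R))⟩, ⟨(tensorPow m).symm⟩⟩

lemma bd_extend {g : B →ₗ[R] D} (hg : Function.Surjective g) (hD : Function.Surjective (bd R C D))
    (φ : (D →ₗ[R] C) →ₗ[R] C) : ∃ ψ : (B →ₗ[R] C) →ₗ[R] C, ψ ∘ₗ pc C g = φ := by
  obtain ⟨d, rfl⟩ := hD φ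
  obtain ⟨b, rfl⟩ := hg d
  exact ⟨bd R C B b, rfl⟩

include hC in
lemma TR.toWF (h : TR R C A) : WF R C A := by
  refine ⟨fun B => ∃ Ω : ModuleCat.{u} R, TR R C Ω ∧ Nonempty (B ≃ₗ[R] (Ω →ₗ[R] C)),
    ⟨ModuleCat.of R (A →ₗ[R] C), h.dual hC, ⟨LinearEquiv.ofBijective _ h.bij⟩⟩, ?_⟩
  rintro B ⟨Ω, hΩ, ⟨e⟩⟩
  constructor
  · rintro Y ⟨P, hP, ⟨e'⟩⟩
    have h1 : Module.Flat R P := pP_le_pL _ (pF_le_pP _ hP)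
    have h2 : Module.Finite R (Ω →ₗ[R] C) := (hΩ.dual hC).fin
    exact (PE.tensor_right (hΩ.dual hC).pe).congr e.symm e'.symm
  · have := hΩ.fin
    obtain ⟨m, K, f, g, hs, hK⟩ := exists_finite_cover (R := R) Ω
    have hd : SES (pc C g) (pc C f) := hs.hom C (hΩ.pe.extend hs)
    have hKT : TR R C K :=
      { fin := hK
        pe := PE.left hs PE.of_projective hΩ.pe
        pe' := PE.right hd hΩ.pe' (TR.free hC m).pe' (bd_extend hs.surj hΩ.bij.2)
        bij := bd_five hs (hΩ.pe.extend hs) (TR.free hC m).bij hΩ.bij.1 }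
    refine ⟨ModuleCat.of R (Fin m → C), ModuleCat.of R (K →ₗ[R] C), _, _,
      hd.congr e.symm (homPow m) (LinearEquiv.refl R _), CT_pow hC m, K, hKT, ⟨LinearEquiv.refl R _⟩⟩

include hC in
lemma WF.bd_inj {S : Type u} [AddCommGroup S] [Module R S] (h : WF R C S) : Function.Injective (bd R C S) := by
  obtain ⟨Z, D, f, g, hs, hZ, hD⟩ := h.step
  exact GCAux.bd_inj hs.inj (TR.of_CT hC hZ).bij.1

include hC in
lemma WF.bd_bij {S : Type u} [AddCommGroup S] [Module R S] (h : WF R C S) : Function.Bijective (bd R C S) := by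
  obtain ⟨Z, D, f, g, hs, hZ, hD⟩ := h.step
  exact bd_five hs ((WF.pe hC hD).extend hs) (TR.of_CT hC hZ).bij (WF.bd_inj hC hD)

include hC in
lemma WF.toTR {S : Type u} [AddCommGroup S] [Module R S] (h : WF R C S) : TR R C S where
  fin := WF.finite hC h
  pe := WF.pe hC h
  pe' := by
    refine PE.of_syzygy (Φ := fun A => ∃ S : ModuleCat.{u} R, WF R C S ∧ Nonempty (A ≃ₗ[R] (S →ₗ[R] C)))
      (Ψ := fun Y => Nonempty (Y ≃ₗ[R] C)) ?_ (ModuleCat.of R (S →ₗ[R] C)) (ModuleCat.of R C)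
      ⟨ModuleCat.of R S, h, ⟨LinearEquiv.refl R _⟩⟩ ⟨LinearEquiv.refl R _⟩
    rintro A ⟨S, hS, ⟨e⟩⟩
    obtain ⟨Z, D, f, g, hs, hZ, hD⟩ := hS.step
    have hd : SES (pc C g) (pc C f) := hs.hom C ((WF.pe hC hD).extend hs)
    refine ⟨ModuleCat.of R (D →ₗ[R] C), ModuleCat.of R (Z →ₗ[R] C), pc C g, e.symm.toLinearMap ∘ₗ pc C f, ?_,
      ⟨D, hD, ⟨LinearEquiv.refl R _⟩⟩, ?_⟩
    · exact hd.congr (LinearEquiv.refl R _) (LinearEquiv.refl R _) e.symm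
    · rintro Y ⟨e'⟩
      refine ⟨(TR.of_CT hC hZ).pe'.congr_right e'.symm, fun φ => ?_⟩
      obtain ⟨ψ, hψ⟩ := bd_extend hs.surj (WF.bd_bij hC hD).2 (e'.toLinearMap ∘ₗ φ)
      refine ⟨e'.symm.toLinearMap ∘ₗ ψ, ?_⟩
      rw [LinearMap.comp_assoc, hψ]
      ext; simp
  bij := WF.bd_bij hC h

include hC in
lemma WF.self : WF R C R :=
  (TR.toWF hC (TR.free hC 1)).congr (LinearEquiv.funUnique (Fin 1) R R)

include hC in
lemma WP.of_projective (P : Type u) [AddCommGroup P] [Module R P] [Module.Projective R P] : WP R C P :=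
  (WF.tensor_proj hC (WF.self hC) (P := P)).congr (TensorProduct.lid R P)

include hC in
lemma WD.of_flat (P : Type u) [AddCommGroup P] [Module R P] [Module.Flat R P] : WD R C P :=
  (WD.tensor_flat hC (WF.toWD hC (WF.self hC)) (F := P)).congr (TensorProduct.lid R P)

variable (R C) in
abbrev cWP (A : ModuleCat.{u} R) : Prop := WP R C A
variable (R C) in
abbrev cWD (A : ModuleCat.{u} R) : Prop := WD R C A

include hC in
lemma resP : Resolving (cWP R C) :=
  Resolving.of_isW (goodP hC) fun A hA => WP.of_projective hC A

include hC in
lemma resD : Resolving (cWD R C) :=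
  Resolving.of_isW (goodD hC) fun A hA => WD.of_flat hC A

include hC in
lemma toWF_of_isW {𝒴 : ModuleCat.{u} R → Prop} (hg : Good 𝒴) (hCm : ∀ m, IsW 𝒴 𝒴 (Fin m → C))
    (hfl : ∀ Y, 𝒴 Y → CT C (pL R) Y) (hpe : ∀ B : ModuleCat.{u} R, Module.Finite R B → IsW 𝒴 𝒴 B → PE R B C)
    {S : Type u} [AddCommGroup S] [Module R S] [hS : Module.Finite R S] (h : IsW 𝒴 𝒴 S) : WF R C S := by
  have := hC.fin
  refine ⟨fun B => Module.Finite R B ∧ IsW 𝒴 𝒴 B, ⟨hS, h⟩, ?_⟩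
  rintro B ⟨hB, hW⟩
  have hBC := hpe B hB hW
  refine ⟨?_, ?_⟩
  · rintro Y ⟨P, hP, ⟨e⟩⟩
    have h1 : Module.Flat R P := pP_le_pL _ (pF_le_pP _ hP)
    exact (PE.tensor_right hBC).congr_right e.symm
  · have hfin : Module.Finite R (B →ₗ[R] C) := finite_hom
    obtain ⟨m, s, hs⟩ := Module.Finite.exists_fin (R := R) (M := B →ₗ[R] C)
    let η : B →ₗ[R] (Fin m → C) := LinearMap.pi s
    have hη : ∀ φ : B →ₗ[R] C, ∃ ψ : (Fin m → C) →ₗ[R] C, ψ ∘ₗ η = φ := by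
      intro φ
      have : φ ∈ Submodule.span R (Set.range s) := by rw [hs]; trivial
      obtain ⟨c, hc⟩ := (Submodule.mem_span_range_iff_exists_fun R).1 this
      refine ⟨∑ i, c i • LinearMap.proj i, ?_⟩
      rw [← hc]
      ext b
      simp [η]
    have hinj : Function.Injective η := by
      rw [injective_iff_map_eq_zero]
      intro b hb
      obtain ⟨Z, D, f, g, hs', hZ, -⟩ := hW.step
      obtain ⟨F, hF, ⟨e⟩⟩ := hfl Z hZ
      have hF' : Module.Flat R F := hF
      obtain ⟨t, ht⟩ := factor_prop (e.toLinearMap ∘ₗ f)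
      apply hs'.inj
      rw [map_zero]
      apply e.injective
      rw [map_zero]
      refine (ht b).trans (Finset.sum_eq_zero fun i _ => ?_)
      obtain ⟨ψ, hψ⟩ := hη i.1
      rw [← hψ]
      simp [hb]
    have hs1 := ses_coker hinj
    have hDC : PE R ((Fin m → C) ⧸ LinearMap.range η) C := PE.right hs1 hBC (pe_pow hC m) hη
    refine ⟨ModuleCat.of R (Fin m → C), ModuleCat.of R ((Fin m → C) ⧸ LinearMap.range η), η, _, hs1,
      CT_pow hC m, inferInstanceAs (Module.Finite R ((Fin m → C) ⧸ LinearMap.range η)), ?_⟩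
    refine IsW.cok hg hs1 hW (hCm m) fun Y hY => ?_
    obtain ⟨F, hF, ⟨e⟩⟩ := hfl Y hY
    have hF' : Module.Flat R F := hF
    exact (PE.tensor_right hDC).congr_right e.symm

include hC in
lemma WP.toWF {S : Type u} [AddCommGroup S] [Module R S] [hS : Module.Finite R S] (h : WP R C S) : WF R C S := by
  refine toWF_of_isW hC (goodP hC) (fun m => ?_) (fun Y hY => hY.mono pP_le_pL) (fun B _ hB => ?_) h
  · exact (goodP hC).mem ((CT_pow hC m).mono pF_le_pP)
  · exact IsW.pe hB (ModuleCat.of R C) (CT_self (inferInstanceAs (Module.Projective R R)))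

include hC in
lemma WD.toWF {S : Type u} [AddCommGroup S] [Module R S] [hS : Module.Finite R S] (h : WD R C S) : WF R C S := by
  have := hC.fin
  refine toWF_of_isW hC (goodD hC) (fun m => ?_) (fun Y hY => hY.mono pD_le_pL) (fun B hBf hB => ?_) h
  · exact WF.toWD hC ((goodF hC).mem (CT_pow hC m))
  · refine PE.of_bidual ?_
    obtain ⟨e⟩ := bidual_equiv (R := R) (C := C)
    refine (IsW.pe hB (ModuleCat.of R (C ⊗[R] CharacterModule (CharacterModule R)))
      ⟨ModuleCat.of R (CharacterModule (CharacterModule R)), ⟨ModuleCat.of R (CharacterModule R), ?_,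
        ⟨LinearEquiv.refl R _⟩⟩, ⟨LinearEquiv.refl R _⟩⟩).congr_right e
    exact injective_char_of_flat

include hC in
lemma syzP_iff_syzD (d : ℕ) (M : ModuleCat.{u} R) [Module.Finite R M] :
    Syz (cWP R C) d M ↔ Syz (cWD R C) d M := by
  induction d generalizing M with
  | zero => exact ⟨fun h => WF.toWD hC (WP.toWF hC h), fun h => WF.toWP hC (WD.toWF hC h)⟩
  | succ d ih =>
    obtain ⟨m, K, f, g, hs, hK⟩ := exists_finite_cover (R := R) M
    have hp : Module.Projective R (ModuleCat.of R (Fin m → R)) :=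
      inferInstanceAs (Module.Projective R (Fin m → R))
    constructor
    · intro h
      exact ⟨K, ModuleCat.of R (Fin m → R), f, g, hs, hp,
        (ih K).1 (Syz.indep (resP hC) (P := ModuleCat.of R (Fin m → R)) hs hp h)⟩
    · intro h
      exact ⟨K, ModuleCat.of R (Fin m → R), f, g, hs, hp,
        (ih K).2 (Syz.indep (resD hC) (P := ModuleCat.of R (Fin m → R)) hs hp h)⟩

end totally
end GCAux

namespace GCAux
open CategoryTheory TensorProduct
section gc
variable {R : Type u} [CommRing R]
variable {A B D J N : Type u} [AddCommGroup A] [AddCommGroup B] [AddCommGroup D]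
    [Module R A] [Module R B] [Module R D] [AddCommGroup J] [Module R J]
    [AddCommGroup N] [Module R N]
    {f : A →ₗ[R] B} {g : B →ₗ[R] D}

lemma exact_rTensor_iff (hgf : ∀ a, g (f a) = 0) :
    Function.Exact (f.rTensor J) (g.rTensor J) ↔
      ∀ u : B →ₗ[R] CharacterModule J, u ∘ₗ f = 0 → ∃ h : D →ₗ[R] CharacterModule J, h ∘ₗ g = u := by
  have hgf' : ∀ a, g.rTensor J (f.rTensor J a) = 0 := by
    intro a
    rw [← LinearMap.comp_apply, ← LinearMap.rTensor_comp]
    have : g ∘ₗ f = 0 := by ext x; exact hgf x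
    simp [this]
  constructor
  · intro hex u hu
    obtain ⟨χ', h'⟩ := char_factor (g.rTensor J) (CharacterModule.uncurry u) (by
      intro z hz
      obtain ⟨w, rfl⟩ := (hex z).1 hz
      induction w with
      | zero => rw [map_zero]; first | exact map_zero _ | (rw [map_zero]; exact map_zero _)
      | tmul a j =>
        have := congr($hu a j)
        exact this
      | add x y hx hy => rw [map_add, map_add, hx (hgf' x), hy (hgf' y), add_zero])
    refine ⟨CharacterModule.curry χ', ?_⟩
    ext b j
    exact h' (b ⊗ₜ j)
  · intro H z
    refine ⟨fun hz => ?_, fun ⟨w, hw⟩ => hw ▸ hgf' w⟩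
    by_contra hne
    have hq : (LinearMap.range (f.rTensor J)).mkQ z ≠ 0 := by
      simpa using hne
    obtain ⟨χ, hχ⟩ := CharacterModule.exists_character_apply_ne_zero_of_ne_zero hq
    let χ₁ : CharacterModule (B ⊗[R] J) := CharacterModule.dual (LinearMap.range (f.rTensor J)).mkQ χ
    obtain ⟨h, hh⟩ := H (CharacterModule.curry χ₁) (by
      ext a j
      change χ ((LinearMap.range (f.rTensor J)).mkQ (f a ⊗ₜ j)) = 0
      have : (LinearMap.range (f.rTensor J)).mkQ (f a ⊗ₜ j) = 0 := by
        simp only [Submodule.mkQ_apply, Submodule.Quotient.mk_eq_zero]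
        exact ⟨a ⊗ₜ j, rfl⟩
      rw [this, map_zero])
    apply hχ
    have key : ∀ y, CharacterModule.uncurry h (g.rTensor J y) = χ₁ y := by
      intro y
      induction y with
      | zero => rw [map_zero, map_zero]; exact (map_zero χ₁).symm
      | tmul b j => exact congr($hh b j)
      | add x y hx hy => rw [map_add, map_add, hx, hy, map_add]
    have := key z
    rw [hz, map_zero] at this
    exact this.symm

/-- general complete resolutions -/
def GC (𝒴 𝒬 𝒵 : ModuleCat.{u} R → Prop) (N : Type u) [AddCommGroup N] [Module R N] : Prop :=
  ∃ (X : ℤ → ModuleCat.{u} R) (d : ∀ i : ℤ, X i →ₗ[R] X (i + 1)),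
    (∀ i : ℤ, i ≤ 0 → 𝒬 (X i)) ∧
    (∀ i : ℤ, 0 < i → 𝒵 (X i)) ∧
    (∀ i, Function.Exact (d i) (d (i + 1))) ∧
    (∀ (Q : ModuleCat.{u} R), 𝒴 Q →
      ∀ (i : ℤ) (g : X (i + 1) →ₗ[R] Q), g.comp (d i) = 0 →
        ∃ h : X (i + 1 + 1) →ₗ[R] Q, h.comp (d (i + 1)) = g) ∧
    ∃ π : X 0 →ₗ[R] N, Function.Surjective π ∧ Function.Exact (d (-1)) π

lemma ses_range {f : A →ₗ[R] B} {g : B →ₗ[R] D} (h : Function.Exact f g) :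
    SES (LinearMap.range f).subtype g.rangeRestrict := by
  refine ⟨Subtype.val_injective, ?_, LinearMap.surjective_rangeRestrict g⟩
  intro b
  rw [← Subtype.val_inj]
  change g b = 0 ↔ _
  rw [h b]
  constructor
  · rintro ⟨a, rfl⟩; exact ⟨⟨f a, a, rfl⟩, rfl⟩
  · rintro ⟨⟨_, a, rfl⟩, rfl⟩; exact ⟨a, rfl⟩

lemma GC.isW {𝒴 𝒬 𝒵 : ModuleCat.{u} R → Prop}
    (hp : ∀ P Y : ModuleCat.{u} R, 𝒬 P → 𝒴 Y → PE R P Y) (hz : ∀ P Y : ModuleCat.{u} R, 𝒵 P → 𝒴 Y → PE R P Y)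
    (h : GC 𝒴 𝒬 𝒵 N) : IsW 𝒴 𝒵 N := by
  obtain ⟨X, d, hP, hZ, hex, hH, π, hπ, hπ'⟩ := h
  have hXY : ∀ i (Y : ModuleCat.{u} R), 𝒴 Y → PE R (X i) Y := by
    intro i Y hY
    rcases le_or_gt i 0 with hi | hi
    · exact hp _ _ (hP i hi) hY
    · exact hz _ _ (hZ i hi) hY
  have hpe : ∀ (Y : ModuleCat.{u} R), 𝒴 Y → ∀ i, PE R (LinearMap.range (d i)) Y := by
    intro Y hY i
    refine PE.of_syzygy (Φ := fun A => ∃ i, Nonempty (A ≃ₗ[R] LinearMap.range (d i))) (Ψ := 𝒴) ?_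
      (ModuleCat.of R (LinearMap.range (d i))) Y ⟨i, ⟨LinearEquiv.refl R _⟩⟩ hY
    rintro A ⟨i, ⟨e⟩⟩
    obtain ⟨k, rfl⟩ : ∃ k, i = k + 1 + 1 := ⟨i - 2, by ring⟩
    have h1 := ses_range (hex (k + 1))
    refine ⟨ModuleCat.of R (LinearMap.range (d (k + 1))), X (k + 1 + 1), _, e.symm.toLinearMap ∘ₗ _,
      h1.congr (LinearEquiv.refl R _) (LinearEquiv.refl R _) e.symm, ⟨k + 1, ⟨LinearEquiv.refl R _⟩⟩, ?_⟩
    intro Y hY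
    refine ⟨hXY _ Y hY, fun φ => ?_⟩
    obtain ⟨h, hh⟩ := hH Y hY k (φ ∘ₗ (d (k + 1)).rangeRestrict) (by
      ext a
      have : (d (k + 1)).rangeRestrict (d k a) = 0 := by
        rw [← Subtype.val_inj]
        exact (hex k).apply_apply_eq_zero a
      simp only [LinearMap.comp_apply, this, map_zero, LinearMap.zero_apply])
    refine ⟨h, ?_⟩
    ext ⟨_, a, rfl⟩
    exact LinearMap.congr_fun hh a
  have h0 : Function.Exact (d (-1)) (d 0) := hex (-1)
  have eN : N ≃ₗ[R] LinearMap.range (d 0) := by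
    have e1 : LinearMap.ker π = LinearMap.ker (d 0) := by
      rw [LinearMap.exact_iff.1 hπ', LinearMap.exact_iff.1 h0]
    exact (LinearMap.quotKerEquivOfSurjective π hπ).symm.trans
      ((Submodule.quotEquivOfEq _ _ e1).trans (LinearMap.quotKerEquivRange (d 0)))
  suffices IsW 𝒴 𝒵 (LinearMap.range (d 0)) from this.congr eN.symm
  refine ⟨fun B => ∃ i : ℤ, 0 ≤ i ∧ Nonempty (B ≃ₗ[R] LinearMap.range (d i)), ⟨0, le_rfl, ⟨LinearEquiv.refl R _⟩⟩, ?_⟩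
  rintro B ⟨i, hi, ⟨e⟩⟩
  refine ⟨fun Y hY => (hpe Y hY i).congr_left e.symm, ?_⟩
  exact ⟨X (i + 1), ModuleCat.of R (LinearMap.range (d (i + 1))), _, _, (ses_range (hex i)).congr e.symm
    (LinearEquiv.refl R _) (LinearEquiv.refl R _), hZ _ (by omega), i + 1, by omega, ⟨LinearEquiv.refl R _⟩⟩

lemma GC.of_ses {𝒴 𝒬 𝒵 : ModuleCat.{u} R → Prop} (X S : ℤ → ModuleCat.{u} R) (p : ∀ i, X i →ₗ[R] S i)
    (j : ∀ i, S i →ₗ[R] X (i + 1)) (h : ∀ i, SES (j i) (p (i + 1))) (hP : ∀ i : ℤ, i ≤ 0 → 𝒬 (X i))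
    (hZ : ∀ i : ℤ, 0 < i → 𝒵 (X i)) (hS : ∀ i Y, 𝒴 Y → PE R (S i) Y) : GC 𝒴 𝒬 𝒵 (S 0) := by
  have hp : ∀ i, Function.Surjective (p i) := by
    intro i
    obtain ⟨k, rfl⟩ : ∃ k, i = k + 1 := ⟨i - 1, by ring⟩
    exact (h k).surj
  have aux : ∀ i, Function.Exact (j i ∘ₗ p i) (p (i + 1)) := by
    intro i x
    constructor
    · intro hx
      obtain ⟨s, rfl⟩ := (h i).lift hx
      obtain ⟨y, rfl⟩ := hp i s
      exact ⟨y, rfl⟩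
    · rintro ⟨y, rfl⟩
      exact (h i).zero _
  refine ⟨X, fun i => j i ∘ₗ p i, hP, hZ, ?_, ?_, p 0, hp 0, aux (-1)⟩
  · intro i x
    rw [← aux i x]
    constructor
    · intro hx
      apply (h (i + 1)).inj
      rw [map_zero]
      exact hx
    · intro hx
      simp [hx]
  · intro Q hQ i u hu
    obtain ⟨v, hv⟩ := (h i).desc u (by
      ext s
      obtain ⟨y, rfl⟩ := hp i s
      exact LinearMap.congr_fun hu y)
    obtain ⟨w, hw⟩ := (hS (i + 1 + 1) Q hQ).extend (h (i + 1)) v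
    refine ⟨w, ?_⟩
    rw [← LinearMap.comp_assoc, hw, hv]

lemma IsW.gc {𝒴 𝒬 𝒵 : ModuleCat.{u} R → Prop} (hp : ∀ P : ModuleCat.{u} R, Module.Projective R P → 𝒬 P)
    (h : IsW 𝒴 𝒵 N) : GC 𝒴 𝒬 𝒵 N := by
  have hstep : ∀ B : {B : ModuleCat.{u} R // IsW 𝒴 𝒵 B}, ∃ (Z : ModuleCat.{u} R) (D : {B : ModuleCat.{u} R // IsW 𝒴 𝒵 B})
      (f : B.1 →ₗ[R] Z) (g : Z →ₗ[R] D.1), SES f g ∧ 𝒵 Z := by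
    rintro ⟨B, hB⟩
    obtain ⟨Z, D, f, g, hs, hZ, hD⟩ := hB.step
    exact ⟨Z, ⟨D, hD⟩, f, g, hs, hZ⟩
  choose Z nx fr gr hr hrZ using hstep
  have hcov : ∀ A : ModuleCat.{u} R, ∃ (K P : ModuleCat.{u} R) (f : K →ₗ[R] P) (g : P →ₗ[R] A), SES f g ∧
    Module.Projective R P := fun A => exists_free_cover A
  choose K P fl gl hl hlP using hcov
  let σ : ℕ → {B : ModuleCat.{u} R // IsW 𝒴 𝒵 B} := fun n => Nat.rec ⟨ModuleCat.of R N, h⟩ (fun _ B => nx B) n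
  let τ : ℕ → ModuleCat.{u} R := fun n => Nat.rec (ModuleCat.of R N) (fun _ A => K A) n
  let X : ℤ → ModuleCat.{u} R := fun i => match i with
    | Int.ofNat 0 => P (τ 0)
    | Int.ofNat (n + 1) => Z (σ n)
    | Int.negSucc n => P (τ (n + 1))
  let S : ℤ → ModuleCat.{u} R := fun i => match i with
    | Int.ofNat n => (σ n).1
    | Int.negSucc n => τ (n + 1)
  let p : ∀ i, X i →ₗ[R] S i := fun i => match i with
    | Int.ofNat 0 => gl (τ 0)
    | Int.ofNat (n + 1) => gr (σ n)
    | Int.negSucc n => gl (τ (n + 1))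
  let j : ∀ i, S i →ₗ[R] X (i + 1) := fun i => match i with
    | Int.ofNat n => fr (σ n)
    | Int.negSucc 0 => fl (τ 0)
    | Int.negSucc (n + 1) => fl (τ (n + 1))
  have hs : ∀ i, SES (j i) (p (i + 1)) := fun i => match i with
    | Int.ofNat n => hr (σ n)
    | Int.negSucc 0 => hl (τ 0)
    | Int.negSucc (n + 1) => hl (τ (n + 1))
  have hK : ∀ A : ModuleCat.{u} R, (∀ Y : ModuleCat.{u} R, 𝒴 Y → PE R A Y) →
      (∀ Y : ModuleCat.{u} R, 𝒴 Y → PE R (K A) Y) := fun A hA Y hY => by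
    have := hlP A
    exact PE.left (hl A) PE.of_projective (hA Y hY)
  have hτ : ∀ n : ℕ, (fun A : ModuleCat.{u} R => ∀ Y : ModuleCat.{u} R, 𝒴 Y → PE R A Y) (τ n) := by
    intro n
    induction n with
    | zero => exact fun Y hY => h.pe Y hY
    | succ n ih => exact hK (τ n) ih
  refine GC.of_ses X S p j hs ?_ ?_ ?_
  · intro i hi
    match i with
    | Int.ofNat 0 => exact hp _ (hlP _)
    | Int.ofNat (n + 1) => simp at hi; omega
    | Int.negSucc n => exact hp _ (hlP _)
  · intro i hi
    match i with
    | Int.ofNat 0 => simp at hi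
    | Int.ofNat (n + 1) => exact hrZ _
    | Int.negSucc n => simp at hi
  · intro i Y hY
    match i with
    | Int.ofNat n => exact IsW.pe (σ n).2 Y hY
    | Int.negSucc n => exact hτ (n + 1) Y hY

variable {C : Type u} [AddCommGroup C] [Module R C] [IsNoetherianRing R] (hC : SD R C)

include hC in
lemma gcProj_iff : IsGCProjective R C N ↔ WP R C N := by
  constructor
  · intro h
    have h' : GC (CT C (pP R)) (pP R) (CT C (pP R)) N := h
    refine h'.isW ?_ (goodP hC).perp
    intro P Y hP hY
    have : Module.Projective R P := hP
    exact PE.of_projective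
  · intro h
    have h' : GC (CT C (pP R)) (pP R) (CT C (pP R)) N := IsW.gc (fun _ h => h) h
    exact h'

lemma CT_D_iff [Module.Finite R C] (Y : ModuleCat.{u} R) :
    CT C (pD R) Y ↔ ∃ J : ModuleCat.{u} R, IsCInjective R C J ∧ Nonempty (Y ≃ₗ[R] CharacterModule J) := by
  constructor
  · rintro ⟨P, ⟨I, hI, ⟨e⟩⟩, ⟨e'⟩⟩
    exact ⟨ModuleCat.of R (C →ₗ[R] I), ⟨I, hI, ⟨LinearEquiv.refl R _⟩⟩,
      ⟨e'.trans ((TensorProduct.congr (LinearEquiv.refl R C) e).trans (thetaEquiv C I))⟩⟩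
  · rintro ⟨J, ⟨I, hI, ⟨e⟩⟩, ⟨e'⟩⟩
    exact ⟨ModuleCat.of R (CharacterModule I), ⟨I, hI, ⟨LinearEquiv.refl R _⟩⟩,
      ⟨e'.trans ((CharacterModule.congr e).trans (thetaEquiv C I).symm)⟩⟩

lemma gcFlat_iff_gc [Module.Finite R C] : IsGCFlat R C N ↔ GC (CT C (pD R)) (pL R) (CT C (pL R)) N := by
  constructor
  · rintro ⟨X, d, h1, h2, h3, h4, h5⟩
    refine ⟨X, d, h1, h2, h3, ?_, h5⟩
    intro Y hY i u hu
    obtain ⟨J, hJ, ⟨e⟩⟩ := (CT_D_iff Y).1 hY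
    obtain ⟨h, hh⟩ := (exact_rTensor_iff (h3 i).apply_apply_eq_zero).1 (h4 J hJ i) (e.toLinearMap ∘ₗ u)
      (by rw [LinearMap.comp_assoc, hu, LinearMap.comp_zero])
    refine ⟨e.symm.toLinearMap ∘ₗ h, ?_⟩
    rw [LinearMap.comp_assoc, hh]
    ext; simp
  · rintro ⟨X, d, h1, h2, h3, h4, h5⟩
    refine ⟨X, d, h1, h2, h3, ?_, h5⟩
    intro J hJ i
    refine (exact_rTensor_iff (h3 i).apply_apply_eq_zero).2 fun u hu => ?_
    exact h4 (ModuleCat.of R (CharacterModule J)) ((CT_D_iff _).2 ⟨J, hJ, ⟨LinearEquiv.refl R _⟩⟩) i u hu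

include hC in
lemma gcFlat_iff : IsGCFlat R C N ↔ WD R C N := by
  have := hC.fin
  rw [gcFlat_iff_gc]
  constructor
  · intro h
    refine IsW.trans (goodD hC) (fun Z hZ => WD.of_cflat hC Z hZ) (h.isW ?_ ?_)
    · intro P Y hP hY
      have : Module.Flat R P := hP
      obtain ⟨J, hJ, ⟨e⟩⟩ := (CT_D_iff Y).1 hY
      exact PE.of_flat.congr_right e.symm
    · rintro P Y ⟨F, hF, ⟨e⟩⟩ hY
      have : Module.Flat R F := hF
      exact (perp_flat hC Y hY).congr_left e.symm
  · intro h
    exact IsW.gc pP_le_pL (IsW.mono h (fun B Y hB hY => hB.pe Y hY) fun Z hZ => hZ.mono pD_le_pL)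

include hC in
lemma resDimP_iff (n : ℕ) (A : ModuleCat.{u} R) :
    ResDimLE R (fun N => IsGCProjective R C N) n A ↔ Syz (cWP R C) n A := by
  rw [← resDimLE_iff_syz (resP hC)]
  have : (fun N : ModuleCat.{u} R => IsGCProjective R C N) = cWP R C := by
    ext N
    exact gcProj_iff hC
  rw [this]

include hC in
lemma resDimD_iff (n : ℕ) (A : ModuleCat.{u} R) :
    ResDimLE R (fun N => IsGCFlat R C N) n A ↔ Syz (cWD R C) n A := by
  rw [← resDimLE_iff_syz (resD hC)]
  have : (fun N : ModuleCat.{u} R => IsGCFlat R C N) = cWD R C := by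
    ext N
    exact gcFlat_iff hC
  rw [this]

end gc
end GCAux

namespace GCAux
open CategoryTheory TensorProduct
open scoped Pointwise
section stepB
variable {R : Type u} [CommRing R]
variable {A B D K F S Y : Type u} [AddCommGroup A] [AddCommGroup B] [AddCommGroup D]
    [Module R A] [Module R B] [Module R D] [AddCommGroup K] [Module R K] [AddCommGroup F] [Module R F]
    [AddCommGroup S] [Module R S] [AddCommGroup Y] [Module R Y]
    {f : A →ₗ[R] B} {g : B →ₗ[R] D}

lemma nak [IsLocalRing R] {x : R} (hx : x ∈ maximalIdeal R) (N : Submodule R A) [Module.Finite R A]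
    (h : ∀ a : A, ∃ n ∈ N, ∃ b, a = n + x • b) : N = ⊤ := by
  rw [eq_top_iff]
  refine Submodule.le_of_le_smul_of_le_jacobson_bot (I := maximalIdeal R) (Module.Finite.fg_top) ?_ ?_
  · rw [IsLocalRing.jacobson_eq_maximalIdeal]
    exact bot_ne_top
  · intro a _
    obtain ⟨n, hn, b, rfl⟩ := h a
    exact Submodule.add_mem_sup hn (Submodule.smul_mem_smul hx trivial)

lemma nak0 [IsLocalRing R] {x : R} (hx : x ∈ maximalIdeal R) [Module.Finite R A]
    (h : ∀ a : A, ∃ b, a = x • b) (a : A) : a = 0 := by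
  have := nak hx (⊥ : Submodule R A) (fun a => ⟨0, rfl, by simpa using h a⟩)
  have h2 : a ∈ (⊥ : Submodule R A) := by rw [this]; trivial
  simpa using h2

/-- precomposition on Ext -/
noncomputable def pre {i : ℕ} (f : A →ₗ[R] B) (y : Abelian.Ext (ModuleCat.of R B) (ModuleCat.of R Y) i) :
    Abelian.Ext (ModuleCat.of R A) (ModuleCat.of R Y) i :=
  (Abelian.Ext.mk₀ (ModuleCat.ofHom f)).comp y (zero_add i)

lemma pre_pre {i : ℕ} (f : A →ₗ[R] B) (g : B →ₗ[R] D)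
    (y : Abelian.Ext (ModuleCat.of R D) (ModuleCat.of R Y) i) : pre f (pre g y) = pre (g ∘ₗ f) y := by
  simp only [pre, Abelian.Ext.mk₀_comp_mk₀_assoc, ModuleCat.ofHom_comp]

lemma pre_id {i : ℕ} (y : Abelian.Ext (ModuleCat.of R D) (ModuleCat.of R Y) i) : pre LinearMap.id y = y := by
  simp only [pre, ModuleCat.ofHom_id, Abelian.Ext.mk₀_id_comp]

lemma pre_add {i : ℕ} (f g : A →ₗ[R] B)
    (y : Abelian.Ext (ModuleCat.of R B) (ModuleCat.of R Y) i) : pre (f + g) y = pre f y + pre g y := by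
  have : ModuleCat.ofHom (f + g) = ModuleCat.ofHom f + ModuleCat.ofHom g := rfl
  simp only [pre, this, Abelian.Ext.mk₀_add, Abelian.Ext.add_comp]

lemma pre_smul {i : ℕ} (r : R) (y : Abelian.Ext (ModuleCat.of R D) (ModuleCat.of R Y) i) :
    pre (r • LinearMap.id) y = r • y := by
  have : ModuleCat.ofHom (r • (LinearMap.id : D →ₗ[R] D)) = r • 𝟙 (ModuleCat.of R D) := rfl
  simp only [pre, this, Abelian.Ext.mk₀_smul, Abelian.Ext.smul_comp, Abelian.Ext.mk₀_id_comp]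

lemma EV.of_nak [IsLocalRing R] [IsNoetherianRing R] [Module.Finite R A] [Module.Finite R Y] {x : R}
    (hx : x ∈ maximalIdeal R) {i : ℕ}
    (h : ∀ y : Abelian.Ext (ModuleCat.of R A) (ModuleCat.of R Y) i, ∃ z, y = pre (x • LinearMap.id) z) :
    EV R i A Y := by
  refine EV.of_zero fun y => ?_
  have : Module.Finite R (Abelian.Ext (ModuleCat.of R A) (ModuleCat.of R Y) i) := ModuleCat.finite_ext R (ModuleCat.of R A) (ModuleCat.of R Y) i
  have key : ∀ y : Abelian.Ext (ModuleCat.of R A) (ModuleCat.of R Y) i,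
      ∃ z : Abelian.Ext (ModuleCat.of R A) (ModuleCat.of R Y) i, y = x • z := by
    intro y
    obtain ⟨z, rfl⟩ := h y
    exact ⟨z, pre_smul x z⟩
  have nz : ∀ {E : Type u} [AddCommGroup E] [Module R E] [Module.Finite R E] (_ : ∀ a : E, ∃ b, a = x • b) (a : E),
    a = 0 := fun h a => nak0 hx h a
  exact nz key y

variable [IsNoetherianRing R] [IsLocalRing R] {C : Type u} [AddCommGroup C] [Module R C] (hC : SD R C)

lemma pc_comp (f : A →ₗ[R] B) (g : B →ₗ[R] D) : pc C (g ∘ₗ f) = pc C f ∘ₗ pc C g := rfl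

include hC in
/-- main step : `K → F × S → S` where the map to `S` is `x • s - π f` -/
lemma TR.of_scale {x : R} (hx : x ∈ maximalIdeal R) [Module.Finite R S] (hF : TR R C F)
    {k : K →ₗ[R] F × S} {p : F × S →ₗ[R] S} (h : SES k p) (hp : ∀ s, p (0, s) = x • s) (hK : TR R C K) :
    TR R C S := by
  have := hC.fin
  have hpr : p ∘ₗ LinearMap.inr R F S = x • LinearMap.id := by
    ext s; exact hp s
  have pe1 : PE R S C := by
    intro i
    refine EV.of_nak hx fun y => ?_
    obtain ⟨z, hz⟩ := Abelian.Ext.contravariant_sequence_exact₂ h.shortExact _ (pre (LinearMap.snd R F S) y)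
      ((hK.pe i).eq_zero _)
    refine ⟨z, ?_⟩
    have hz' : pre p z = pre (LinearMap.snd R F S) y := hz
    rw [← hpr, ← pre_pre, hz', pre_pre, LinearMap.snd_comp_inr, pre_id]
  have hd : SES (pc C p) (pc C k) := h.hom C (pe1.extend h)
  have finS : Module.Finite R (S →ₗ[R] C) := finite_hom
  have hdec : (LinearMap.id : ((F × S) →ₗ[R] C) →ₗ[R] _) =
      pc C (LinearMap.fst R F S) ∘ₗ pc C (LinearMap.inl R F S) +
        pc C (LinearMap.snd R F S) ∘ₗ pc C (LinearMap.inr R F S) := by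
    apply LinearMap.ext
    intro φ
    apply LinearMap.ext
    rintro ⟨a, b⟩
    change φ (a, b) = φ (a, 0) + φ (0, b)
    rw [← map_add]; simp
  have hpr' : pc C (LinearMap.inr R F S) ∘ₗ pc C p = x • LinearMap.id := by
    rw [← pc_comp, hpr]
    ext φ s
    simp [pc_apply]
  have pe2 : PE R (S →ₗ[R] C) C := by
    intro i
    refine EV.of_nak hx fun y => ?_
    obtain ⟨z, hz⟩ := Abelian.Ext.contravariant_sequence_exact₁ hd.shortExact _ y (add_comm 1 (i + 1))
      ((hK.pe' (i + 1)).eq_zero _)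
    have hz' : pre (pc C p) z = y := hz
    refine ⟨pre (pc C (LinearMap.snd R F S)) z, ?_⟩
    have h1 : z = pre (pc C (LinearMap.inr R F S)) (pre (pc C (LinearMap.snd R F S)) z) := by
      conv_lhs => rw [← pre_id z, hdec, pre_add]
      rw [← pre_pre, ← pre_pre, (hF.pe' i).eq_zero (pre (pc C (LinearMap.fst R F S)) z)]
      simp [pre]
    rw [← hpr', ← pre_pre, ← h1, hz']
  have hdd : SES (pc C (pc C k)) (pc C (pc C p)) := hd.hom C (hK.pe'.extend hd)
  have finSS : Module.Finite R ((S →ₗ[R] C) →ₗ[R] C) := finite_hom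
  refine ⟨inferInstance, pe1, pe2, ?_, ?_⟩
  · have hker : ∀ s : LinearMap.ker (bd R C S), s = 0 := by
      refine nak0 hx ?_
      rintro ⟨s, hs⟩
      obtain ⟨⟨f, s1⟩, rfl⟩ := h.surj s
      obtain ⟨ξ, hξ⟩ := hdd.lift (b := bd R C (F × S) (f, s1)) hs
      obtain ⟨κ, rfl⟩ := hK.bij.2 ξ
      have e1 : f = (k κ).1 := by
        apply hF.bij.1
        ext φ
        exact (LinearMap.congr_fun hξ (φ ∘ₗ LinearMap.fst R F S)).symm
      have e2 : s1 - (k κ).2 ∈ LinearMap.ker (bd R C S) := by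
        rw [LinearMap.mem_ker, map_sub, sub_eq_zero]
        ext φ
        exact (LinearMap.congr_fun hξ (φ ∘ₗ LinearMap.snd R F S)).symm
      refine ⟨⟨_, e2⟩, ?_⟩
      ext
      change p (f, s1) = x • (s1 - (k κ).2)
      rw [← hp, ← sub_zero (p (f, s1)), ← h.zero κ, ← map_sub]
      congr 1
      ext
      · simp [e1]
      · simp
    rw [injective_iff_map_eq_zero]
    intro s hs
    exact congr($(hker ⟨s, hs⟩).1)
  · rw [← LinearMap.range_eq_top]
    refine nak hx _ fun ζ => ?_
    obtain ⟨ω, rfl⟩ := hdd.surj ζ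
    obtain ⟨f, hf⟩ := hF.bij.2 (ω ∘ₗ pc C (LinearMap.fst R F S))
    refine ⟨bd R C S (p (f, 0)), ⟨_, rfl⟩, ω ∘ₗ pc C (LinearMap.snd R F S), ?_⟩
    ext φ
    have e1 := LinearMap.congr_fun hf (φ ∘ₗ p ∘ₗ LinearMap.inl R F S)
    have e2 : pc C p φ = pc C (LinearMap.fst R F S) (φ ∘ₗ p ∘ₗ LinearMap.inl R F S) +
        pc C (LinearMap.snd R F S) (x • φ) := by
      apply LinearMap.ext
      rintro ⟨a, b⟩
      change φ (p (a, b)) = φ (p (a, 0)) + x • φ b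
      rw [← map_smul, ← hp, ← map_add, ← map_add]; simp
    change ω (pc C p φ) = φ (p (f, 0)) + x • ω (pc C (LinearMap.snd R F S) φ)
    rw [e2, map_add, map_smul, map_smul]
    congr 1
    exact e1.symm

/-- the auxiliary module -/
abbrev KK (x : R) (π : F →ₗ[R] S) : Submodule R (F × S) :=
  LinearMap.ker (x • LinearMap.snd R F S - π ∘ₗ LinearMap.fst R F S)

omit [IsNoetherianRing R] [IsLocalRing R] in
lemma ses_KK (x : R) {π : F →ₗ[R] S} (hπ : Function.Surjective π) :
    SES (KK x π).subtype (x • LinearMap.snd R F S - π ∘ₗ LinearMap.fst R F S) := by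
  refine ses_ker fun s => ?_
  obtain ⟨f, rfl⟩ := hπ s
  exact ⟨(-f, 0), by simp⟩

omit [IsNoetherianRing R] [IsLocalRing R] in
lemma mem_KK {x : R} {π : F →ₗ[R] S} {f : F} {s : S} : (f, s) ∈ KK x π ↔ x • s = π f := by
  simp [KK, sub_eq_zero]

omit [IsNoetherianRing R] [IsLocalRing R] in
/-- the syzygy of `KK` -/
lemma ses_KK_syz (x : R) {π : F →ₗ[R] S} (hπ : Function.Surjective π) {F' : Type u} [AddCommGroup F'] [Module R F']
    {π' : F' →ₗ[R] LinearMap.ker π} (hπ' : Function.Surjective π') :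
    ∃ (i : KK x π' →ₗ[R] F' × F) (q : F' × F →ₗ[R] KK x π), SES i q := by
  let q0 : F' × F →ₗ[R] F × S := LinearMap.prod
    (((LinearMap.ker π).subtype ∘ₗ π') ∘ₗ LinearMap.fst R F' F + x • LinearMap.snd R F' F)
    (π ∘ₗ LinearMap.snd R F' F)
  have hq0 : ∀ a b, q0 (a, b) = ((π' a : F) + x • b, π b) := fun a b => rfl
  have hmem : ∀ z, q0 z ∈ KK x π := by
    rintro ⟨a, b⟩
    rw [hq0, mem_KK, map_add, (π' a).2, zero_add, map_smul]
  let i : KK x π' →ₗ[R] F' × F := (LinearMap.prodMap LinearMap.id (-(LinearMap.ker π).subtype)) ∘ₗ (KK x π').subtype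
  have hi : ∀ z, i z = (z.1.1, -(z.1.2 : F)) := fun z => rfl
  refine ⟨i, q0.codRestrict _ hmem, ?_, ?_, ?_⟩
  · rintro ⟨⟨a, b⟩, h1⟩ ⟨⟨a', b'⟩, h2⟩ hh
    rw [hi, hi] at hh
    simp only [Prod.mk.injEq, neg_inj] at hh
    obtain ⟨rfl, hb⟩ := hh
    have : b = b' := Subtype.ext hb
    subst this
    rfl
  · rintro ⟨a, b⟩
    constructor
    · intro hh
      have hh' : q0 (a, b) = 0 := congr($(hh).1)
      rw [hq0] at hh'
      have h1 : (π' a : F) + x • b = 0 := congr($(hh').1)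
      have h2 : π b = 0 := congr($(hh').2)
      refine ⟨⟨(a, -⟨b, h2⟩), ?_⟩, ?_⟩
      · rw [mem_KK]
        ext
        simp only [Submodule.coe_smul, Submodule.coe_neg, smul_neg]
        exact (eq_neg_of_add_eq_zero_left h1).symm
      · rw [hi]; simp
    · rintro ⟨⟨⟨a', b'⟩, h1⟩, h2⟩
      rw [hi] at h2
      simp only [Prod.mk.injEq] at h2
      obtain ⟨rfl, rfl⟩ := h2
      rw [mem_KK] at h1
      ext1
      change q0 _ = 0
      rw [hq0, ← h1]
      ext
      · simp
      · simp
  · rintro ⟨⟨f, s⟩, h⟩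
    rw [mem_KK] at h
    obtain ⟨b, rfl⟩ := hπ s
    obtain ⟨a, ha⟩ := hπ' ⟨f - x • b, by simp [h]⟩
    refine ⟨(a, b), ?_⟩
    ext1
    change q0 _ = _
    rw [hq0, ha]
    simp

include hC in
lemma syz_of_KK {x : R} (hx : x ∈ maximalIdeal R) (e : ℕ) (S : ModuleCat.{u} R) [Module.Finite R S] (m : ℕ)
    (π : (Fin m → R) →ₗ[R] S) (hπ : Function.Surjective π) (h : Syz (cWP R C) e (ModuleCat.of R (KK x π))) :
    Syz (cWP R C) e S := by
  induction e generalizing S m with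
  | zero =>
    have h1 : Module.Finite R (KK x π) := inferInstance
    have h2 : TR R C (KK x π) := WF.toTR hC (WP.toWF hC h)
    refine WF.toWP hC (TR.toWF hC (TR.of_scale hC hx (TR.free hC m) (ses_KK x hπ) ?_ h2))
    intro s
    simp
  | succ e ih =>
    have hfin : Module.Finite R (LinearMap.ker π) := inferInstance
    obtain ⟨m', π', hπ'⟩ := Module.Finite.exists_fin' R (LinearMap.ker π)
    obtain ⟨i, q, hs⟩ := ses_KK_syz x hπ hπ'
    have hp : Module.Projective R (Fin m → R) := inferInstance
    have := ih (ModuleCat.of R (LinearMap.ker π)) m' π' hπ'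
      (Syz.indep (resP hC) (K := ModuleCat.of R (KK x π')) (P := ModuleCat.of R ((Fin m' → R) × (Fin m → R))) hs
        (inferInstanceAs (Module.Projective R ((Fin m' → R) × (Fin m → R)))) h)
    exact ⟨_, ModuleCat.of R (Fin m → R), _, _, ses_ker hπ, hp, this⟩

include hC in
lemma stepB {x : R} (hx : x ∈ maximalIdeal R) {M : Type u} [AddCommGroup M] [Module R M] [Module.Finite R M]
    [Nontrivial M] (hreg : IsSMulRegular M x) (e : ℕ)
    (h : Syz (cWP R C) e (ModuleCat.of R (QuotSMulTop x M))) :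
    ∃ e', e = e' + 1 ∧ Syz (cWP R C) e' (ModuleCat.of R M) := by
  have := hC.fin
  have hses : SES (x • (LinearMap.id : M →ₗ[R] M)) (Submodule.mkQ (x • (⊤ : Submodule R M))) := by
    refine ⟨hreg, ?_, Submodule.mkQ_surjective _⟩
    intro m
    simp only [Submodule.mkQ_apply, Submodule.Quotient.mk_eq_zero, Submodule.mem_smul_pointwise_iff_exists]
    simp
  cases e with
  | zero =>
    exfalso
    have h2 : TR R C (QuotSMulTop x M) := WF.toTR hC (WP.toWF hC h)
    have h3 : ∀ φ : M →ₗ[R] C, φ = 0 := by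
      have : Module.Finite R (M →ₗ[R] C) := finite_hom
      refine nak0 hx fun φ => ?_
      obtain ⟨ψ, hψ⟩ := h2.pe.extend hses φ
      refine ⟨ψ, ?_⟩
      rw [← hψ]
      ext; simp
    have h4 : ∀ a : QuotSMulTop x M, a = 0 := by
      intro a
      apply h2.bij.1
      rw [map_zero]
      ext φ
      obtain ⟨m, rfl⟩ := hses.surj a
      exact LinearMap.congr_fun (h3 (φ ∘ₗ Submodule.mkQ _)) m
    obtain ⟨m, hm⟩ := exists_ne (0 : M)
    refine hm (nak0 hx (fun a => ?_) m)
    obtain ⟨b, hb⟩ := hses.lift (h4 (Submodule.mkQ _ a))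
    exact ⟨b, hb.symm⟩
  | succ e =>
    refine ⟨e, rfl, ?_⟩
    obtain ⟨m, π, hπ⟩ := Module.Finite.exists_fin' R M
    refine syz_of_KK hC hx e (ModuleCat.of R M) m π hπ ?_
    have hs : SES (LinearMap.fst R (Fin m → R) M ∘ₗ (KK x π).subtype)
        (Submodule.mkQ (x • (⊤ : Submodule R M)) ∘ₗ π) := by
      refine ⟨?_, ?_, hses.surj.comp hπ⟩
      · rintro ⟨⟨a, b⟩, h1⟩ ⟨⟨a', b'⟩, h2⟩ hh
        have : a = a' := hh
        subst this
        rw [mem_KK] at h1 h2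
        have : b = b' := hreg (h1.trans h2.symm)
        subst this
        rfl
      · intro a
        constructor
        · intro ha
          obtain ⟨b, hb⟩ := hses.lift (b := π a) ha
          exact ⟨⟨(a, b), mem_KK.2 hb⟩, rfl⟩
        · rintro ⟨⟨⟨a', b'⟩, h1⟩, rfl⟩
          rw [mem_KK] at h1
          change Submodule.mkQ _ (π a') = 0
          rw [← h1]
          exact hses.zero b'
    exact Syz.indep (resP hC) (K := ModuleCat.of R (KK x π)) (P := ModuleCat.of R (Fin m → R))
      (A := ModuleCat.of R (QuotSMulTop x M)) hs (inferInstanceAs (Module.Projective R (Fin m → R))) h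

end stepB
end GCAux

namespace GCAux
open CategoryTheory TensorProduct
open scoped Pointwise
section iter
variable {R : Type u} [CommRing R]
variable {A B D : Type u} [AddCommGroup A] [AddCommGroup B] [AddCommGroup D]
    [Module R A] [Module R B] [Module R D]

/-- The module `R_x / R`. -/
abbrev LL (x : R) : Type u := Localization.Away x ⧸ LinearMap.range (Algebra.linearMap R (Localization.Away x))

/-- localization map -/
def jj (x : R) (A : Type u) [AddCommGroup A] [Module R A] : A →ₗ[R] Localization.Away x ⊗[R] A :=
  TensorProduct.mk R (Localization.Away x) A 1

/-- quotient map -/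
def qq (x : R) (A : Type u) [AddCommGroup A] [Module R A] : Localization.Away x ⊗[R] A →ₗ[R] LL x ⊗[R] A :=
  LinearMap.rTensor A (Submodule.mkQ _)

instance jj_loc (x : R) : IsLocalizedModule (Submonoid.powers x) (jj x A) :=
  (isLocalizedModule_iff_isBaseChange (Submonoid.powers x) (Localization.Away x) _).2
    (TensorProduct.isBaseChange R A (Localization.Away x))

lemma jj_inj {x : R} (hx : IsSMulRegular A x) : Function.Injective (jj x A) := by
  intro a b h
  obtain ⟨⟨_, k, rfl⟩, hc⟩ := (IsLocalizedModule.eq_iff_exists (Submonoid.powers x) (jj x A)).1 h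
  exact hx.pow k hc

lemma qq_surj (x : R) : Function.Surjective (qq x A) := LinearMap.rTensor_surjective A (Submodule.mkQ_surjective _)

lemma jq_exact (x : R) : Function.Exact (jj x A) (qq x A) := by
  have h0 : Function.Exact (Algebra.linearMap R (Localization.Away x))
    (Submodule.mkQ (LinearMap.range (Algebra.linearMap R (Localization.Away x)))) := by
    intro b; simp
  have h := rTensor_exact A h0 (Submodule.mkQ_surjective _)
  intro b
  refine (h b).trans ⟨?_, ?_⟩
  · rintro ⟨c, rfl⟩
    refine ⟨TensorProduct.lid R A c, ?_⟩
    obtain ⟨a, rfl⟩ := (TensorProduct.lid R A).symm.surjective c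
    simp [jj]
  · rintro ⟨a, rfl⟩
    exact ⟨1 ⊗ₜ a, by simp [jj]⟩

lemma ses_jq {x : R} (hx : IsSMulRegular A x) : SES (jj x A) (qq x A) := ⟨jj_inj hx, jq_exact x, qq_surj x⟩

/-- inverse of `x` -/
lemma x_bij (x : R) : Function.Bijective (fun a : Localization.Away x ⊗[R] A => x • a) := by
  have := IsLocalizedModule.map_units (jj x A) (⟨x, 1, by simp⟩ : Submonoid.powers x)
  exact (Module.End.isUnit_iff _).1 this

def PT (r : R) (A : Type u) [AddCommGroup A] [Module R A] : Prop := ∀ a : A, ∃ k : ℕ, r ^ k • a = 0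

lemma PT.tensor {r : R} (h : PT r A) : PT r (D ⊗[R] A) := by
  intro t
  induction t with
  | zero => exact ⟨0, smul_zero _⟩
  | tmul d a =>
    obtain ⟨k, hk⟩ := h a
    exact ⟨k, by rw [← TensorProduct.tmul_smul, hk, tmul_zero]⟩
  | add s t hs ht =>
    obtain ⟨k, hk⟩ := hs
    obtain ⟨l, hl⟩ := ht
    refine ⟨k + l, ?_⟩
    rw [smul_add, pow_add, mul_smul, mul_smul, hl, smul_zero, add_zero, smul_comm, hk, smul_zero]

lemma pt_LL (x : R) : PT x (LL x ⊗[R] A) := by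
  intro t
  obtain ⟨s, rfl⟩ := qq_surj x t
  obtain ⟨⟨a, ⟨_, k, rfl⟩⟩, h⟩ := IsLocalizedModule.surj (Submonoid.powers x) (jj x A) s
  refine ⟨k, ?_⟩
  rw [← map_smul]
  change qq x A (x ^ k • s) = 0
  have h : x ^ k • s = jj x A a := h
  rw [h]
  exact (jq_exact x).apply_apply_eq_zero a

/-- `A` is the kernel of surjective multiplication by `x` on the `x`-torsion module `B`. -/
structure KerM (x : R) (f : A →ₗ[R] B) : Prop where
  ses : SES f (x • (LinearMap.id : B →ₗ[R] B))
  pt : PT x B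

lemma KerM.xf {x : R} {f : A →ₗ[R] B} (h : KerM x f) (a : A) : x • f a = 0 := h.ses.zero a

lemma KerM.xl {x : R} {f : A →ₗ[R] B} (h : KerM x f) {b : B} (hb : x • b = 0) : ∃ a, f a = b := h.ses.lift hb

lemma KerM.reg {x y : R} {f : A →ₗ[R] B} (h : KerM x f) (hy : IsSMulRegular A y) : IsSMulRegular B y := by
  rw [isSMulRegular_iff_right_eq_zero_of_smul] at *
  have key : ∀ k (b : B), x ^ k • b = 0 → y • b = 0 → b = 0 := by
    intro k
    induction k with
    | zero => intro b hb _; simpa using hb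
    | succ k ih =>
      intro b hb hyb
      refine ih b ?_ hyb
      rw [pow_succ', mul_smul] at hb
      obtain ⟨a, ha⟩ := h.xl hb
      have : y • a = 0 := h.ses.inj (by rw [map_smul, ha, smul_comm, hyb, smul_zero, map_zero])
      rw [← ha, hy _ this, map_zero]
  intro b hb
  obtain ⟨k, hk⟩ := h.pt b
  exact key k b hk hb

lemma KerM.quot {x y : R} {f : A →ₗ[R] B} (h : KerM x f) (hy : IsSMulRegular A y) :
    KerM x (QuotSMulTop.map y f) := by
  have hyB := h.reg hy
  refine ⟨⟨?_, ?_, ?_⟩, ?_⟩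
  · rw [injective_iff_map_eq_zero]
    intro a ha
    obtain ⟨a, rfl⟩ := Submodule.mkQ_surjective _ a
    have h1 : (Submodule.Quotient.mk (f a) : QuotSMulTop y B) = 0 := ha
    rw [Submodule.Quotient.mk_eq_zero, Submodule.mem_smul_pointwise_iff_exists] at h1
    obtain ⟨b, -, hb⟩ := h1
    have h2 : x • b = 0 := hyB (by
      change y • x • b = y • (0 : B)
      rw [smul_comm, hb, h.xf, smul_zero])
    obtain ⟨a', rfl⟩ := h.xl h2
    rw [← map_smul] at hb
    have := h.ses.inj hb
    subst this
    rw [Submodule.mkQ_apply, Submodule.Quotient.mk_eq_zero, Submodule.mem_smul_pointwise_iff_exists]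
    exact ⟨a', trivial, rfl⟩
  · intro b
    constructor
    · intro hb
      obtain ⟨b, rfl⟩ := Submodule.mkQ_surjective _ b
      have h1 : (Submodule.Quotient.mk (x • b) : QuotSMulTop y B) = 0 := hb
      rw [Submodule.Quotient.mk_eq_zero, Submodule.mem_smul_pointwise_iff_exists] at h1
      obtain ⟨c, -, hc⟩ := h1
      obtain ⟨d, rfl⟩ := h.ses.surj c
      have h2 : x • (b - y • d) = 0 := by
        rw [smul_sub, smul_comm x y, ← hc]; simp
      obtain ⟨a, ha⟩ := h.xl h2
      refine ⟨Submodule.Quotient.mk a, ?_⟩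
      change (Submodule.Quotient.mk (f a) : QuotSMulTop y B) = Submodule.Quotient.mk b
      rw [Submodule.Quotient.eq, ha, Submodule.mem_smul_pointwise_iff_exists]
      exact ⟨-d, trivial, by simp⟩
    · rintro ⟨a, rfl⟩
      obtain ⟨a, rfl⟩ := Submodule.mkQ_surjective _ a
      change (Submodule.Quotient.mk (x • f a) : QuotSMulTop y B) = 0
      rw [h.xf]; rfl
  · intro b
    obtain ⟨b, rfl⟩ := Submodule.mkQ_surjective _ b
    obtain ⟨d, rfl⟩ := h.ses.surj b
    exact ⟨Submodule.Quotient.mk d, rfl⟩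
  · intro b
    obtain ⟨b, rfl⟩ := Submodule.mkQ_surjective _ b
    obtain ⟨k, hk⟩ := h.pt b
    exact ⟨k, by rw [← map_smul, hk, map_zero]⟩

lemma KerM.weak {x : R} (rs : List R) : ∀ {A B : Type u} [AddCommGroup A] [AddCommGroup B]
    [Module R A] [Module R B] {f : A →ₗ[R] B} (_ : KerM x f)
    (_ : RingTheory.Sequence.IsWeaklyRegular A rs), RingTheory.Sequence.IsWeaklyRegular B rs := by
  induction rs with
  | nil => intros; exact RingTheory.Sequence.IsWeaklyRegular.nil R _
  | cons y ys ih =>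
    intro A B _ _ _ _ f h hA
    rw [RingTheory.Sequence.isWeaklyRegular_cons_iff] at *
    exact ⟨h.reg hA.1, ih (h.quot hA.1) hA.2⟩

/-- `m ↦ m / x` -/
lemma KerM.base {x : R} (hx : IsSMulRegular A x) : ∃ f : QuotSMulTop x A →ₗ[R] LL x ⊗[R] A, KerM x f := by
  let v : Localization.Away x := IsLocalization.Away.invSelf x
  have hv : x • v = 1 := by
    rw [Algebra.smul_def]; exact IsLocalization.Away.mul_invSelf x
  let φ : A →ₗ[R] LL x ⊗[R] A := qq x A ∘ₗ TensorProduct.mk R (Localization.Away x) A v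
  have hφ : ∀ a, φ a = qq x A (v ⊗ₜ a) := fun a => rfl
  have hxv : ∀ a : A, x • (v ⊗ₜ[R] a) = jj x A a := fun a => by
    rw [TensorProduct.smul_tmul', hv]; rfl
  have hle : x • (⊤ : Submodule R A) ≤ LinearMap.ker φ := by
    intro a ha
    rw [Submodule.mem_smul_pointwise_iff_exists] at ha
    obtain ⟨b, -, rfl⟩ := ha
    rw [LinearMap.mem_ker, hφ, tmul_smul, hxv]
    exact (jq_exact x).apply_apply_eq_zero b
  refine ⟨Submodule.liftQ _ φ hle, ⟨?_, ?_, ?_⟩, pt_LL x⟩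
  · rw [injective_iff_map_eq_zero]
    intro a ha
    obtain ⟨a, rfl⟩ := Submodule.mkQ_surjective _ a
    change φ a = 0 at ha
    rw [hφ] at ha
    obtain ⟨b, hb⟩ := (jq_exact x _).1 ha
    have : a = x • b := by
      apply jj_inj hx
      rw [← hxv, ← hb, map_smul]
    rw [Submodule.mkQ_apply, Submodule.Quotient.mk_eq_zero, Submodule.mem_smul_pointwise_iff_exists]
    exact ⟨b, trivial, this.symm⟩
  · intro t
    constructor
    · intro ht
      obtain ⟨s, rfl⟩ := qq_surj x t
      change x • qq x A s = 0 at ht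
      rw [← map_smul] at ht
      obtain ⟨a, ha⟩ := (jq_exact x _).1 ht
      refine ⟨Submodule.Quotient.mk a, ?_⟩
      change φ a = _
      rw [hφ]
      congr 1
      apply (x_bij x).1
      change x • _ = x • _
      rw [hxv, ha]
    · rintro ⟨a, rfl⟩
      obtain ⟨a, rfl⟩ := Submodule.mkQ_surjective _ a
      change x • φ a = 0
      rw [hφ, ← map_smul, hxv]
      exact (jq_exact x).apply_apply_eq_zero a
  · intro t
    obtain ⟨s, rfl⟩ := qq_surj x t
    obtain ⟨s, rfl⟩ := (x_bij x).2 s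
    exact ⟨qq x A s, by simp⟩

lemma qq_nat (y : R) (f : A →ₗ[R] B) (t : Localization.Away y ⊗[R] A) :
    qq y B (f.lTensor _ t) = f.lTensor _ (qq y A t) := by
  induction t with
  | zero => simp
  | tmul a b => simp [qq]
  | add s t hs ht => simp only [map_add, hs, ht]

lemma KerM.tensor {x y : R} {f : A →ₗ[R] B} (h : KerM x f) (hy : IsSMulRegular A y) :
    KerM x (f.lTensor (LL y)) := by
  have hyB := h.reg hy
  have e1 : (x • LinearMap.id : LL y ⊗[R] B →ₗ[R] _) = (x • LinearMap.id : B →ₗ[R] B).lTensor (LL y) := by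
    ext a b
    simp
  refine ⟨⟨?_, ?_, ?_⟩, h.pt.tensor⟩
  · rw [injective_iff_map_eq_zero]
    intro t ht
    obtain ⟨s, rfl⟩ := qq_surj y t
    rw [← qq_nat] at ht
    obtain ⟨b, hb⟩ := (jq_exact y _).1 ht
    have hfj : ∀ a, f.lTensor _ (jj y A a) = jj y B (f a) := fun a => rfl
    have hb0 : x • b = 0 := by
      apply jj_inj hyB
      rw [map_smul, hb, map_zero, ← map_smul]
      have hxf : x • f = 0 := by
        ext a; exact h.xf a
      have : x • (f.lTensor (Localization.Away y)) = 0 := by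
        rw [← LinearMap.lTensor_smul, hxf, LinearMap.lTensor_zero]
      rw [map_smul]
      exact LinearMap.congr_fun this s
    obtain ⟨a, rfl⟩ := h.xl hb0
    have : s = jj y A a := by
      apply Module.Flat.lTensor_preserves_injective_linearMap (M := Localization.Away y) f h.ses.inj
      rw [hfj, hb]
    rw [this]
    exact (jq_exact y).apply_apply_eq_zero a
  · rw [e1]
    exact lTensor_exact _ h.ses.exact h.ses.surj
  · rw [e1]
    exact LinearMap.lTensor_surjective _ h.ses.surj

/-- iterate -/
def iter : List R → ModuleCat.{u} R → ModuleCat.{u} R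
  | [], A => A
  | x :: xs, A => iter xs (ModuleCat.of R (LL x ⊗[R] A))

lemma weak_LL {x : R} {xs : List R} (h : RingTheory.Sequence.IsWeaklyRegular A (x :: xs)) :
    IsSMulRegular A x ∧ RingTheory.Sequence.IsWeaklyRegular (LL x ⊗[R] A) xs := by
  rw [RingTheory.Sequence.isWeaklyRegular_cons_iff] at h
  obtain ⟨f, hf⟩ := KerM.base h.1
  exact ⟨h.1, hf.weak _ h.2⟩

lemma KerM.iter {x : R} (rs : List R) : ∀ {A B : ModuleCat.{u} R} {f : A →ₗ[R] B} (_ : KerM x f)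
    (_ : RingTheory.Sequence.IsWeaklyRegular A rs), ∃ f : GCAux.iter rs A →ₗ[R] GCAux.iter rs B, KerM x f := by
  induction rs with
  | nil => intro A B f h _; exact ⟨f, h⟩
  | cons y ys ih =>
    intro A B f h hA
    obtain ⟨h1, h2⟩ := weak_LL hA
    exact ih (A := ModuleCat.of R (LL y ⊗[R] A)) (B := ModuleCat.of R (LL y ⊗[R] B)) (h.tensor h1) h2

lemma PT.iter {r : R} (rs : List R) : ∀ {A : ModuleCat.{u} R} (_ : PT r A), PT r (GCAux.iter rs A) := by
  induction rs with
  | nil => intro A h; exact h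
  | cons y ys ih => intro A h; exact ih (A := ModuleCat.of R (LL y ⊗[R] A)) (PT.tensor h)

lemma PT.iter_mem {r : R} (rs : List R) (hr : r ∈ rs) : ∀ (A : ModuleCat.{u} R), PT r (GCAux.iter rs A) := by
  induction rs with
  | nil => simp at hr
  | cons y ys ih =>
    intro A
    rcases List.mem_cons.1 hr with rfl | h
    · exact PT.iter ys (A := ModuleCat.of R (GCAux.LL r ⊗[R] A)) (pt_LL r)
    · exact ih h _

lemma iter_tors [IsNoetherianRing R] [IsLocalRing R] (rs : List R) (M : ModuleCat.{u} R)
    (h : maximalIdeal R ≤ (Ideal.ofList rs ⊔ Module.annihilator R M).radical) (t : iter rs M) :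
    ∃ k : ℕ, ∀ r ∈ maximalIdeal R ^ k, r • t = 0 := by
  let J : Ideal R := LinearMap.ker (LinearMap.toSpanSingleton R (iter rs M) t)
  have hJ : ∀ r, r ∈ J ↔ r • t = 0 := fun r => Iff.rfl
  have h1 : Ideal.ofList rs ⊔ Module.annihilator R M ≤ J.radical := by
    refine sup_le (Ideal.span_le.2 fun r hr => ?_) fun r hr => ?_
    · obtain ⟨k, hk⟩ := PT.iter_mem rs hr M t
      exact ⟨k, hk⟩
    · obtain ⟨k, hk⟩ := PT.iter (r := r) rs (A := M)
        (fun a => ⟨1, by rw [pow_one]; exact Module.mem_annihilator.1 hr a⟩) t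
      exact ⟨k, hk⟩
  have h2 : maximalIdeal R ≤ J.radical :=
    h.trans ((Ideal.radical_mono h1).trans (Ideal.radical_idem J).le)
  obtain ⟨k, hk⟩ := Ideal.exists_pow_le_of_le_radical_of_fg h2 (IsNoetherian.noetherian _)
  exact ⟨k, fun r hr => hk hr⟩

lemma syz_tensor {C : Type u} [AddCommGroup C] [Module R C] [IsNoetherianRing R] [IsLocalRing R] (hC : SD R C)
    (F : Type u) [AddCommGroup F] [Module R F] [Module.Flat R F] (n : ℕ) : ∀ A : ModuleCat.{u} R,
    Syz (cWD R C) n A → Syz (cWD R C) n (ModuleCat.of R (F ⊗[R] A)) := by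
  induction n with
  | zero =>
    intro A h
    have : WD R C A := h
    exact IsW.congr (WD.tensor_flat hC this (F := F)) (TensorProduct.comm R A F)
  | succ n ih =>
    rintro A ⟨K, P, f, g, hs, hP, hK⟩
    have : Module.Flat R P := inferInstance
    exact Syz.cok (resD hC) (A := ModuleCat.of R (F ⊗[R] K)) (B := ModuleCat.of R (F ⊗[R] P))
      (D := ModuleCat.of R (F ⊗[R] A)) (hs.lTensor F) (ih K hK)
      (Syz.of_mem (resD hC) (WD.of_flat hC (F ⊗[R] P)) n)

lemma iter_up {C : Type u} [AddCommGroup C] [Module R C] [IsNoetherianRing R] [IsLocalRing R] (hC : SD R C)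
    (rs : List R) : ∀ (n : ℕ) (A : ModuleCat.{u} R), RingTheory.Sequence.IsWeaklyRegular A rs →
    Syz (cWD R C) n A → Syz (cWD R C) (n + rs.length) (iter rs A) := by
  induction rs with
  | nil => intro n A _ h; exact h
  | cons x xs ih =>
    intro n A hA h
    obtain ⟨h1, h2⟩ := weak_LL hA
    have := ih (n + 1) (ModuleCat.of R (LL x ⊗[R] A)) h2
      (Syz.cok (resD hC) (A := A) (B := ModuleCat.of R (Localization.Away x ⊗[R] A))
        (D := ModuleCat.of R (LL x ⊗[R] A)) (ses_jq h1) h (syz_tensor hC _ n A h))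
    rw [List.length_cons, show n + (xs.length + 1) = n + 1 + xs.length by omega]
    exact this

lemma iter_down {C : Type u} [AddCommGroup C] [Module R C] [IsNoetherianRing R] [IsLocalRing R] (hC : SD R C)
    (rs : List R) : ∀ (d : ℕ) (A : Type u) [AddCommGroup A] [Module R A] [Module.Finite R A] [Nontrivial A],
    (∀ x ∈ rs, x ∈ maximalIdeal R) → RingTheory.Sequence.IsWeaklyRegular A rs →
    Syz (cWD R C) d (iter rs (ModuleCat.of R A)) →
    ∃ d', d = d' + rs.length ∧ Syz (cWP R C) d' (ModuleCat.of R A) := by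
  induction rs with
  | nil =>
    intro d A _ _ _ _ _ _ h
    have : Module.Finite R (ModuleCat.of R A) := inferInstanceAs (Module.Finite R A)
    exact ⟨d, rfl, (syzP_iff_syzD hC d (ModuleCat.of R A)).2 h⟩
  | cons x xs ih =>
    intro d A _ _ _ _ hm hA h
    have hx : x ∈ maximalIdeal R := hm x (by simp)
    rw [RingTheory.Sequence.isWeaklyRegular_cons_iff] at hA
    obtain ⟨f, hf⟩ := KerM.base hA.1
    obtain ⟨f', hf'⟩ := KerM.iter xs (A := ModuleCat.of R (QuotSMulTop x A))
      (B := ModuleCat.of R (LL x ⊗[R] A)) hf hA.2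
    have h1 : Syz (cWD R C) d (iter xs (ModuleCat.of R (QuotSMulTop x A))) :=
      Syz.ker (resD hC) hf'.ses h h
    have : Nontrivial (QuotSMulTop x A) := by
      by_contra hn
      rw [not_nontrivial_iff_subsingleton] at hn
      obtain ⟨m, hm⟩ := exists_ne (0 : A)
      refine hm (nak0 hx (fun a => ?_) m)
      have : (Submodule.Quotient.mk a : QuotSMulTop x A) = 0 := Subsingleton.elim _ _
      rw [Submodule.Quotient.mk_eq_zero, Submodule.mem_smul_pointwise_iff_exists] at this
      obtain ⟨b, -, hb⟩ := this
      exact ⟨b, hb.symm⟩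
    obtain ⟨d', rfl, h2⟩ := ih d (QuotSMulTop x A) (fun y hy => hm y (by simp [hy])) hA.2 h1
    obtain ⟨e, rfl, h3⟩ := stepB hC hx hA.1 d' h2
    exact ⟨e, by rw [List.length_cons]; omega, h3⟩

lemma exists_seq [IsNoetherianRing R] [IsLocalRing R] (M : Type u) [AddCommGroup M] [Module R M] [Module.Finite R M]
    [Nontrivial M] (n : ℕ) (hd : moduleDim R M = (n : WithBot ℕ∞)) (hCM : IsCohenMacaulayModule R M) :
    ∃ rs : List R, rs.length = n ∧ (∀ x ∈ rs, x ∈ maximalIdeal R) ∧ RingTheory.Sequence.IsWeaklyRegular M rs ∧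
      maximalIdeal R ≤ (Ideal.ofList rs ⊔ Module.annihilator R M).radical := by
  have h0 : depth R M = (n : ℕ∞) := by
    have := hCM.trans hd
    exact_mod_cast this
  have hne : {n : ℕ∞ | ∃ rs : List R, (rs.length : ℕ∞) = n ∧ (∀ x ∈ rs, x ∈ maximalIdeal R) ∧
    RingTheory.Sequence.IsRegular M rs}.Nonempty := ⟨0, [], rfl, by simp, RingTheory.Sequence.IsRegular.nil R M⟩
  have hmem := @ENat.sSup_mem_of_nonempty_of_lt_top _ hne.to_subtype (by
    change depth R M < ⊤
    rw [h0]; exact ENat.coe_lt_top n)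
  change depth R M ∈ _ at hmem
  rw [h0] at hmem
  obtain ⟨rs, hl, hm, hr⟩ := hmem
  have hl : rs.length = n := by exact_mod_cast hl
  refine ⟨rs, hl, hm, hr.1, ?_⟩
  have h1 := Module.supportDim_add_length_eq_supportDim_of_isRegular rs hr
  rw [Module.supportDim_eq_ringKrullDim_quotient_annihilator R M] at h1
  have h2 : Module.supportDim R (M ⧸ Ideal.ofList rs • (⊤ : Submodule R M)) = 0 := by
    have h3 := h1.trans hd
    rw [hl] at h3
    generalize Module.supportDim R (M ⧸ Ideal.ofList rs • (⊤ : Submodule R M)) = s at h3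
    cases s with
    | bot => simp at h3
    | coe s =>
      have h4 : s + (n : ℕ∞) = n := by exact_mod_cast h3
      cases s with
      | top => simp at h4
      | coe s =>
        have : s + n = n := by exact_mod_cast h4
        have : s = 0 := by omega
        subst this; rfl
  have h3 := support_of_supportDim_eq_zero _ _ h2
  rw [Module.support_quotient, Module.support_eq_zeroLocus, ← PrimeSpectrum.zeroLocus_union] at h3
  rw [← PrimeSpectrum.vanishingIdeal_zeroLocus_eq_radical, PrimeSpectrum.zeroLocus_sup, ← PrimeSpectrum.zeroLocus_union,
    Set.union_comm, h3]
  exact PrimeSpectrum.subset_vanishingIdeal_zeroLocus _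

end iter
end GCAux

namespace GCAux
open CategoryTheory TensorProduct Limits
section bridge
variable {R : Type u} [CommRing R]

lemma sur_equiv {A B Z : Type*} [AddCommGroup A] [Module R A] [AddCommGroup B] [Module R B]
    [AddCommGroup Z] [Module R Z] (f : Z →ₗ[R] A) (g : Z →ₗ[R] B) (hf : Function.Surjective f)
    (hg : Function.Surjective g) (h : ∀ z, f z = 0 ↔ g z = 0) : ∃ e : A ≃ₗ[R] B, ∀ z, e (f z) = g z := by
  have hk : LinearMap.ker f = LinearMap.ker g := by ext z; exact h z
  let e := (f.quotKerEquivOfSurjective hf).symm.trans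
    ((Submodule.quotEquivOfEq _ _ hk).trans (g.quotKerEquivOfSurjective hg))
  refine ⟨e, fun z => ?_⟩
  have : f z = f.quotKerEquivOfSurjective hf (Submodule.Quotient.mk z) := rfl
  rw [this]
  simp only [e, LinearEquiv.trans_apply, LinearEquiv.symm_apply_apply]
  rfl

/-! ### homology in the opposite category -/
section opH
variable (K : ChainComplex (ModuleCat.{u} R)ᵒᵖ ℕ) (n : ℕ)

/-- cycles -/
noncomputable abbrev pO : (K.opcycles n).unop ⟶ (K.X n).unop := (K.pOpcycles n).unop
noncomputable abbrev iO : (K.opcycles n).unop ⟶ (K.homology n).unop := (K.homologyι n).unop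

lemma pO_inj : Function.Injective (pO K n) := (ModuleCat.mono_iff_injective _).1 inferInstance
lemma iO_surj : Function.Surjective (iO K n) := (ModuleCat.epi_iff_surjective _).1 inferInstance

lemma pO_exact : Function.Exact (pO K n) (K.d (n + 1) n).unop := by
  have h := (ShortComplex.exact_of_g_is_cokernel (ShortComplex.mk (K.d (n+1) n) (K.pOpcycles n) (by simp))
    (K.opcyclesIsCokernel (n + 1) n (by simp))).unop
  rw [ShortComplex.ShortExact.moduleCat_exact_iff_function_exact] at h
  exact h

lemma iO_exact (j : ℕ) (hj : (ComplexShape.down ℕ).next n = j) :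
    Function.Exact (K.fromOpcycles n j).unop (iO K n) := by
  have h := (ShortComplex.exact_of_f_is_kernel (ShortComplex.mk (K.homologyι n) (K.fromOpcycles n j) (by simp))
    (K.homologyIsKernel n j hj)).unop
  rw [ShortComplex.ShortExact.moduleCat_exact_iff_function_exact] at h
  exact h

lemma fO (j : ℕ) (w : (K.X j).unop) : pO K n ((K.fromOpcycles n j).unop w) = (K.d n j).unop w := by
  have : (K.fromOpcycles n j).unop ≫ pO K n = (K.d n j).unop := by
    rw [← unop_comp]; simp
  rw [← this]; rfl

end opH

section old
variable {X X' : ModuleCat.{u} R} (P : ProjectiveResolution X) (P' : ProjectiveResolution X') (Y : ModuleCat.{u} R) (n : ℕ)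

/-- The contravariant hom functor. -/
noncomputable abbrev FY : ModuleCat.{u} R ⥤ (ModuleCat.{u} R)ᵒᵖ := ((linearYoneda R (ModuleCat.{u} R)).obj Y).rightOp

noncomputable abbrev KY : ChainComplex (ModuleCat.{u} R)ᵒᵖ ℕ := ((FY Y).mapHomologicalComplex _).obj P.complex

noncomputable abbrev oE (X Y : ModuleCat.{u} R) (n : ℕ) : ModuleCat.{u} R :=
  ((Ext R (ModuleCat.{u} R) n).obj (Opposite.op X)).obj Y

noncomputable def isoU : ((KY P Y).homology n).unop ≅ oE X Y n :=
  (P.isoLeftDerivedObj (FY Y) n).unop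

noncomputable def clO : ((KY P Y).opcycles n).unop ⟶ oE X Y n :=
  iO (KY P Y) n ≫ (isoU P Y n).hom

lemma clO_surj : Function.Surjective (clO P Y n) := by
  refine (ModuleCat.epi_iff_surjective _).1 ?_
  unfold clO
  infer_instance

lemma clO_eq_zero (c : ((KY P Y).opcycles n).unop) : clO P Y n c = 0 ↔ iO (KY P Y) n c = 0 := by
  have : Function.Injective (isoU P Y n).hom := 
    (ModuleCat.mono_iff_injective _).1 inferInstance
  exact map_eq_zero_iff (isoU P Y n).hom.hom this

/-- underlying cocycle -/
noncomputable def coc (c : ((KY P Y).opcycles n).unop) : P.complex.X n ⟶ Y := pO (KY P Y) n c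

lemma coc_zero (c : ((KY P Y).opcycles n).unop) : P.complex.d (n + 1) n ≫ coc P Y n c = 0 :=
  (pO_exact (KY P Y) n).apply_apply_eq_zero c

lemma coc_lift (z : P.complex.X n ⟶ Y) (hz : P.complex.d (n + 1) n ≫ z = 0) : ∃ c, coc P Y n c = z :=
  (pO_exact (KY P Y) n z).1 hz

lemma clO_eq_zero' (c : ((KY P Y).opcycles n).unop) :
    clO P Y n c = 0 ↔ ∃ w : P.complex.X ((ComplexShape.down ℕ).next n) ⟶ Y, P.complex.d n _ ≫ w = coc P Y n c := by
  rw [clO_eq_zero, iO_exact (KY P Y) n _ rfl c]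
  constructor
  · rintro ⟨w, rfl⟩
    exact ⟨w, (fO (KY P Y) n _ w).symm⟩
  · rintro ⟨w, hw⟩
    exact ⟨w, pO_inj _ _ ((fO (KY P Y) n _ w).trans hw)⟩

lemma extMk_zero_iff (z : P.complex.X n ⟶ Y) (hz : P.complex.d (n + 1) n ≫ z = 0) :
    P.extMk z (n + 1) rfl hz = 0 ↔ ∃ w : P.complex.X ((ComplexShape.down ℕ).next n) ⟶ Y, P.complex.d n _ ≫ w = z := by
  cases n with
  | succ p =>
    rw [P.extMk_eq_zero_iff _ _ _ _ p rfl]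
    have : (ComplexShape.down ℕ).next (p + 1) = p := by simp
    rw [this]
  | zero =>
    have h0 : ∀ j, P.complex.d 0 j = 0 := fun j => P.complex.shape _ _ (by simp)
    constructor
    · intro h
      rw [← P.extEquivCohomologyClass.apply_eq_iff_eq, P.extEquivCohomologyClass_extMk,
        P.extEquivCohomologyClass_zero, CochainComplex.HomComplex.CohomologyClass.mk_eq_zero_iff,
        CochainComplex.HomComplex.Cocycle.toSingleMk_mem_coboundaries_iff _ _ _ _ _ 1 (by simp)] at h
      obtain ⟨w, hw⟩ := h
      have hz0 : IsZero (P.cochainComplex.X 1) := P.cochainComplex.isZero_of_isStrictlyLE 0 1 (by simp)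
      have : P.cochainComplex.d (-((0 : ℕ) : ℤ)) 1 = 0 := hz0.eq_of_tgt _ _
      rw [this, zero_comp] at hw
      have : z = 0 := by
        rw [← cancel_epi (P.cochainComplexXIso (-((0:ℕ):ℤ)) 0 rfl).hom, ← hw, comp_zero]
      exact ⟨0, by rw [this, comp_zero]⟩
    · rintro ⟨w, hw⟩
      have : z = 0 := by rw [← hw, h0, zero_comp]
      subst this
      exact P.extMk_zero _ _

noncomputable def clN : ((KY P Y).opcycles n).unop →ₗ[R] Abelian.Ext X Y n where
  toFun c := P.extMk (coc P Y n c) (n + 1) rfl (coc_zero P Y n c)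
  map_add' c c' := by
    rw [P.add_extMk]
    congr 1
    exact map_add (pO (KY P Y) n).hom c c'
  map_smul' r c := by
    rw [RingHom.id_apply, Abelian.Ext.smul_eq_comp_mk₀, P.extMk_comp_mk₀]
    congr 1
    rw [Linear.comp_smul, Category.comp_id]
    exact map_smul (pO (KY P Y) n).hom r c

lemma clN_surj : Function.Surjective (clN P Y n) := by
  intro α
  obtain ⟨f, hf, rfl⟩ := P.extMk_surjective α (n + 1) rfl
  obtain ⟨c, rfl⟩ := coc_lift P Y n f hf
  exact ⟨c, rfl⟩

lemma exists_eE : ∃ e : oE X Y n ≃ₗ[R] Abelian.Ext X Y n, ∀ c, e (clO P Y n c) = clN P Y n c :=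
  sur_equiv (clO P Y n).hom (clN P Y n) (clO_surj P Y n) (clN_surj P Y n) fun c =>
    (clO_eq_zero' P Y n c).trans (extMk_zero_iff P Y n _ (coc_zero P Y n c)).symm

/-- comparison of the two Exts -/
noncomputable def eE (X Y : ModuleCat.{u} R) (n : ℕ) : oE X Y n ≃ₗ[R] Abelian.Ext X Y n :=
  (exists_eE (projectiveResolution X) Y n).choose

lemma eE_nat (g : X ⟶ X') (a : oE X' Y n) :
    eE X Y n (((Ext R (ModuleCat.{u} R) n).map g.op).app Y a) = (Abelian.Ext.mk₀ g).comp (eE X' Y n a) (zero_add n) := by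
  let P := projectiveResolution X
  let P' := projectiveResolution X'
  have hP := (exists_eE P Y n).choose_spec
  have hP' := (exists_eE P' Y n).choose_spec
  obtain ⟨c, rfl⟩ := clO_surj P' Y n a
  have hcomm : (ProjectiveResolution.lift g P P').f 0 ≫ P'.π.f 0 = P.π.f 0 ≫ g :=
    ProjectiveResolution.lift_commutes_zero g P P'
  let φ : ProjectiveResolution.Hom P P' g := ⟨ProjectiveResolution.lift g P P', by
    rw [hcomm]; simp⟩
  have hnat := ProjectiveResolution.isoLeftDerivedObj_hom_naturality g P P' φ.hom hcomm (FY Y) n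
  let ψ := ((FY Y).mapHomologicalComplex (ComplexShape.down ℕ)).map φ.hom
  let oc : (KY P Y).opcycles n ⟶ (KY P' Y).opcycles n := HomologicalComplex.opcyclesMap ψ n
  have ha : ((Ext R (ModuleCat.{u} R) n).map g.op).app Y (clO P' Y n c) =
      (isoU P Y n).hom ((HomologicalComplex.homologyMap ψ n).unop (iO (KY P' Y) n c)) :=
    congrArg (fun t => t.unop (iO (KY P' Y) n c)) hnat
  have hb : (HomologicalComplex.homologyMap ψ n).unop (iO (KY P' Y) n c) = iO (KY P Y) n (oc.unop c) :=
    congrArg (fun t => t.unop c) (HomologicalComplex.homologyι_naturality ψ n)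
  have h2 : ((Ext R (ModuleCat.{u} R) n).map g.op).app Y (clO P' Y n c) = clO P Y n (oc.unop c) := by
    rw [ha, hb]; rfl
  have h3 : coc P Y n (oc.unop c) = φ.hom.f n ≫ coc P' Y n c :=
    congrArg (fun t => t.unop c) (HomologicalComplex.p_opcyclesMap ψ n)
  rw [h2]
  refine (hP _).trans ?_
  have h4 : eE X' Y n (clO P' Y n c) = clN P' Y n c := hP' c
  rw [h4]
  refine Eq.trans ?_ (ProjectiveResolution.mk₀_comp_extMk (coc P' Y n c) (n+1) rfl (coc_zero P' Y n c) φ).symm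
  have h5 : ∀ (z z' : P.complex.X n ⟶ Y) (hz hz'), z = z' → 
      P.extMk z (n+1) rfl hz = P.extMk z' (n+1) rfl hz' := by
    intro z z' hz hz' h; subst h; rfl
  exact h5 _ _ (coc_zero P Y n _) (h3 ▸ coc_zero P Y n _) h3

end old
end bridge
end GCAux

namespace GCAux
open CategoryTheory TensorProduct Limits
section lc
variable {R : Type u} [CommRing R]

lemma SD.of_semidualizing {C : Type u} [AddCommGroup C] [Module R C] (h : IsSemidualizing R C) : SD R C where
  fin := h.1
  hom := h.2.1
  pe := fun i => by
    have : Subsingleton (oE (ModuleCat.of R C) (ModuleCat.of R C) (i+1)) := h.2.2 (i+1) (by omega)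
    exact (eE (ModuleCat.of R C) (ModuleCat.of R C) (i+1)).symm.toEquiv.subsingleton

/-- the inverse system -/
noncomputable abbrev GJ (J : Ideal R) : ℕᵒᵖ ⥤ ModuleCat.{u} R :=
  localCohomology.ringModIdeals (localCohomology.idealPowersDiagram J)

noncomputable def preL {X X' : ModuleCat.{u} R} (Y : ModuleCat.{u} R) (i : ℕ) (g : X ⟶ X') :
    Abelian.Ext X' Y i →ₗ[R] Abelian.Ext X Y i where
  toFun y := (Abelian.Ext.mk₀ g).comp y (zero_add i)
  map_add' _ _ := by rw [Abelian.Ext.comp_add]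
  map_smul' _ _ := by rw [Abelian.Ext.comp_smul]; rfl

/-- the direct system with the new Ext -/
noncomputable def nD (J : Ideal R) (i : ℕ) (Y : ModuleCat.{u} R) : (ℕᵒᵖ)ᵒᵖ ⥤ ModuleCat.{u} R where
  obj t := ModuleCat.of R (Abelian.Ext ((GJ J).obj t.unop) Y i)
  map w := ModuleCat.ofHom (preL Y i ((GJ J).map w.unop))
  map_id t := by
    ext y
    simp [preL]
  map_comp v w := by
    ext y
    simp only [unop_comp, Functor.map_comp, preL, ModuleCat.hom_ofHom, ModuleCat.hom_comp, LinearMap.comp_apply, 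
      LinearMap.coe_mk, AddHom.coe_mk]
    exact (Abelian.Ext.mk₀_comp_mk₀_assoc _ _ _).symm

noncomputable def lcIso (J : Ideal R) (i : ℕ) (Y : ModuleCat.{u} R) :
    (localCohomology J i).obj Y ≅ colimit (nD J i Y) :=
  colimitObjIsoColimitCompEvaluation
    (localCohomology.diagram (localCohomology.idealPowersDiagram J) i) Y ≪≫
  HasColimit.isoOfNatIso (NatIso.ofComponents (fun t => (eE ((GJ J).obj t.unop) Y i).toModuleIso)
    (fun {s t} w => by
      ext a
      exact eE_nat Y i ((GJ J).map w.unop) a))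

end lc
end GCAux

namespace GCAux
open CategoryTheory TensorProduct Limits
section lc
variable {R : Type u} [CommRing R] {J : Ideal R}

/-- scalars acting bijectively on the target and nilpotently on the source -/
lemma ext_vanish {X Y : ModuleCat.{u} R} {r : R} (hX : ∀ a : X, r • a = 0)
    (hY : Function.Bijective (fun a : Y => r • a)) (i : ℕ) (z : Abelian.Ext X Y i) : z = 0 := by
  have h0 : ∀ z : Abelian.Ext X Y i, r • z = 0 := by
    intro z
    have h1 : r • 𝟙 X = 0 := by ext a; exact hX a
    have := Abelian.Ext.mk₀_smul (X := X) (Y := X) r (𝟙 X)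
    rw [h1, Abelian.Ext.mk₀_zero] at this
    have h2 := congrArg (fun t => t.comp z (zero_add i)) this
    simp only [Abelian.Ext.zero_comp, Abelian.Ext.smul_comp, Abelian.Ext.mk₀_id_comp] at h2
    exact h2.symm
  let e : Y ≃ₗ[R] Y := LinearEquiv.ofBijective (r • LinearMap.id) hY
  have h3 : ModuleCat.ofHom e.symm.toLinearMap ≫ (r • 𝟙 Y) = 𝟙 Y := by
    ext a
    exact e.apply_symm_apply a
  have h4 : (z.comp (Abelian.Ext.mk₀ (ModuleCat.ofHom e.symm.toLinearMap)) (add_zero i)).comp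
      (Abelian.Ext.mk₀ (r • 𝟙 Y)) (add_zero i) = z := by
    rw [Abelian.Ext.comp_assoc_of_third_deg_zero, Abelian.Ext.mk₀_comp_mk₀, h3, Abelian.Ext.comp_mk₀_id]
  rw [← Abelian.Ext.smul_eq_comp_mk₀, h0] at h4
  exact h4.symm

lemma GJ_kill {x : R} (hx : x ∈ J) (t : ℕᵒᵖ) (a : (GJ J).obj t) : x ^ t.unop • a = 0 := by
  obtain ⟨b, rfl⟩ := Ideal.Quotient.mk_surjective (I := J ^ t.unop) a
  change Ideal.Quotient.mk (J ^ t.unop) (x ^ t.unop * b) = 0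
  exact Ideal.Quotient.eq_zero_iff_mem.2 (Ideal.mul_mem_right _ _ (Ideal.pow_mem_pow hx _))

lemma pow_bij {Y : Type u} [AddCommGroup Y] [Module R Y] {x : R} (h : Function.Bijective (fun a : Y => x • a))
    (k : ℕ) : Function.Bijective (fun a : Y => x ^ k • a) := by
  induction k with
  | zero => simp only [pow_zero, one_smul]; exact Function.bijective_id
  | succ k ih =>
    have : (fun a : Y => x ^ (k+1) • a) = (fun a : Y => x ^ k • a) ∘ (fun a : Y => x • a) := by
      funext a; simp [pow_succ, mul_smul]
    rw [this]; exact ih.comp h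

noncomputable def conn {A B D : Type u} [AddCommGroup A] [AddCommGroup B] [AddCommGroup D]
    [Module R A] [Module R B] [Module R D] {f : A →ₗ[R] B} {g : B →ₗ[R] D} (h : SES f g) (X : ModuleCat.{u} R) (i : ℕ) :
    Abelian.Ext X (ModuleCat.of R D) i →ₗ[R] Abelian.Ext X (ModuleCat.of R A) (i + 1) where
  toFun z := z.comp h.shortExact.extClass rfl
  map_add' _ _ := by rw [Abelian.Ext.add_comp]
  map_smul' _ _ := by rw [Abelian.Ext.smul_comp]; rfl

lemma conn_bij {A B D : Type u} [AddCommGroup A] [AddCommGroup B] [AddCommGroup D]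
    [Module R A] [Module R B] [Module R D] {f : A →ₗ[R] B} {g : B →ₗ[R] D} (h : SES f g) (X : ModuleCat.{u} R) (i : ℕ)
    (hB : ∀ i (z : Abelian.Ext X (ModuleCat.of R B) i), z = 0) : Function.Bijective (conn h X i) := by
  constructor
  · rw [injective_iff_map_eq_zero]
    intro z hz
    obtain ⟨y, rfl⟩ := Abelian.Ext.covariant_sequence_exact₃ X h.shortExact z rfl hz
    have : y = 0 := hB i y
    rw [this, Abelian.Ext.zero_comp]
  · intro z
    exact Abelian.Ext.covariant_sequence_exact₁ X h.shortExact z (hB (i+1) _) rfl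

noncomputable def stepIso {x : R} (hxJ : x ∈ J) {A : Type u} [AddCommGroup A] [Module R A]
    (hx : IsSMulRegular A x) (i : ℕ) :
    colimit (nD J i (ModuleCat.of R (LL x ⊗[R] A))) ≅ colimit (nD J (i + 1) (ModuleCat.of R A)) :=
  HasColimit.isoOfNatIso (NatIso.ofComponents (fun t =>
    (LinearEquiv.ofBijective (conn (ses_jq hx) ((GJ J).obj t.unop) i)
      (conn_bij (ses_jq hx) _ i fun j z =>
        ext_vanish (GJ_kill hxJ t.unop) (pow_bij (x_bij x) _) j z)).toModuleIso)
    (fun {s t} w => by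
      ext a
      exact Abelian.Ext.comp_assoc _ _ _ (zero_add i) rfl (by omega)))

/-- evaluation at one -/
noncomputable def ev1 (J : Ideal R) (A : ModuleCat.{u} R) (t : ℕᵒᵖᵒᵖ) :
    Abelian.Ext ((GJ J).obj t.unop) A 0 →ₗ[R] A where
  toFun y := (Abelian.Ext.linearEquiv₀ (R := R) y).hom (Ideal.Quotient.mk (J ^ t.unop.unop) 1)
  map_add' _ _ := by rw [map_add]; rfl
  map_smul' _ _ := by rw [map_smul]; rfl

noncomputable def coc0 (J : Ideal R) (A : ModuleCat.{u} R) : Cocone (nD J 0 A) where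
  pt := A
  ι := 
  { app := fun t => ModuleCat.ofHom (ev1 J A t)
    naturality := by
      intro s t w
      ext y
      obtain ⟨f, rfl⟩ := (Abelian.Ext.linearEquiv₀ (R := R)).symm.surjective y
      have h1 : (nD J 0 A).map w ((Abelian.Ext.linearEquiv₀ (R := R)).symm f) = 
        (Abelian.Ext.linearEquiv₀ (R := R)).symm ((GJ J).map w.unop ≫ f) :=
          Abelian.Ext.mk₀_comp_mk₀ _ _
      change ev1 J A t ((nD J 0 A).map w ((Abelian.Ext.linearEquiv₀ (R := R)).symm f)) = ev1 J A s _
      rw [h1]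
      simp only [ev1, LinearMap.coe_mk, AddHom.coe_mk, LinearEquiv.apply_symm_apply]
      rfl }

lemma coc0_bij (J : Ideal R) (A : ModuleCat.{u} R) (hA : ∀ a : A, ∃ k, ∀ r ∈ J ^ k, r • a = 0) :
    Function.Bijective (colimit.desc _ (coc0 J A)) := by
  have hd : ∀ (t : ℕᵒᵖᵒᵖ) (y : (nD J 0 A).obj t),
      colimit.desc _ (coc0 J A) (colimit.ι (nD J 0 A) t y) = ev1 J A t y := by
    intro t y
    rw [← ConcreteCategory.comp_apply, colimit.ι_desc]; rfl
  have : PreservesFilteredColimitsOfSize.{0, 0} (forget (ModuleCat.{u} R)) :=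
    preservesFilteredColimitsOfSize_shrink.{0, u, 0, u} _
  constructor
  · rw [injective_iff_map_eq_zero]
    intro z hz
    obtain ⟨t, y, rfl⟩ := Concrete.colimit_exists_rep _ z
    have h : ev1 J A t y = 0 := by
      exact (hd t y).symm.trans hz
    obtain ⟨f, rfl⟩ := (Abelian.Ext.linearEquiv₀ (R := R)).symm.surjective y
    simp only [ev1, LinearMap.coe_mk, AddHom.coe_mk, LinearEquiv.apply_symm_apply] at h
    have : f = 0 := by
      ext a
      obtain ⟨b, rfl⟩ := Ideal.Quotient.mk_surjective (I := J ^ t.unop.unop) a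
      have h2 : Ideal.Quotient.mk (J ^ t.unop.unop) b = b • Ideal.Quotient.mk (J ^ t.unop.unop) 1 := by
        rw [← mul_one b, map_mul]; simp [Algebra.smul_def]
      have h3 := map_smul f.hom b (Ideal.Quotient.mk (J ^ t.unop.unop) 1)
      exact (congrArg f.hom h2).trans (h3.trans ((congrArg (fun c : A => b • c) h).trans (smul_zero b)))
    rw [this, map_zero]
    exact map_zero (colimit.ι (nD J 0 A) t).hom
  · intro a
    obtain ⟨k, hk⟩ := hA a
    let t : ℕᵒᵖᵒᵖ := Opposite.op (Opposite.op k)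
    let g : (R ⧸ J ^ k) →ₗ[R] A := Submodule.liftQ _ (LinearMap.toSpanSingleton R A a) (by
      intro r hr; exact hk r hr)
    let f : (GJ J).obj t.unop ⟶ A := ModuleCat.ofHom g
    refine ⟨colimit.ι (nD J 0 A) t ((Abelian.Ext.linearEquiv₀ (R := R)).symm f), ?_⟩
    refine (hd t _).trans ?_
    change (Abelian.Ext.linearEquiv₀ (R := R) ((Abelian.Ext.linearEquiv₀ (R := R)).symm f)).hom _ = _
    rw [LinearEquiv.apply_symm_apply]
    exact one_smul R a

lemma iter_lc [IsNoetherianRing R] [IsLocalRing R] (rs : List R) : ∀ (A : ModuleCat.{u} R)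
    (_ : ∀ x ∈ rs, x ∈ maximalIdeal R) (_ : RingTheory.Sequence.IsWeaklyRegular A rs)
    (_ : ∀ t : iter rs A, ∃ k, ∀ r ∈ maximalIdeal R ^ k, r • t = 0),
    Nonempty (colimit (nD (maximalIdeal R) rs.length A) ≅ iter rs A) := by
  induction rs with
  | nil =>
    intro A _ _ h
    exact ⟨(LinearEquiv.ofBijective (colimit.desc _ (coc0 _ A)).hom (coc0_bij _ A h)).toModuleIso⟩
  | cons x xs ih =>
    intro A hm hw h
    obtain ⟨hx, hw'⟩ := weak_LL hw
    obtain ⟨e⟩ := ih (ModuleCat.of R (LL x ⊗[R] A)) (fun y hy => hm y (List.mem_cons_of_mem _ hy)) hw' h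
    exact ⟨(stepIso (hm x List.mem_cons_self) hx xs.length).symm ≪≫ e⟩

end lc
end GCAux

namespace GCAux
open CategoryTheory TensorProduct Limits
section fin
variable {R : Type u} [CommRing R]

lemma resDim_le {pp : ModuleCat.{u} R → Prop} {A : ModuleCat.{u} R} {k : ℕ} (h : ResDimLE R pp k A) :
    ResDim R pp A ≤ k := sInf_le ⟨k, rfl, h⟩

lemma resDim_exists {pp : ModuleCat.{u} R → Prop} {A : ModuleCat.{u} R} (h : ResDim R pp A ≠ ⊤) :
    ∃ k : ℕ, ResDim R pp A = k ∧ ResDimLE R pp k A := by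
  have hne : {n : ℕ∞ | ∃ k : ℕ, (k : ℕ∞) = n ∧ ResDimLE R pp k A}.Nonempty := by
    by_contra hn
    rw [Set.not_nonempty_iff_eq_empty] at hn
    apply h
    rw [ResDim, hn, sInf_empty]
  obtain ⟨k, hk, h'⟩ := csInf_mem hne
  exact ⟨k, hk.symm, h'⟩

lemma resDim_add {pp qq : ModuleCat.{u} R → Prop} {A B : ModuleCat.{u} R} {n : ℕ}
    (h1 : ∀ k, ResDimLE R pp k A → ResDimLE R qq (k + n) B)
    (h2 : ∀ d, ResDimLE R qq d B → ∃ d', d = d' + n ∧ ResDimLE R pp d' A) :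
    (ResDim R pp A ≠ ⊤ ↔ ResDim R qq B ≠ ⊤) ∧ ResDim R qq B = ResDim R pp A + n := by
  have key : ResDim R qq B = ResDim R pp A + n := by
    apply le_antisymm
    · by_cases h : ResDim R pp A = ⊤
      · rw [h]; simp
      · obtain ⟨k, hk, hk'⟩ := resDim_exists h
        rw [hk]
        exact_mod_cast resDim_le (h1 k hk')
    · by_cases h : ResDim R qq B = ⊤
      · rw [h]; exact le_top
      · obtain ⟨d, hd, hd'⟩ := resDim_exists h
        obtain ⟨d', rfl, h3⟩ := h2 d hd'
        rw [hd, Nat.cast_add]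
        exact add_le_add_left (resDim_le h3) _
  refine ⟨?_, key⟩
  rw [key]
  simp

theorem main [IsNoetherianRing R] [IsLocalRing R]
    (C : Type u) [AddCommGroup C] [Module R C] (hC : IsSemidualizing R C)
    (M : Type u) [AddCommGroup M] [Module R M] [Module.Finite R M]
    (hM : Nontrivial M) (n : ℕ) (hdim : moduleDim R M = (n : WithBot ℕ∞))
    (hCM : IsCohenMacaulayModule R M) :
    (GCprojDim R C M ≠ ⊤ ↔ GCflatDim R C (lcoh R (maximalIdeal R) n M) ≠ ⊤) ∧
    GCflatDim R C (lcoh R (maximalIdeal R) n M) = GCprojDim R C M + n := by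
  have hS := SD.of_semidualizing hC
  obtain ⟨rs, rfl, hm, hw, hr⟩ := exists_seq M n hdim hCM
  obtain ⟨e⟩ := iter_lc rs (ModuleCat.of R M) hm hw (iter_tors rs (ModuleCat.of R M) hr)
  let E := (lcIso (maximalIdeal R) rs.length (ModuleCat.of R M) ≪≫ e).toLinearEquiv
  have : Module.Finite R (ModuleCat.of R M) := inferInstanceAs (Module.Finite R M)
  refine resDim_add (fun k hk => ?_) (fun d hd => ?_)
  · refine (resDimD_iff hS _ _).2 ?_
    have h1 := (syzP_iff_syzD hS k (ModuleCat.of R M)).1 ((resDimP_iff hS _ _).1 hk)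
    exact (iter_up hS rs k _ hw h1).congr (resD hS) E.symm
  · have h1 := ((resDimD_iff hS _ _).1 hd).congr (resD hS) E
    obtain ⟨d', hd', h3⟩ := iter_down hS rs d M hm hw h1
    exact ⟨d', hd', (resDimP_iff hS _ _).2 h3⟩

end fin
end GCAux

/-- **Proposition 4.5.** Let `C` be a semidualizing module over a Noetherian local ring
`R` and let `M` be a non-zero finitely generated Cohen-Macaulay module of dimension `n`.
Then `G_C-pd_R M` is finite iff `G_C-fd_R H^n_𝔪(M)` is finite; furthermore
`G_C-fd_R H^n_𝔪(M) = G_C-pd_R M + n`. -/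
theorem GCflatDim_localCohomology_eq_GCprojDim_add
    (R : Type u) [CommRing R] [IsNoetherianRing R] [IsLocalRing R]
    (C : Type u) [AddCommGroup C] [Module R C] (hC : IsSemidualizing R C)
    (M : Type u) [AddCommGroup M] [Module R M] [Module.Finite R M]
    (hM : Nontrivial M) (n : ℕ) (hdim : moduleDim R M = (n : WithBot ℕ∞))
    (hCM : IsCohenMacaulayModule R M) :
    (GCprojDim R C M ≠ ⊤ ↔ GCflatDim R C (lcoh R (maximalIdeal R) n M) ≠ ⊤) ∧
    GCflatDim R C (lcoh R (maximalIdeal R) n M) = GCprojDim R C M + n := by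
  exact GCAux.main C hC M hM n hdim hCM
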